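/- arXiv:1706.08645 — 10 statements merged into one kernel-verified Lean document; each statement's English description precedes it below -/
import Mathlib

section
/- Let k be an algebraically closed field of characteristic zero, let n ≥ 2 and d ≥ 2 be integers, and let f_1, …, f_n ∈ k[x_1, …, x_n] be homogeneous polynomials of degree d whose only common zero in k^n is the origin. Then the Jacobian determinant jac(f) := det(∂f_i/∂x_j)_{1 ≤ i,j ≤ n} does not belong to the ideal (f_1, …, f_n) of k[x_1, …, x_n]. -/
open MvPolynomial in
theorem mem_span_X_pow_image {σ R : Type*} [CommRing R] {e : σ → ℕ} {S : Set σ}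
    {p : MvPolynomial σ R} :
    p ∈ Ideal.span ((fun i => (X i ^ e i : MvPolynomial σ R)) '' S) ↔
      ∀ m ∈ p.support, ∃ i ∈ S, e i ≤ m i := by
  have h : (fun i => (X i ^ e i : MvPolynomial σ R)) '' S =
      (fun s => monomial s (1 : R)) '' ((fun i => Finsupp.single i (e i)) '' S) := by
    simp only [Set.image_image, X_pow_eq_monomial]
  rw [h, mem_ideal_span_monomial_image]
  simp

open MvPolynomial in
theorem mem_span_X_pow_image_of_X_mul_mem {σ R : Type*} [CommRing R] {e : σ → ℕ} {S : Set σ}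
    {p : MvPolynomial σ R} {i : σ} (hi : i ∉ S)
    (h : X i * p ∈ Ideal.span ((fun j => (X j ^ e j : MvPolynomial σ R)) '' S)) :
    p ∈ Ideal.span ((fun j => (X j ^ e j : MvPolynomial σ R)) '' S) := by
  rw [mem_span_X_pow_image] at h ⊢
  intro m hm
  obtain ⟨j, hj, hle⟩ := h (Finsupp.single i 1 + m) (by simpa [coeff_X_mul] using hm)
  have hij : i ≠ j := fun hij => hi (hij ▸ hj)
  exact ⟨j, hj, by simpa [Finsupp.single_apply, hij] using hle⟩

/-- Cramer's rule modulo an ideal. -/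
theorem Matrix.mul_det_mem_of_mulVec_mem {ι R : Type*} [Fintype ι] [DecidableEq ι] [CommRing R]
    (A : Matrix ι ι R) (x : ι → R) {I : Ideal R} (h : ∀ j, (A.mulVec x) j ∈ I) (i : ι) :
    x i * A.det ∈ I := by
  have hx : A.adjugate.mulVec (A.mulVec x) = A.det • x := by
    rw [Matrix.mulVec_mulVec, Matrix.adjugate_mul, Matrix.smul_mulVec, Matrix.one_mulVec]
  have hi := congrFun hx i
  rw [Pi.smul_apply, smul_eq_mul, mul_comm] at hi
  rw [← hi]
  exact I.sum_mem fun j _ => I.mul_mem_left _ (h j)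

open MvPolynomial in
/-- Two matrices carrying the variables to the same pure powers have congruent determinants. -/
theorem det_sub_det_mem_span_X_pow {ι R : Type*} [Fintype ι] [DecidableEq ι] [CommRing R]
    (e : ι → ℕ) (A B : Matrix ι ι (MvPolynomial ι R))
    (hA : A.mulVec X = fun i => X i ^ e i) (hB : B.mulVec X = fun i => X i ^ e i) :
    A.det - B.det ∈ Ideal.span (Set.range fun i => (X i ^ e i : MvPolynomial ι R)) := by
  let H : Finset ι → Matrix ι ι (MvPolynomial ι R) :=
    fun s => Matrix.of fun i => if i ∈ s then A i else B i
  have hH : ∀ s, (H s).mulVec X = fun i => X i ^ e i := by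
    intro s
    ext1 i
    by_cases his : i ∈ s
    · simpa [H, Matrix.mulVec, his] using congrFun hA i
    · simpa [H, Matrix.mulVec, his] using congrFun hB i
  have key : ∀ s, (H s).det - B.det ∈
      Ideal.span (Set.range fun i => (X i ^ e i : MvPolynomial ι R)) := by
    intro s
    induction s using Finset.induction_on with
    | empty =>
      have : H ∅ = B := by ext1; simp [H]
      simp [this]
    | insert i s his ih =>
      have h₁ : H (insert i s) = (H s).updateRow i (B i + (A i - B i)) := by
        ext j l : 2
        by_cases hj : j = i
        · subst hj; simp [H]
        · simp [H, hj]
      have h₂ : (H s).updateRow i (B i) = H s := by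
        ext j l : 2
        by_cases hj : j = i
        · subst hj; simp [H, his]
        · simp [hj]
      rw [h₁, Matrix.det_updateRow_add, h₂, add_sub_right_comm]
      refine Ideal.add_mem _ ih ?_
      have hsub : (fun j => (X j ^ e j : MvPolynomial ι R)) '' {i}ᶜ ⊆
          Set.range fun j => (X j ^ e j : MvPolynomial ι R) := Set.image_subset_range _ _
      refine Ideal.span_mono hsub
        (mem_span_X_pow_image_of_X_mul_mem (i := i) (by simp)
          (Matrix.mul_det_mem_of_mulVec_mem _ X (fun j => ?_) i))
      by_cases hj : j = i
      · subst hj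
        have hz : (A j - B j) ⬝ᵥ (X : ι → MvPolynomial ι R) = 0 := by
          rw [sub_dotProduct, sub_eq_zero]
          exact (congrFun hA j).trans (congrFun hB j).symm
        simp only [Matrix.mulVec, Matrix.updateRow_self]
        exact hz ▸ Ideal.zero_mem _
      · have := congrFun (hH s) j
        simp only [Matrix.mulVec] at this
        simp only [Matrix.mulVec, Matrix.updateRow_ne hj, this]
        exact Ideal.subset_span ⟨j, hj, rfl⟩
  have hu : H Finset.univ = A := by ext1; simp [H]
  simpa [hu] using key Finset.univ

open MvPolynomial in
theorem prod_X_pow_notMem_span_X_pow_succ {ι R : Type*} [Fintype ι] [CommRing R] [Nontrivial R]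
    (e : ι → ℕ) :
    (∏ i, X i ^ e i : MvPolynomial ι R) ∉
      Ideal.span (Set.range fun i => (X i ^ (e i + 1) : MvPolynomial ι R)) := by
  classical
  have hprod : (∏ i, X i ^ e i : MvPolynomial ι R) =
      monomial (Finsupp.equivFunOnFinite.symm e) 1 := by
    rw [monomial_eq, Finsupp.prod_fintype _ _ (by simp)]
    simp
  rw [← Set.image_univ, mem_span_X_pow_image (e := fun i => e i + 1), hprod]
  intro h
  obtain ⟨i, -, hi⟩ := h (Finsupp.equivFunOnFinite.symm e) (by simp [mem_support_iff])
  simp at hi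

open MvPolynomial in
/-- If `f = A x` and the ideal `(f)` contains a power of every variable, then `det A ∉ (f)`. -/
theorem det_notMem_span_of_mulVec_X {ι R : Type*} [Fintype ι] [DecidableEq ι] [CommRing R]
    [Nontrivial R] (f : ι → MvPolynomial ι R) (A : Matrix ι ι (MvPolynomial ι R))
    (hA : A.mulVec X = f) (e : ι → ℕ) (he : ∀ i, X i ^ (e i + 1) ∈ Ideal.span (Set.range f)) :
    A.det ∉ Ideal.span (Set.range f) := by
  intro hdet
  choose b hb using fun i => Ideal.mem_span_range_iff_exists_fun.1 (he i)
  let B : Matrix ι ι (MvPolynomial ι R) := Matrix.of b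
  have hBf : B.mulVec f = fun i => X i ^ (e i + 1) := funext hb
  set J := Ideal.span (Set.range fun i => (X i ^ (e i + 1) : MvPolynomial ι R))
  have hfB : ∀ i, f i * B.det ∈ J := Matrix.mul_det_mem_of_mulVec_mem B f fun j => by
    rw [hBf]
    exact Ideal.subset_span ⟨j, rfl⟩
  have hBA : (B * A).det ∈ J := by
    obtain ⟨c, hc⟩ := Ideal.mem_span_range_iff_exists_fun.1 hdet
    rw [Matrix.det_mul, ← hc, Finset.mul_sum]
    refine J.sum_mem fun i _ => ?_
    rw [mul_left_comm, mul_comm B.det]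
    exact J.mul_mem_left _ (hfB i)
  have hdiag := det_sub_det_mem_span_X_pow (fun i => e i + 1) (B * A)
    (Matrix.diagonal fun i => X i ^ e i)
    (by rw [← Matrix.mulVec_mulVec, hA, hBf])
    (by ext1 i; rw [Matrix.mulVec_diagonal, pow_succ])
  refine prod_X_pow_notMem_span_X_pow_succ (R := R) e ?_
  simpa using J.sub_mem hBA hdiag

open MvPolynomial in
/-- A consequence of the Nullstellensatz. -/
theorem exists_X_pow_succ_mem_span {k ι : Type*} [Field k] [IsAlgClosed k] [Finite ι]
    (f : ι → MvPolynomial ι k)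
    (hzero : ∀ x : ι → k, (∀ i, MvPolynomial.eval x (f i) = 0) → x = 0) (i : ι) :
    ∃ m : ℕ, X i ^ (m + 1) ∈ Ideal.span (Set.range f) := by
  have h : X i ∈ (Ideal.span (Set.range f)).radical := by
    rw [← vanishingIdeal_zeroLocus_eq_radical (K := k), mem_vanishingIdeal_iff]
    intro x hx
    have hx0 : x = 0 := hzero x fun j => by
      simpa [aeval_eq_eval] using hx (f j) (Ideal.subset_span ⟨j, rfl⟩)
    simp [hx0]
  obtain ⟨m, hm⟩ := h
  exact ⟨m, Ideal.pow_mem_of_pow_mem _ hm (Nat.le_succ m)⟩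

/-- For homogeneous `f_1, …, f_n` of degree `d ≥ 2` over an algebraically closed field of
characteristic zero whose only common zero is the origin, the Jacobian determinant
`det(∂f_i/∂x_j)` does not belong to the ideal `(f_1, …, f_n)`. -/
theorem stmt_1 {k : Type*} [Field k] [IsAlgClosed k] [CharZero k]
    (n d : ℕ) (hn : 2 ≤ n) (hd : 2 ≤ d)
    (f : Fin n → MvPolynomial (Fin n) k)
    (hf : ∀ i, (f i).IsHomogeneous d)
    (hzero : ∀ x : Fin n → k, (∀ i, MvPolynomial.eval x (f i) = 0) → x = 0) :
    (Matrix.of fun i j => MvPolynomial.pderiv j (f i)).det ∉ Ideal.span (Set.range f) := by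
  have hd0 : (d : k) ≠ 0 := Nat.cast_ne_zero.2 (by omega)
  have hspan : ∀ i, f i ∈ Ideal.span (Set.range fun i => d • f i) := fun i => by
    have h : f i = MvPolynomial.C (d : k)⁻¹ * (d • f i) := by
      rw [nsmul_eq_mul, ← mul_assoc, ← map_natCast (MvPolynomial.C (σ := Fin n) (R := k)),
        ← map_mul, inv_mul_cancel₀ hd0, map_one, one_mul]
    rw [h]
    exact Ideal.mul_mem_left _ _ (Ideal.subset_span ⟨i, rfl⟩)
  have hle : Ideal.span (Set.range f) ≤ Ideal.span (Set.range fun i => d • f i) :=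
    Ideal.span_le.2 (Set.range_subset_iff.2 hspan)
  choose e he using exists_X_pow_succ_mem_span f hzero
  refine fun h => det_notMem_span_of_mulVec_X (fun i => d • f i) _ ?_ e
    (fun i => hle (he i)) (hle h)
  ext1 i
  rw [← (hf i).sum_X_mul_pderiv]
  simp [Matrix.mulVec, dotProduct, mul_comm]
end

section
/- Let k be an algebraically closed field of characteristic zero, let n ≥ 2 and d ≥ 2 be integers, and let f_1, …, f_n ∈ k[x_1, …, x_n] be homogeneous polynomials of degree d whose only common zero in k^n is the origin. Let ρ be an integer with 0 ≤ ρ ≤ n(d−1)−d, and let h_1, …, h_n ∈ k[x_1, …, x_n] be homogeneous of degree ρ. Then h_1 f_1 + ⋯ + h_n f_n = 0 if and only if there exists a skew-symmetric n×n matrix D = (D_{ij}) with entries in k[x_1, …, x_n], each entry homogeneous of degree ρ − d (interpreted as 0 when ρ < d), such that D_{ij} = −D_{ji} for all i, j and h_j = Σ_{i=1}^n f_i D_{ij} for all j. -/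
open IsLocalRing RingTheory.Sequence

theorem Ideal.IsPrime.eq_of_lt_of_mem_minimalPrimes_sup_span_singleton {A : Type*} [CommRing A]
    [IsNoetherianRing A] {p q m : Ideal A} [p.IsPrime] [q.IsPrime] {x : A}
    (hm : m ∈ (p ⊔ Ideal.span {x}).minimalPrimes) (hpq : p < q) (hqm : q ≤ m) : q = m := by
  have := hm.isPrime
  by_contra hne
  have hlt : q < m := lt_of_le_of_ne hqm hne
  have h1 := Ideal.map_height_le_one_of_mem_minimalPrimes hm
  have : (q.map (Ideal.Quotient.mk p)).IsPrime := Ideal.isPrime_map_quotientMk_of_isPrime hpq.le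
  have : (m.map (Ideal.Quotient.mk p)).IsPrime :=
    Ideal.isPrime_map_quotientMk_of_isPrime (hpq.le.trans hqm)
  have hlt' : q.map (Ideal.Quotient.mk p) < m.map (Ideal.Quotient.mk p) := by
    refine lt_of_le_of_ne (Ideal.map_mono hqm) fun h ↦ hne ?_
    have := congrArg (Ideal.comap (Ideal.Quotient.mk p)) h
    rwa [Ideal.comap_map_mk hpq.le, Ideal.comap_map_mk (hpq.le.trans hqm)] at this
  have hlt0 : ⊥ < q.map (Ideal.Quotient.mk p) := by
    rw [bot_lt_iff_ne_bot]
    intro h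
    have := (Ideal.map_eq_bot_iff_le_ker _).mp h
    rw [Ideal.mk_ker] at this
    exact hpq.not_ge this
  have h2 := Ideal.height_add_one_le_of_lt_of_isPrime hlt'
  have h3 := Ideal.height_add_one_le_of_lt_of_isPrime hlt0
  have := (add_le_add_left h3 1).trans (h2.trans h1)
  simp at this
  norm_num at this

theorem isWeaklyRegular_cons_iff_quotient {A : Type*} [CommRing A] {b : A} {rs : List A} :
    IsWeaklyRegular A (b :: rs) ↔ IsSMulRegular A b ∧
    IsWeaklyRegular (A ⧸ Ideal.span {b}) (rs.map (Ideal.Quotient.mk (Ideal.span {b}))) := by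
  rw [isWeaklyRegular_cons_iff]
  have := isWeaklyRegular_map_algebraMap_iff (M := A ⧸ Ideal.span {b}) (A ⧸ Ideal.span {b}) rs
  erw [this]
  have e : QuotSMulTop b A ≃ₗ[A] A ⧸ Ideal.span {b} :=
    Submodule.quotEquivOfEq _ _ (by rw [← Submodule.ideal_span_singleton_smul]; simp)
  rw [e.isWeaklyRegular_congr]

theorem isSMulRegular_quotient_smul_top_of_pow_mem_sup {A : Type*} [CommRing A] {I : Ideal A}
    {b f : A} (hb : IsSMulRegular (A ⧸ (I • ⊤ : Submodule A A)) b) {N : ℕ}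
    (h : b ^ N ∈ I ⊔ Ideal.span {f}) : IsSMulRegular (A ⧸ (I • ⊤ : Submodule A A)) f := by
  have hI : (I • ⊤ : Submodule A A) = I := by simp
  rw [isSMulRegular_quotient_iff_mem_of_smul_mem, hI]
  intro u hu
  have hbN := (isSMulRegular_quotient_iff_mem_of_smul_mem _ _).mp (hb.pow N) u
  rw [hI] at hbN
  refine hbN ?_
  obtain ⟨y, hy, z, hz, hyz⟩ := Submodule.mem_sup.mp h
  obtain ⟨c, rfl⟩ := Ideal.mem_span_singleton'.mp hz
  rw [← hyz, smul_eq_mul, add_mul, mul_assoc]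
  exact I.add_mem (I.mul_mem_right _ hy) (I.mul_mem_left _ hu)

theorem IsLocalRing.exists_mem_maximalIdeal_forall_notMem {A : Type*} [CommRing A]
    [IsLocalRing A] {S : Set (Ideal A)} (hS : S.Finite) (hprime : ∀ p ∈ S, p.IsPrime)
    (hne : ∀ p ∈ S, p ≠ maximalIdeal A) : ∃ b ∈ maximalIdeal A, ∀ p ∈ S, b ∉ p := by
  by_contra! H
  have hsub : (maximalIdeal A : Set A) ⊆ ⋃ p ∈ (hS.toFinset : Set (Ideal A)), (p : Set A) := by
    intro b hb
    obtain ⟨p, hp, hbp⟩ := H b hb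
    simp only [Set.Finite.coe_toFinset, Set.mem_iUnion]
    exact ⟨p, hp, hbp⟩
  rw [Ideal.subset_union_prime (f := fun p : Ideal A ↦ p) ⊥ ⊥
    fun p hp _ _ ↦ hprime p (hS.mem_toFinset.mp hp)] at hsub
  obtain ⟨p, hp, hle⟩ := hsub
  rw [hS.mem_toFinset] at hp
  exact hne p hp (le_antisymm (le_maximalIdeal (hprime p hp).ne_top) hle)

/-- In a Noetherian local ring with a weakly regular sequence of length `n` in the maximal ideal,
any `n` elements generating an ideal primary to the maximal ideal form a weakly regular
sequence. -/
theorem IsLocalRing.isWeaklyRegular_of_forall_isPrime_eq_maximalIdeal {A : Type*} [CommRing A]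
    [IsLocalRing A] [IsNoetherianRing A] {rs fs : List A} (hlen : rs.length = fs.length)
    (hrs : ∀ r ∈ rs, r ∈ maximalIdeal A) (hreg : IsWeaklyRegular A rs)
    (hfs : ∀ f ∈ fs, f ∈ maximalIdeal A)
    (hmax : ∀ p : Ideal A, p.IsPrime → (∀ f ∈ fs, f ∈ p) → p = maximalIdeal A) :
    IsWeaklyRegular A fs := by
  obtain ⟨n, hn⟩ : ∃ n, fs.length = n := ⟨_, rfl⟩
  induction n generalizing A with
  | zero =>
    rw [List.length_eq_zero_iff] at hn
    subst hn
    exact .nil A A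
  | succ n ih =>
    obtain ⟨rs, a, rfl⟩ : ∃ rs' a, rs = rs' ++ [a] := by
      rcases List.eq_nil_or_concat rs with rfl | ⟨l, a, rfl⟩
      · simp at hlen; omega
      · exact ⟨l, a, by simp⟩
    obtain ⟨fs, f, rfl⟩ : ∃ fs' f, fs = fs' ++ [f] := by
      rcases List.eq_nil_or_concat fs with rfl | ⟨l, a, rfl⟩
      · simp at hn
      · exact ⟨l, a, by simp⟩
    simp only [List.length_append, List.length_cons, List.length_nil, List.mem_append,
      List.mem_singleton] at hlen hn hrs hfs hmax
    rw [isWeaklyRegular_append_iff, isWeaklyRegular_singleton_iff] at hreg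
    have hass := biUnion_associatedPrimes_eq_compl_regular
      (A ⧸ (Ideal.ofList rs • ⊤ : Submodule A A)) (R := A)
    obtain ⟨b, hbm, hb⟩ : ∃ b ∈ maximalIdeal A,
        ∀ p ∈ associatedPrimes A (A ⧸ (Ideal.ofList rs • ⊤ : Submodule A A)) ∪
          {p ∈ (Ideal.ofList fs).minimalPrimes | p ≠ maximalIdeal A}, b ∉ p := by
      refine exists_mem_maximalIdeal_forall_notMem
        ((associatedPrimes.finite A _).union
          ((Ideal.finite_minimalPrimes_of_isNoetherianRing A _).subset (Set.sep_subset _ _))) ?_ ?_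
      · rintro p (hp | hp)
        · exact hp.isPrime
        · exact hp.1.isPrime
      · rintro p (hp | hp)
        · rintro rfl
          have : a ∈ ({r : A | IsSMulRegular (A ⧸ (Ideal.ofList rs • ⊤ : Submodule A A)) r}ᶜ) := by
            rw [← hass]
            exact Set.mem_biUnion hp (hrs a (.inr rfl))
          exact this hreg.2
        · exact hp.2
    have hbreg : IsWeaklyRegular A (rs ++ [b]) := by
      rw [isWeaklyRegular_append_iff, isWeaklyRegular_singleton_iff]
      refine ⟨hreg.1, ?_⟩
      by_contra hcon
      have : b ∈ ({r : A | IsSMulRegular (A ⧸ (Ideal.ofList rs • ⊤ : Submodule A A)) r}ᶜ) := hcon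
      rw [← hass] at this
      simp only [Set.mem_iUnion] at this
      obtain ⟨p, hp, hbp⟩ := this
      exact hb p (.inl hp) hbp
    have hbreg' : IsWeaklyRegular A (b :: rs) :=
      isWeaklyRegular_of_perm_of_subset_maximalIdeal hbreg
        (List.perm_append_singleton b rs) (by
          intro r hr
          rcases List.mem_append.mp hr with hr | hr
          · exact hrs r (.inl hr)
          · rwa [List.mem_singleton.mp hr])
    rw [isWeaklyRegular_cons_iff_quotient] at hbreg'
    have hbtop : Ideal.span {b} ≠ ⊤ := fun h ↦
      (maximalIdeal.isMaximal A).ne_top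
        (top_le_iff.mp (h ▸ (Ideal.span_singleton_le_iff_mem _).mpr hbm))
    have : Nontrivial (A ⧸ Ideal.span {b}) := Ideal.Quotient.nontrivial_iff.mpr hbtop
    have hloc : IsLocalRing (A ⧸ Ideal.span {b}) :=
      .of_surjective' _ Ideal.Quotient.mk_surjective
    have hcomap : (maximalIdeal (A ⧸ Ideal.span {b})).comap (Ideal.Quotient.mk _) =
        maximalIdeal A :=
      eq_maximalIdeal (Ideal.comap_isMaximal_of_surjective _ Ideal.Quotient.mk_surjective)
    have hmem (x : A) (hx : x ∈ maximalIdeal A) :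
        Ideal.Quotient.mk (Ideal.span {b}) x ∈ maximalIdeal (A ⧸ Ideal.span {b}) := by
      rwa [← hcomap] at hx
    have hquot : IsWeaklyRegular A (b :: fs) := by
      rw [isWeaklyRegular_cons_iff_quotient]
      refine ⟨hbreg'.1, ih (rs := rs.map (Ideal.Quotient.mk _)) (by simpa using hlen) ?_
        hbreg'.2 ?_ ?_ (by simpa using hn)⟩
      · intro r hr
        obtain ⟨x, hx, rfl⟩ := List.mem_map.mp hr
        exact hmem x (hrs x (.inl hx))
      · intro r hr
        obtain ⟨x, hx, rfl⟩ := List.mem_map.mp hr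
        exact hmem x (hfs x (.inl hx))
      · intro q hq hfq
        have hq' := hq.comap (Ideal.Quotient.mk (Ideal.span {b}))
        have hbq : b ∈ q.comap (Ideal.Quotient.mk (Ideal.span {b})) := by
          rw [Ideal.mem_comap, Ideal.Quotient.eq_zero_iff_mem.mpr (Ideal.mem_span_singleton_self b)]
          exact q.zero_mem
        have hfq' : Ideal.ofList fs ≤ q.comap (Ideal.Quotient.mk (Ideal.span {b})) :=
          Ideal.span_le.mpr fun r hr ↦ hfq _ (List.mem_map_of_mem hr)
        obtain ⟨p, hp, hpq⟩ := Ideal.exists_minimalPrimes_le hfq'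
        have hqm := le_maximalIdeal hq'.ne_top
        have hpp := hp.isPrime
        have key : q.comap (Ideal.Quotient.mk (Ideal.span {b})) = maximalIdeal A := by
          by_cases hpm : p = maximalIdeal A
          · exact le_antisymm hqm (hpm ▸ hpq)
          · refine Ideal.IsPrime.eq_of_lt_of_mem_minimalPrimes_sup_span_singleton (p := p) (x := f)
              ⟨⟨inferInstance, sup_le (hpq.trans hqm) ?_⟩, ?_⟩
              (lt_of_le_of_ne hpq fun h ↦ hb p (.inr ⟨hp, hpm⟩) (h ▸ hbq)) hqm
            · exact (Ideal.span_singleton_le_iff_mem _).mpr (hfs f (.inr rfl))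
            · rintro J ⟨hJ, hle⟩ -
              refine (hmax J hJ ?_).ge
              rintro g (hg | rfl)
              · exact hle (Ideal.mem_sup_left (hp.1.2 (Ideal.subset_span hg)))
              · exact hle (Ideal.mem_sup_right (Ideal.mem_span_singleton_self _))
        rw [← hcomap] at key
        exact Ideal.comap_injective_of_surjective _ Ideal.Quotient.mk_surjective key
    have hfb : IsWeaklyRegular A (fs ++ [b]) :=
      isWeaklyRegular_of_perm_of_subset_maximalIdeal hquot
        (List.perm_append_singleton b fs).symm (by
          intro r hr
          rcases List.mem_cons.mp hr with rfl | hr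
          · exact hbm
          · exact hfs r (.inl hr))
    rw [isWeaklyRegular_append_iff, isWeaklyRegular_singleton_iff] at hfb ⊢
    have hrad : b ∈ (Ideal.ofList fs ⊔ Ideal.span {f}).radical := by
      rw [Ideal.radical_eq_sInf, Submodule.mem_sInf]
      rintro p ⟨hle, hp⟩
      rw [hmax p hp]
      · exact hbm
      · rintro g (hg | rfl)
        · exact hle (Ideal.mem_sup_left (Ideal.subset_span hg))
        · exact hle (Ideal.mem_sup_right (Ideal.mem_span_singleton_self _))
    obtain ⟨N, hN⟩ := hrad
    exact ⟨hfb.1, isSMulRegular_quotient_smul_top_of_pow_mem_sup hfb.2 hN⟩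

/-- Every syzygy of a weakly regular sequence is a Koszul syzygy. -/
theorem RingTheory.Sequence.IsWeaklyRegular.exists_skew_of_sum_mul_eq_zero {A : Type*}
    [CommRing A] {n : ℕ} {f h : Fin n → A} (hf : IsWeaklyRegular A (List.ofFn f))
    (hsum : ∑ i, h i * f i = 0) :
    ∃ D : Fin n → Fin n → A, (∀ i j, D i j = -D j i) ∧ ∀ j, h j = ∑ i, f i * D i j := by
  induction n with
  | zero => exact ⟨fun _ _ ↦ 0, fun i ↦ i.elim0, fun j ↦ j.elim0⟩
  | succ n ih =>
    rw [List.ofFn_succ', List.concat_eq_append, isWeaklyRegular_append_iff,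
      isWeaklyRegular_singleton_iff, isSMulRegular_quotient_iff_mem_of_smul_mem] at hf
    have hI : (Ideal.ofList (List.ofFn fun i : Fin n ↦ f i.castSucc) • ⊤ : Submodule A A) =
        Ideal.span (Set.range fun i : Fin n ↦ f i.castSucc) := by
      rw [smul_eq_mul, Ideal.mul_top]
      exact congrArg Ideal.span (Set.ext fun x ↦ List.mem_ofFn' _ x)
    rw [hI] at hf
    rw [Fin.sum_univ_castSucc] at hsum
    have hmem := hf.2 (h (Fin.last n)) (by
      rw [smul_eq_mul, mul_comm, ← neg_eq_of_add_eq_zero_right hsum]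
      exact neg_mem (Ideal.sum_mem _ fun i _ ↦
        Ideal.mul_mem_left _ _ (Ideal.subset_span ⟨i, rfl⟩)))
    obtain ⟨c, hc⟩ := (Ideal.mem_span_range_iff_exists_fun).mp hmem
    obtain ⟨D, hD, hhD⟩ := ih hf.1 (h := fun i ↦ h i.castSucc + c i * f (Fin.last n)) (by
      rw [← hsum, ← hc, Finset.sum_mul, ← Finset.sum_add_distrib]
      exact Finset.sum_congr rfl fun i _ ↦ by ring)
    refine ⟨Fin.lastCases (Fin.lastCases 0 fun j ↦ -c j)
      fun i ↦ Fin.lastCases (c i) fun j ↦ D i j, ?_, ?_⟩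
    · intro i j
      induction i using Fin.lastCases <;> induction j using Fin.lastCases <;>
        simp [← hD]
    · intro j
      induction j using Fin.lastCases with
      | last => simp [Fin.sum_univ_castSucc, ← hc, mul_comm]
      | cast j =>
        simp only [Fin.sum_univ_castSucc, Fin.lastCases_castSucc, Fin.lastCases_last, ← hhD]
        ring

namespace MvPolynomial

theorem isWeaklyRegular_ofFn_X (R : Type*) [CommRing R] (n : ℕ) :
    IsWeaklyRegular (MvPolynomial (Fin n) R)
      (List.ofFn (X : Fin n → MvPolynomial (Fin n) R)) := by
  constructor
  intro i hi
  rw [List.length_ofFn] at hi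
  have hI : (Ideal.ofList ((List.ofFn (X : Fin n → MvPolynomial (Fin n) R)).take i) • ⊤ :
      Submodule (MvPolynomial (Fin n) R) (MvPolynomial (Fin n) R)) =
      Ideal.span (X '' {j : Fin n | (j : ℕ) < i}) := by
    rw [smul_eq_mul, Ideal.mul_top]
    refine congrArg Ideal.span (Set.ext fun x ↦ ?_)
    simp only [Set.mem_ofPred_eq, List.mem_take_iff_getElem, List.getElem_ofFn, List.length_ofFn, Set.mem_image]
    constructor
    · rintro ⟨j, hj, rfl⟩
      exact ⟨⟨j, by omega⟩, by simp; omega, rfl⟩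
    · rintro ⟨j, hj, rfl⟩
      exact ⟨j, by have := j.2; omega, rfl⟩
  rw [isSMulRegular_quotient_iff_mem_of_smul_mem, hI]
  intro p hp
  rw [List.getElem_ofFn, smul_eq_mul, mem_ideal_span_X_image] at hp
  rw [mem_ideal_span_X_image]
  intro m hm
  obtain ⟨j, hj, hne⟩ := hp (Finsupp.single ⟨i, hi⟩ 1 + m) (by
    rw [mem_support_iff, coeff_X_mul]
    exact mem_support_iff.mp hm)
  refine ⟨j, hj, fun h0 ↦ hne ?_⟩
  have : (⟨i, hi⟩ : Fin n) ≠ j := by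
    rintro rfl
    simp at hj
  simp [h0, this]

theorem homogeneousComponent_mul_of_isHomogeneous_left {σ R : Type*} [CommSemiring R]
    {p : MvPolynomial σ R} {d : ℕ} (hp : p.IsHomogeneous d) (q : MvPolynomial σ R) (m : ℕ) :
    homogeneousComponent m (p * q) =
      if d ≤ m then p * homogeneousComponent (m - d) q else 0 := by
  let := gradedAlgebra (σ := σ) (R := R)
  have h (e : ℕ) (r : MvPolynomial σ R) : homogeneousComponent e r =
      (DirectSum.decompose (homogeneousSubmodule σ R) r e : MvPolynomial σ R) :=
    (decomposition.decompose'_apply r e).symm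
  rw [h, h]
  split_ifs with hle
  · exact DirectSum.coe_decompose_mul_of_left_mem_of_le (homogeneousSubmodule σ R) hp hle
  · exact DirectSum.coe_decompose_mul_of_left_mem_of_not_le (homogeneousSubmodule σ R) hp hle

theorem X_mem_radical_span_of_forall_eval_eq_zero {k : Type*} [Field k] [IsAlgClosed k]
    {σ ι : Type*} [Finite σ] {f : ι → MvPolynomial σ k}
    (hzero : ∀ x : σ → k, (∀ i, eval x (f i) = 0) → x = 0) (j : σ) :
    X j ∈ (Ideal.span (Set.range f)).radical := by
  rw [← vanishingIdeal_zeroLocus_eq_radical (K := k), mem_vanishingIdeal_iff]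
  intro x hx
  have hx0 : x = 0 := hzero x fun i ↦ by
    simpa [aeval_eq_eval] using hx (f i) (Ideal.subset_span ⟨i, rfl⟩)
  simp [hx0]

variable {k : Type*} [Field k]

theorem ker_constantCoeff_eq_span_X (σ : Type*) :
    RingHom.ker (constantCoeff : MvPolynomial σ k →+* k) = Ideal.span (Set.range X) := by
  ext p
  rw [← Set.image_univ, mem_ideal_span_X_image, RingHom.mem_ker, constantCoeff_eq]
  constructor
  · intro hp m hm
    by_contra! h
    exact mem_support_iff.mp hm ((Finsupp.ext fun i ↦ h i trivial : m = 0) ▸ hp)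
  · intro hp
    by_contra h
    obtain ⟨i, -, hi⟩ := hp 0 (mem_support_iff.mpr h)
    exact hi rfl

theorem isWeaklyRegular_localization_of_forall_eval_eq_zero [IsAlgClosed k] {n : ℕ}
    {f : Fin n → MvPolynomial (Fin n) k} (hf : ∀ i, constantCoeff (f i) = 0)
    (hzero : ∀ x : Fin n → k, (∀ i, eval x (f i) = 0) → x = 0)
    {P : Ideal (MvPolynomial (Fin n) k)} [P.IsPrime] (hP : P = RingHom.ker constantCoeff) :
    IsWeaklyRegular (Localization.AtPrime P)
      (List.ofFn fun i ↦ algebraMap _ (Localization.AtPrime P) (f i)) := by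
  have hmem (p : MvPolynomial (Fin n) k) (hp : constantCoeff p = 0) :
      algebraMap _ (Localization.AtPrime P) p ∈ maximalIdeal (Localization.AtPrime P) := by
    rw [IsLocalization.AtPrime.to_map_mem_maximal_iff _ P]
    exact hP ▸ hp
  have hX := (isWeaklyRegular_ofFn_X k n).of_isLocalization (Localization.AtPrime P) P.primeCompl
  refine isWeaklyRegular_of_forall_isPrime_eq_maximalIdeal (by simp) ?_ hX ?_ ?_
  · intro r hr
    simp only [List.mem_map, List.mem_ofFn] at hr
    obtain ⟨_, ⟨i, rfl⟩, rfl⟩ := hr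
    exact hmem _ (constantCoeff_X _ i)
  · intro r hr
    obtain ⟨i, rfl⟩ := (List.mem_ofFn' _ _).mp hr
    exact hmem _ (hf i)
  · intro q hq hfq
    refine le_antisymm (le_maximalIdeal hq.ne_top) ?_
    rw [← Localization.AtPrime.map_eq_maximalIdeal, Ideal.map_le_iff_le_comap]
    refine (hP.trans (ker_constantCoeff_eq_span_X _)).trans_le (Ideal.span_le.mpr ?_)
    rintro _ ⟨j, rfl⟩
    have hq' := hq.comap (algebraMap (MvPolynomial (Fin n) k) (Localization.AtPrime P))
    refine hq'.radical_le_iff.mpr (Ideal.span_le.mpr ?_)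
      (X_mem_radical_span_of_forall_eval_eq_zero hzero j)
    rintro _ ⟨i, rfl⟩
    exact hfq _ ((List.mem_ofFn' _ _).mpr ⟨i, rfl⟩)

theorem exists_skew_of_sum_mul_eq_zero [IsAlgClosed k] {n d ρ : ℕ} (hd : d ≠ 0)
    {f h : Fin n → MvPolynomial (Fin n) k} (hf : ∀ i, (f i).IsHomogeneous d)
    (hzero : ∀ x : Fin n → k, (∀ i, eval x (f i) = 0) → x = 0)
    (hh : ∀ i, (h i).IsHomogeneous ρ) (hsum : ∑ i, h i * f i = 0) :
    ∃ D : Fin n → Fin n → MvPolynomial (Fin n) k,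
      (∀ i j, if d ≤ ρ then (D i j).IsHomogeneous (ρ - d) else D i j = 0) ∧
      (∀ i j, D i j = -D j i) ∧ ∀ j, h j = ∑ i, f i * D i j := by
  obtain ⟨P, hP⟩ : ∃ P, P = RingHom.ker (constantCoeff (σ := Fin n) (R := k)) := ⟨_, rfl⟩
  have : P.IsPrime := hP ▸ RingHom.ker_isPrime _
  let φ := algebraMap (MvPolynomial (Fin n) k) (Localization.AtPrime P)
  have hφ : Function.Injective φ :=
    IsLocalization.injective _ P.primeCompl_le_nonZeroDivisors
  have hreg := isWeaklyRegular_localization_of_forall_eval_eq_zero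
    (fun i ↦ (hf i).coeff_eq_zero (by simpa using hd.symm)) hzero hP
  obtain ⟨D, hD, hhD⟩ := hreg.exists_skew_of_sum_mul_eq_zero (h := fun i ↦ φ (h i)) (by
    simp only [φ, ← map_mul, ← map_sum, hsum, map_zero])
  obtain ⟨s, hs⟩ := IsLocalization.exist_integer_multiples_of_finite P.primeCompl
    (fun x : Fin n × Fin n ↦ D x.1 x.2)
  choose E hE using hs
  have hEs (i j) : φ (E (i, j)) = φ s * D i j := by
    rw [hE, Algebra.smul_def]
  have hs0 : constantCoeff (s : MvPolynomial (Fin n) k) ≠ 0 := fun h ↦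
    s.2 (hP ▸ h)
  have hEskew (i j) : E (i, j) = -E (j, i) := hφ (by
    rw [map_neg, hEs, hEs, hD i j]
    exact mul_neg (φ s) (D j i))
  have hEh (j) : h j * s = ∑ i, f i * E (i, j) := hφ (by
    simp only [map_mul, map_sum, hEs]
    rw [hhD j, Finset.sum_mul]
    exact Finset.sum_congr rfl fun i _ ↦ by ring)
  have hcomp (j) : h j * C (constantCoeff (s : MvPolynomial (Fin n) k)) =
      ∑ i, if d ≤ ρ then f i * homogeneousComponent (ρ - d) (E (i, j)) else 0 := by
    have := congrArg (homogeneousComponent ρ) (hEh j)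
    simpa [constantCoeff_eq, homogeneousComponent_mul_of_isHomogeneous_left (hh j),
      homogeneousComponent_mul_of_isHomogeneous_left (hf _)] using this
  refine ⟨fun i j ↦ if d ≤ ρ then
    C (constantCoeff (s : MvPolynomial (Fin n) k))⁻¹ * homogeneousComponent (ρ - d) (E (i, j))
    else 0, ?_, ?_, ?_⟩
  · intro i j
    split_ifs
    · exact (homogeneousComponent_isHomogeneous _ _).C_mul _
    · rfl
  · intro i j
    dsimp only
    split_ifs
    · rw [hEskew i j, map_neg, mul_neg]
    · simp
  · intro j
    have hC : C (constantCoeff (s : MvPolynomial (Fin n) k)) *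
        C (constantCoeff (s : MvPolynomial (Fin n) k))⁻¹ = (1 : MvPolynomial (Fin n) k) := by
      rw [← C_mul, mul_inv_cancel₀ hs0, C_1]
    rw [← mul_one (h j), ← hC, ← mul_assoc, hcomp, Finset.sum_mul]
    refine Finset.sum_congr rfl fun i _ ↦ ?_
    split_ifs
    · ring
    · simp

end MvPolynomial

theorem sum_sum_mul_mul_eq_zero_of_skew {R ι : Type*} [CommRing R] [CharZero R]
    [NoZeroDivisors R] [Fintype ι] {f h : ι → R} {D : ι → ι → R}
    (hD : ∀ i j, D i j = -D j i) (hh : ∀ j, h j = ∑ i, f i * D i j) : ∑ i, h i * f i = 0 := by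
  simp only [hh, Finset.sum_mul]
  refine self_eq_neg.mp ?_
  nth_rw 1 [Finset.sum_comm]
  simp only [← Finset.sum_neg_distrib]
  refine Finset.sum_congr rfl fun i _ ↦ Finset.sum_congr rfl fun j _ ↦ ?_
  rw [hD i j]
  ring

/-- Koszul syzygies: for homogeneous `f_1, …, f_n` of degree `d ≥ 2` over an algebraically
closed field of characteristic zero whose only common zero is the origin, and homogeneous
`h_1, …, h_n` of degree `ρ` with `0 ≤ ρ ≤ n(d−1)−d`: `∑ h_i f_i = 0` iff there is a
skew-symmetric matrix `D` with entries homogeneous of degree `ρ − d` (zero when `ρ < d`)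
such that `h_j = ∑_i f_i D_{ij}`. -/
theorem stmt_4 {k : Type*} [Field k] [IsAlgClosed k] [CharZero k]
    (n d : ℕ) (hn : 2 ≤ n) (hd : 2 ≤ d)
    (f : Fin n → MvPolynomial (Fin n) k)
    (hf : ∀ i, (f i).IsHomogeneous d)
    (hzero : ∀ x : Fin n → k, (∀ i, MvPolynomial.eval x (f i) = 0) → x = 0)
    (ρ : ℕ) (hρ : ρ + d ≤ n * (d - 1))
    (h : Fin n → MvPolynomial (Fin n) k)
    (hh : ∀ i, (h i).IsHomogeneous ρ) :
    ∑ i, h i * f i = 0 ↔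
      ∃ D : Fin n → Fin n → MvPolynomial (Fin n) k,
        (∀ i j, if d ≤ ρ then (D i j).IsHomogeneous (ρ - d) else D i j = 0) ∧
        (∀ i j, D i j = - D j i) ∧
        (∀ j, h j = ∑ i, f i * D i j) := by
  constructor
  · exact MvPolynomial.exists_skew_of_sum_mul_eq_zero (by omega) hf hzero hh
  · rintro ⟨D, -, hD, hhD⟩
    exact sum_sum_mul_mul_eq_zero_of_skew hD hhD
end

section
/- Let k be an algebraically closed field of characteristic zero, let n ≥ 3 and d ≥ 2 be integers with (n, d) ≠ (3, 2), and let f_1, …, f_n ∈ k[x_1, …, x_n] be homogeneous polynomials of degree d whose only common zero in k^n is the origin. Let R be the k-vector space of all families (α_{ij})_{1 ≤ i ≤ j ≤ n} of homogeneous polynomials α_{ij} ∈ k[x_1, …, x_n] of degree n(d−1)−2d satisfying Σ_{1 ≤ i ≤ j ≤ n} α_{ij} f_i f_j = 0. Then dim_k R = Σ_{m=3}^{⌊n(d−1)/d⌋} (−1)^{m−1} (m−1) C(n+1, m) C(n(d−1)−md+n−1, n−1). -/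
open MvPolynomial in
/-- The linear map sending a family `(α_{ij})_{i ≤ j}` of homogeneous polynomials of degree `e`
to `∑_{i ≤ j} α_{ij} f_i f_j`; its kernel is the space `R` of relations. -/
noncomputable def relMap (k : Type*) [Field k] (n e : ℕ)
    (f : Fin n → MvPolynomial (Fin n) k) :
    ({p : Fin n × Fin n // p.1 ≤ p.2} → homogeneousSubmodule (Fin n) k e)
      →ₗ[k] MvPolynomial (Fin n) k where
  toFun α := ∑ q : {p : Fin n × Fin n // p.1 ≤ p.2},
    (α q : MvPolynomial (Fin n) k) * (f q.1.1 * f q.1.2)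
  map_add' a b := by
    simp [add_mul, Finset.sum_add_distrib]
  map_smul' c a := by
    simp [Finset.smul_sum, smul_mul_assoc]

/-- Linear prime avoidance: a linear subspace that is contained in no prime other than the maximal
ideal `m` contains an element regular on finitely many cyclic modules `S ⧸ J` with zero socle. -/
lemma exists_mem_forall_isSMulRegular {k S : Type*} [Field k] [Infinite k] [CommRing S]
    [Algebra k S] [IsNoetherianRing S] {m : Ideal S} (V : Submodule k S)
    (hV : ∀ P : Ideal S, P.IsPrime → (V : Set S) ⊆ P → m ≤ P) (F : Finset (Ideal S))
    (hF : ∀ J ∈ F, ∀ a, (∀ x ∈ m, x * a ∈ J) → a ∈ J) :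
    ∃ z ∈ V, ∀ J ∈ F, IsSMulRegular (S ⧸ J) z := by
  classical
  have hfin : (⋃ J ∈ F, associatedPrimes S (S ⧸ J)).Finite :=
    F.finite_toSet.biUnion fun J _ => associatedPrimes.finite S (S ⧸ J)
  let T : Finset (Subspace k V) :=
    hfin.toFinset.image fun p => (p.restrictScalars k).comap V.subtype
  have hT : ⊤ ∉ T := by
    intro h
    obtain ⟨p, hp, hpt⟩ := Finset.mem_image.mp h
    rw [Set.Finite.mem_toFinset] at hp
    simp only [Set.mem_iUnion] at hp
    obtain ⟨J, hJ, hp⟩ := hp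
    have hVp : (V : Set S) ⊆ p := fun v hv => by
      have : (⟨v, hv⟩ : V) ∈ (p.restrictScalars k).comap V.subtype := hpt ▸ Submodule.mem_top
      simpa using this
    have hmp := hV p hp.isPrime hVp
    obtain ⟨hprime, y, hy⟩ := isAssociatedPrime_iff.mp hp
    obtain ⟨a, rfl⟩ := Ideal.Quotient.mk_surjective y
    have key : ∀ x, x ∈ p ↔ x * a ∈ J := by
      intro x
      rw [hy, Submodule.mem_colon_singleton, Submodule.mem_bot, ← Ideal.Quotient.mk_eq_mk,
        ← Submodule.Quotient.mk_smul, Submodule.Quotient.mk_eq_zero, smul_eq_mul]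
    have ha : a ∈ J := hF J hJ a fun x hx => (key x).mp (hmp hx)
    exact hprime.ne_top ((Ideal.eq_top_iff_one _).mpr ((key 1).mpr (by simpa using ha)))
  obtain ⟨z, hz⟩ := (Set.ne_univ_iff_exists_notMem _).mp
    (Subspace.biUnion_ne_univ_of_top_notMem hT)
  refine ⟨z, z.2, fun J hJ => ?_⟩
  by_contra hreg
  apply hz
  have : (z : S) ∈ ⋃ p ∈ associatedPrimes S (S ⧸ J), (p : Set S) := by
    rw [biUnion_associatedPrimes_eq_compl_regular]
    exact hreg
  simp only [Set.mem_iUnion] at this ⊢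
  obtain ⟨p, hp, hzp⟩ := this
  refine ⟨_, Finset.mem_image.mpr ⟨p, ?_, rfl⟩, by simpa using hzp⟩
  rw [Set.Finite.mem_toFinset]
  exact Set.mem_biUnion hJ hp

/-- Some regular sequence on `S ⧸ J` with entries in `m` has length `n`. -/
def HasRegularSequence {S : Type*} [CommRing S] (m : Ideal S) : ℕ → Ideal S → Prop
  | 0, _ => True
  | n + 1, J => ∃ x ∈ m, IsSMulRegular (S ⧸ J) x ∧ HasRegularSequence m n (J ⊔ Ideal.span {x})

section Swap

variable {S : Type*} [CommRing S] {J : Ideal S} {x y : S}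

lemma isSMulRegular_quotient_iff_mul_mem :
    IsSMulRegular (S ⧸ J) x ↔ ∀ a, x * a ∈ J → a ∈ J :=
  isSMulRegular_quotient_iff_mem_of_smul_mem J x

lemma mem_sup_span_singleton_iff {a : S} :
    a ∈ J ⊔ Ideal.span {x} ↔ ∃ c, a - x * c ∈ J := by
  rw [Submodule.mem_sup]
  constructor
  · rintro ⟨b, hb, z, hz, rfl⟩
    obtain ⟨c, rfl⟩ := Ideal.mem_span_singleton'.mp hz
    exact ⟨c, by convert hb using 1; ring⟩
  · rintro ⟨c, hc⟩
    exact ⟨_, hc, x * c, Ideal.mul_mem_right _ _ (Ideal.mem_span_singleton_self x), by ring⟩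

/-- If `x` is regular on `S ⧸ J` and `y` is regular on `S ⧸ (J, x)`,
then `x` is regular on `S ⧸ (J, y)`. -/
lemma IsSMulRegular.sup_span_singleton_swap (hx : IsSMulRegular (S ⧸ J) x)
    (hxy : IsSMulRegular (S ⧸ (J ⊔ Ideal.span {x})) y) :
    IsSMulRegular (S ⧸ (J ⊔ Ideal.span {y})) x := by
  rw [isSMulRegular_quotient_iff_mul_mem] at *
  intro a ha
  obtain ⟨c, hc⟩ := mem_sup_span_singleton_iff.mp ha
  obtain ⟨b, hb⟩ := mem_sup_span_singleton_iff.mp (hxy c (mem_sup_span_singleton_iff.mpr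
    ⟨a, by convert neg_mem hc using 1; ring⟩))
  refine mem_sup_span_singleton_iff.mpr ⟨b, hx _ ?_⟩
  convert add_mem hc (J.mul_mem_left y hb) using 1
  ring

/-- The socles of `S ⧸ (J, x)` and `S ⧸ (J, y)` vanish simultaneously, when `x` and `y` are
regular on `S ⧸ J`. -/
lemma socle_sup_span_singleton_swap {m : Ideal S} (hxm : x ∈ m)
    (hx : IsSMulRegular (S ⧸ J) x) (hy : IsSMulRegular (S ⧸ J) y)
    (hsoc : ∀ a, (∀ z ∈ m, z * a ∈ J ⊔ Ideal.span {x}) → a ∈ J ⊔ Ideal.span {x}) (a : S)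
    (ha : ∀ z ∈ m, z * a ∈ J ⊔ Ideal.span {y}) : a ∈ J ⊔ Ideal.span {y} := by
  rw [isSMulRegular_quotient_iff_mul_mem] at hx hy
  obtain ⟨v, hv⟩ := mem_sup_span_singleton_iff.mp (ha x hxm)
  have hvx : v ∈ J ⊔ Ideal.span {x} := hsoc v fun z hz => by
    obtain ⟨w, hw⟩ := mem_sup_span_singleton_iff.mp (ha z hz)
    refine mem_sup_span_singleton_iff.mpr ⟨w, hy _ ?_⟩
    convert sub_mem (J.mul_mem_left x hw) (J.mul_mem_left z hv) using 1
    ring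
  obtain ⟨w, hw⟩ := mem_sup_span_singleton_iff.mp hvx
  refine mem_sup_span_singleton_iff.mpr ⟨w, hx _ ?_⟩
  convert add_mem hv (J.mul_mem_left y hw) using 1
  ring

end Swap

lemma HasRegularSequence.socle_eq_bot {S : Type*} [CommRing S] {m : Ideal S} {n : ℕ}
    {J : Ideal S} (h : HasRegularSequence m (n + 1) J) (a : S) (ha : ∀ x ∈ m, x * a ∈ J) :
    a ∈ J := by
  obtain ⟨x, hxm, hx, -⟩ := h
  exact isSMulRegular_quotient_iff_mul_mem.mp hx a (ha x hxm)

/-- Dividing by a regular element lowers the depth by at most one. -/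
lemma HasRegularSequence.sup_span_singleton {k S : Type*} [Field k] [Infinite k] [CommRing S]
    [Algebra k S] [IsNoetherianRing S] {m : Ideal S} {n : ℕ} :
    ∀ {J : Ideal S} {g : S}, HasRegularSequence m (n + 1) J → g ∈ m →
      IsSMulRegular (S ⧸ J) g → HasRegularSequence m n (J ⊔ Ideal.span {g}) := by
  classical
  induction n with
  | zero => intros; trivial
  | succ n ih =>
    intro J g hJ hgm hg
    obtain ⟨x, hxm, hx, hJx⟩ := hJ
    obtain ⟨z, hzm, hz⟩ := exists_mem_forall_isSMulRegular (m := m) (m.restrictScalars k)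
      (fun P _ h => h) {J ⊔ Ideal.span {x}, J ⊔ Ideal.span {g}} (by
        simp only [Finset.mem_insert, Finset.mem_singleton, forall_eq_or_imp, forall_eq]
        exact ⟨hJx.socle_eq_bot,
          socle_sup_span_singleton_swap hxm hx hg hJx.socle_eq_bot⟩)
    simp only [Finset.mem_insert, Finset.mem_singleton, forall_eq_or_imp, forall_eq] at hz
    obtain ⟨hzx, hzg⟩ := hz
    have hJz : HasRegularSequence m (n + 1) (J ⊔ Ideal.span {z}) := by
      refine ⟨x, hxm, hx.sup_span_singleton_swap hzx, ?_⟩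
      rw [sup_right_comm]
      exact ih hJx hzm hzx
    refine ⟨z, hzm, hzg, ?_⟩
    rw [sup_right_comm]
    exact ih hJz hgm (hg.sup_span_singleton_swap hzg)

section

open MvPolynomial

/-- The variables form a regular sequence in a polynomial ring. -/
lemma hasRegularSequence_bot_idealOfVars (k : Type*) [Field k] (n : ℕ) :
    HasRegularSequence (idealOfVars (Fin n) k) n (⊥ : Ideal (MvPolynomial (Fin n) k)) := by
  suffices h : ∀ j ≤ n, HasRegularSequence (idealOfVars (Fin n) k) j
      (Ideal.span ((X : Fin n → MvPolynomial (Fin n) k) '' {i | j ≤ i})) by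
    convert h n le_rfl
    rw [eq_comm, Ideal.span_eq_bot]
    rintro _ ⟨i, hi, rfl⟩
    exact absurd i.2 (not_lt.mpr hi)
  intro j
  induction j with
  | zero => intro; trivial
  | succ j ih =>
    intro hj
    refine ⟨X ⟨j, hj⟩, Ideal.subset_span ⟨_, rfl⟩, ?_, ?_⟩
    · rw [isSMulRegular_quotient_iff_mul_mem]
      intro a ha
      rw [mem_ideal_span_X_image] at ha ⊢
      intro u hu
      have hu' : Finsupp.single (⟨j, hj⟩ : Fin n) 1 + u ∈
          (X ⟨j, hj⟩ * a : MvPolynomial (Fin n) k).support := by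
        rw [mem_support_iff, coeff_X_mul]
        exact mem_support_iff.mp hu
      obtain ⟨i, hi, hi0⟩ := ha _ hu'
      refine ⟨i, hi, ?_⟩
      have hne : (⟨j, hj⟩ : Fin n) ≠ i := by
        rintro rfl
        exact absurd hi (by simp)
      simpa [Finsupp.single_apply, hne] using hi0
    · convert ih (by omega)
      rw [← Ideal.span_union]
      congr 1
      ext p
      constructor
      · rintro (⟨i, hi, rfl⟩ | rfl)
        · exact ⟨i, Nat.le_of_succ_le hi, rfl⟩
        · exact ⟨_, le_refl j, rfl⟩
      · rintro ⟨i, hi, rfl⟩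
        rcases (show j ≤ i from hi).eq_or_lt with h | h
        · right
          simp [h]
        · left
          exact ⟨i, h, rfl⟩

lemma image_Iio_eq_range {S : Type*} (g : ℕ → S) (r : ℕ) :
    g '' Set.Iio r = Set.range fun i : Fin r => g i := by
  ext x
  exact ⟨fun ⟨i, hi, hx⟩ => ⟨⟨i, hi⟩, hx⟩, fun ⟨i, hx⟩ => ⟨i, i.2, hx⟩⟩

section RegularSequence

variable {S : Type*} [CommRing S]

/-- A linear subspace that is contained in no prime other than `m` contains a regular sequence
as long as the regular sequences in `m`. -/
lemma exists_regularSequence_of_hasRegularSequence {k : Type*} [Field k] [Infinite k] [Algebra k S]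
    [IsNoetherianRing S] {m : Ideal S} {n : ℕ} (hm : HasRegularSequence m n ⊥)
    (V : Submodule k S) (hVm : (V : Set S) ⊆ m)
    (hV : ∀ P : Ideal S, P.IsPrime → (V : Set S) ⊆ P → m ≤ P) :
    ∃ g : ℕ → S, ∀ r < n, g r ∈ V ∧ IsSMulRegular (S ⧸ Ideal.span (g '' Set.Iio r)) (g r) := by
  suffices h : ∀ j ≤ n, ∃ g : ℕ → S,
      (∀ r < j, g r ∈ V ∧ IsSMulRegular (S ⧸ Ideal.span (g '' Set.Iio r)) (g r)) ∧
        HasRegularSequence m (n - j) (Ideal.span (g '' Set.Iio j)) by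
    obtain ⟨g, hg, -⟩ := h n le_rfl
    exact ⟨g, hg⟩
  intro j
  induction j with
  | zero => exact fun _ => ⟨0, by simp, by simpa [Set.Iio_zero_eq_empty] using hm⟩
  | succ j ih =>
    intro hj
    obtain ⟨g, hg, hgm⟩ := ih (by omega)
    obtain ⟨l, hl⟩ : ∃ l, n - j = l + 1 := ⟨n - j - 1, by omega⟩
    rw [hl] at hgm
    obtain ⟨z, hzV, hz⟩ := exists_mem_forall_isSMulRegular V hV {Ideal.span (g '' Set.Iio j)}
      (by simpa using fun a => hgm.socle_eq_bot a)
    have hupd : ∀ r ≤ j, Function.update g j z '' Set.Iio r = g '' Set.Iio r := fun r hr =>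
      Set.image_congr fun i hi => Function.update_of_ne (ne_of_lt (lt_of_lt_of_le hi hr)) _ _
    refine ⟨Function.update g j z, fun r hr => ?_, ?_⟩
    · rw [hupd r (by omega)]
      rcases (Nat.lt_succ_iff.mp hr).eq_or_lt with rfl | h
      · simpa using ⟨hzV, hz _ (Finset.mem_singleton_self _)⟩
      · rw [Function.update_of_ne h.ne]
        exact hg r h
    · have hl' : n - (j + 1) = l := by omega
      rw [hl', ← Order.succ_eq_add_one, Order.Iio_succ_eq_insert, Set.image_insert_eq, hupd j le_rfl,
        Function.update_self, Ideal.span_insert, sup_comm]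
      exact hgm.sup_span_singleton (k := k) (hVm hzV) (hz _ (Finset.mem_singleton_self _))

lemma span_image_Iio_succ (g : ℕ → S) (r : ℕ) :
    Ideal.span (g '' Set.Iio (r + 1)) = Ideal.span (g '' Set.Iio r) ⊔ Ideal.span {g r} := by
  rw [← Order.succ_eq_add_one, Order.Iio_succ_eq_insert, Set.image_insert_eq, Ideal.span_insert,
    sup_comm]

lemma mem_span_image_Iio_iff {g : ℕ → S} {r : ℕ} {x : S} :
    x ∈ Ideal.span (g '' Set.Iio r) ↔ ∃ c : ℕ → S, x = ∑ i ∈ Finset.range r, c i * g i := by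
  rw [image_Iio_eq_range, Ideal.mem_span_range_iff_exists_fun]
  constructor
  · rintro ⟨c, rfl⟩
    refine ⟨fun i => if h : i < r then c ⟨i, h⟩ else 0, ?_⟩
    rw [Finset.sum_range]
    simp
  · rintro ⟨c, rfl⟩
    exact ⟨fun i => c i, by rw [Finset.sum_range]⟩

/-- The coefficients of a linear relation among the members of a regular sequence lie in the ideal
they generate. -/
lemma mem_span_of_sum_mul_eq_zero {g : ℕ → S} {n : ℕ}
    (hg : ∀ r < n, IsSMulRegular (S ⧸ Ideal.span (g '' Set.Iio r)) (g r)) :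
    ∀ b : ℕ → S, ∑ i ∈ Finset.range n, b i * g i = 0 →
      ∀ i < n, b i ∈ Ideal.span (g '' Set.Iio n) := by
  induction n with
  | zero => intros; omega
  | succ n ih =>
    intro b hb
    have hle : Ideal.span (g '' Set.Iio n) ≤ Ideal.span (g '' Set.Iio (n + 1)) :=
      span_image_Iio_succ g n ▸ le_sup_left
    have hgn : g n ∈ Ideal.span (g '' Set.Iio (n + 1)) :=
      Ideal.subset_span ⟨n, Nat.lt_succ_self n, rfl⟩
    rw [Finset.sum_range_succ] at hb
    have hbn : b n ∈ Ideal.span (g '' Set.Iio n) := by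
      refine isSMulRegular_quotient_iff_mul_mem.mp (hg n (Nat.lt_succ_self n)) _
        (mem_span_image_Iio_iff.mpr ⟨fun i => -b i, ?_⟩)
      simp only [neg_mul, Finset.sum_neg_distrib]
      linear_combination hb
    obtain ⟨c, hc⟩ := mem_span_image_Iio_iff.mp hbn
    have hrel : ∑ i ∈ Finset.range n, (b i + c i * g n) * g i = 0 := by
      rw [← hb, hc, Finset.sum_mul, ← Finset.sum_add_distrib]
      exact Finset.sum_congr rfl fun i _ => by ring
    intro i hi
    rcases (Nat.lt_succ_iff.mp hi).eq_or_lt with rfl | h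
    · exact hle hbn
    · have := hle (ih (fun r hr => hg r (by omega)) _ hrel i h)
      convert sub_mem this (Ideal.mul_mem_left _ (c i) hgn) using 1
      ring

/-- A regular sequence is quasi-regular in degree one: `I / I ^ 2` is free over `S ⧸ I` on the
given generators. -/
lemma sum_mul_mem_sq_iff {g : ℕ → S} {n : ℕ}
    (hg : ∀ r < n, IsSMulRegular (S ⧸ Ideal.span (g '' Set.Iio r)) (g r)) (b : Fin n → S) :
    ∑ i, b i * g i ∈ Ideal.span (g '' Set.Iio n) ^ 2 ↔
      ∀ i, b i ∈ Ideal.span (g '' Set.Iio n) := by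
  constructor
  · intro h
    rw [pow_two, ← Ideal.smul_eq_mul] at h
    nth_rw 2 [image_Iio_eq_range] at h
    obtain ⟨c, hc, hsum⟩ := (Submodule.mem_ideal_smul_span_iff_exists_sum _ _ _).mp h
    rw [Finsupp.sum_fintype _ _ (by simp)] at hsum
    have key := mem_span_of_sum_mul_eq_zero hg
      (fun i => if h : i < n then b ⟨i, h⟩ - c ⟨i, h⟩ else 0) (by
        rw [Finset.sum_range]
        simp only [Fin.is_lt, dite_true, Fin.eta, sub_mul, Finset.sum_sub_distrib]
        rw [sub_eq_zero, ← hsum]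
        rfl)
    intro i
    have := key i i.2
    simp only [Fin.is_lt, dite_true, Fin.eta] at this
    convert add_mem this (hc i) using 1
    ring
  · intro h
    rw [pow_two]
    exact Ideal.sum_mem _ fun i _ => Ideal.mul_mem_mul (h i) (Ideal.subset_span ⟨i, i.2, rfl⟩)

end RegularSequence

section HilbertFunction

attribute [local instance] MvPolynomial.gradedAlgebra

variable {σ k : Type*} [Field k]

lemma homogeneousComponent_eq_decompose (p : MvPolynomial σ k) (e : ℕ) :
    homogeneousComponent e p = (DirectSum.decompose (homogeneousSubmodule σ k) p e : _) :=
  (decomposition.decompose'_apply p e).symm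

lemma homogeneousComponent_add_mul {g : MvPolynomial σ k} {d : ℕ} (hg : g.IsHomogeneous d)
    (a : MvPolynomial σ k) (e : ℕ) :
    homogeneousComponent (e + d) (a * g) = homogeneousComponent e a * g := by
  rw [homogeneousComponent_eq_decompose, homogeneousComponent_eq_decompose]
  exact DirectSum.coe_decompose_mul_add_of_right_mem (homogeneousSubmodule σ k) hg

lemma homogeneousComponent_mul_of_lt {g : MvPolynomial σ k} {d e : ℕ} (hg : g.IsHomogeneous d)
    (a : MvPolynomial σ k) (h : e < d) : homogeneousComponent e (a * g) = 0 := by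
  rw [homogeneousComponent_eq_decompose]
  exact DirectSum.coe_decompose_mul_of_right_mem_of_not_le (homogeneousSubmodule σ k) hg
    (not_le.mpr h)

lemma isHomogeneous_span_of_isHomogeneous {s : Set (MvPolynomial σ k)} {d : ℕ}
    (hs : ∀ g ∈ s, g.IsHomogeneous d) :
    (Ideal.span s).IsHomogeneous (homogeneousSubmodule σ k) :=
  Ideal.homogeneous_span _ _ fun g hg => ⟨d, hs g hg⟩

/-- The subspace of homogeneous polynomials of degree `e` in an ideal. -/
noncomputable def homogeneousPart (J : Ideal (MvPolynomial σ k)) (e : ℕ) :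
    Submodule k (MvPolynomial σ k) :=
  J.restrictScalars k ⊓ homogeneousSubmodule σ k e

/-- The Hilbert function of an ideal of a polynomial ring. -/
noncomputable def hilbertFunction (J : Ideal (MvPolynomial σ k)) (e : ℕ) : ℕ :=
  Module.finrank k (homogeneousPart J e)

lemma mem_homogeneousPart {J : Ideal (MvPolynomial σ k)} {e : ℕ} {p : MvPolynomial σ k} :
    p ∈ homogeneousPart J e ↔ p ∈ J ∧ p.IsHomogeneous e := Iff.rfl

lemma homogeneousPart_top (e : ℕ) :
    homogeneousPart (⊤ : Ideal (MvPolynomial σ k)) e = homogeneousSubmodule σ k e := by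
  ext p
  simp [mem_homogeneousPart]

lemma homogeneousPart_bot (e : ℕ) :
    homogeneousPart (⊥ : Ideal (MvPolynomial σ k)) e = ⊥ := by
  ext p
  simp only [mem_homogeneousPart, Ideal.mem_bot, Submodule.mem_bot, and_iff_left_iff_imp]
  rintro rfl
  exact isHomogeneous_zero σ k e

lemma hilbertFunction_bot (e : ℕ) : hilbertFunction (⊥ : Ideal (MvPolynomial σ k)) e = 0 := by
  rw [hilbertFunction, homogeneousPart_bot, finrank_bot]

instance [Finite σ] (e : ℕ) : Module.Finite k (homogeneousSubmodule σ k e) :=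
  Module.Finite.iff_fg.mpr (homogeneousSubmodule_fg σ k e)

instance [Finite σ] (J : Ideal (MvPolynomial σ k)) (e : ℕ) :
    Module.Finite k (homogeneousPart J e) :=
  Submodule.finiteDimensional_of_le (S₂ := homogeneousSubmodule σ k e) inf_le_right

lemma finrank_homogeneousSubmodule [Fintype σ] (e : ℕ) :
    Module.finrank k (homogeneousSubmodule σ k e) = (Fintype.card σ + e - 1).choose e := by
  classical
  rw [homogeneousSubmodule_eq_finsupp_supported]
  have hs : {u : σ →₀ ℕ | u.degree = e} = ↑(Finset.univ.finsuppAntidiag e : Finset (σ →₀ ℕ)) := by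
    ext u
    simp [Finset.mem_finsuppAntidiag, Finsupp.degree_eq_sum]
  have h := (AddMonoidAlgebra.supportedEquivFinsupp (R := k) (S := k)
    {u : σ →₀ ℕ | u.degree = e}).finrank_eq
  rw [h, hs, Module.finrank_finsupp_self]
  simp [Finset.card_finsuppAntidiag_nat_eq_choose]

/-- A homogeneous element of `J + (g_i)`, with all `g_i` of degree `d`, has homogeneous
coefficients. -/
lemma exists_homogeneous_coeff {ι : Type*} [Fintype ι] {d e : ℕ} {J : Ideal (MvPolynomial σ k)}
    (hJ : J.IsHomogeneous (homogeneousSubmodule σ k)) {g : ι → MvPolynomial σ k}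
    (hg : ∀ i, (g i).IsHomogeneous d) {p : MvPolynomial σ k}
    (hp : p ∈ homogeneousPart (J ⊔ Ideal.span (Set.range g)) (e + d)) :
    ∃ a : ι → MvPolynomial σ k, (∀ i, (a i).IsHomogeneous e) ∧
      ∃ b ∈ homogeneousPart J (e + d), ∑ i, a i * g i + b = p := by
  obtain ⟨hpJ, hpe⟩ := mem_homogeneousPart.mp hp
  obtain ⟨b, hb, c, hc, rfl⟩ := Submodule.mem_sup.mp hpJ
  obtain ⟨a, rfl⟩ := Ideal.mem_span_range_iff_exists_fun.mp hc
  refine ⟨fun i => homogeneousComponent e (a i), fun i => homogeneousComponent_isHomogeneous _ _,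
    homogeneousComponent (e + d) b,
    ⟨homogeneousComponent_mem_of_mem hJ hb _, homogeneousComponent_isHomogeneous _ _⟩, ?_⟩
  rw [← homogeneousComponent_eq_self hpe, map_add, map_sum, add_comm]
  simp only [homogeneousComponent_add_mul (hg _)]

/-- Linear combinations of polynomials of degree `d` with coefficients of degree `e`, plus elements
of degree `e + d` of an ideal. -/
noncomputable def homogeneousCombination {ι : Type*} [Fintype ι] (d e : ℕ)
    (J : Ideal (MvPolynomial σ k)) (g : ι → MvPolynomial σ k) :
    ((ι → homogeneousSubmodule σ k e) × homogeneousPart J (e + d)) →ₗ[k] MvPolynomial σ k :=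
  LinearMap.coprod
    (∑ i, LinearMap.mulRight k (g i) ∘ₗ (homogeneousSubmodule σ k e).subtype ∘ₗ LinearMap.proj i)
    (homogeneousPart J (e + d)).subtype

lemma homogeneousCombination_apply {ι : Type*} [Fintype ι] {d e : ℕ}
    {J : Ideal (MvPolynomial σ k)} {g : ι → MvPolynomial σ k}
    (x : (ι → homogeneousSubmodule σ k e) × homogeneousPart J (e + d)) :
    homogeneousCombination d e J g x = ∑ i, (x.1 i : MvPolynomial σ k) * g i + x.2 := by
  simp [homogeneousCombination]

lemma range_homogeneousCombination {ι : Type*} [Fintype ι] {d e : ℕ}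
    {J : Ideal (MvPolynomial σ k)} (hJ : J.IsHomogeneous (homogeneousSubmodule σ k))
    {g : ι → MvPolynomial σ k} (hg : ∀ i, (g i).IsHomogeneous d) :
    LinearMap.range (homogeneousCombination d e J g) =
      homogeneousPart (J ⊔ Ideal.span (Set.range g)) (e + d) := by
  ext p
  constructor
  · rintro ⟨⟨a, b⟩, rfl⟩
    rw [homogeneousCombination_apply]
    refine mem_homogeneousPart.mpr ⟨?_, IsHomogeneous.add (IsHomogeneous.sum _ _ _
      fun i _ => IsHomogeneous.mul (a i).2 (hg i)) b.2.2⟩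
    refine add_mem (Ideal.sum_mem _ fun i _ => Ideal.mul_mem_left _ _ ?_)
      (Ideal.mem_sup_left b.2.1)
    exact Ideal.mem_sup_right (Ideal.subset_span ⟨i, rfl⟩)
  · intro hp
    obtain ⟨a, ha, b, hb, rfl⟩ := exists_homogeneous_coeff hJ hg hp
    exact ⟨(fun i => ⟨a i, ha i⟩, ⟨b, hb⟩), homogeneousCombination_apply _⟩

lemma finrank_ker_homogeneousCombination [Finite σ] {ι : Type*} [Fintype ι] {d e : ℕ}
    {J K : Ideal (MvPolynomial σ k)}
    {g : ι → MvPolynomial σ k} (hg : ∀ i, (g i).IsHomogeneous d)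
    (hJK : ∀ a : ι → MvPolynomial σ k, ∑ i, a i * g i ∈ J ↔ ∀ i, a i ∈ K) :
    Module.finrank k (LinearMap.ker (homogeneousCombination d e J g)) =
      Fintype.card ι * hilbertFunction K e := by
  let T : LinearMap.ker (homogeneousCombination d e J g) →ₗ[k] (ι → homogeneousPart K e) :=
    LinearMap.pi fun i => LinearMap.codRestrict (homogeneousPart K e)
      ((homogeneousSubmodule σ k e).subtype ∘ₗ LinearMap.proj i ∘ₗ LinearMap.fst _ _ _ ∘ₗ
        Submodule.subtype _) (by
        rintro ⟨⟨a, b⟩, hx⟩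
        rw [LinearMap.mem_ker, homogeneousCombination_apply] at hx
        refine ⟨(hJK fun i => a i).mp ?_ i, (a i).2⟩
        rw [eq_neg_of_add_eq_zero_left hx]
        exact neg_mem b.2.1)
  have hT : Function.Bijective T := by
    constructor
    · rw [injective_iff_map_eq_zero]
      rintro ⟨⟨a, b⟩, hx⟩ h0
      have ha : a = 0 := _root_.funext fun i => by
        have hi := congrArg (Submodule.subtype (homogeneousPart K e)) (congrFun h0 i)
        exact Subtype.ext hi
      subst ha
      rw [LinearMap.mem_ker, homogeneousCombination_apply] at hx
      have hb : b = 0 := Subtype.ext (by simpa using hx)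
      subst hb
      rfl
    · intro c
      have hsum : ∑ i, (c i : MvPolynomial σ k) * g i ∈ homogeneousPart J (e + d) :=
        ⟨(hJK _).mpr fun i => (c i).2.1,
          IsHomogeneous.sum _ _ _ fun i _ => IsHomogeneous.mul (c i).2.2 (hg i)⟩
      refine ⟨⟨(fun i => ⟨c i, (c i).2.2⟩, -⟨_, hsum⟩), ?_⟩, rfl⟩
      rw [LinearMap.mem_ker, homogeneousCombination_apply]
      simp
  rw [(LinearEquiv.ofBijective T hT).finrank_eq, Module.finrank_pi_fintype, Finset.sum_const,
    Finset.card_univ, smul_eq_mul, hilbertFunction]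

/-- If `∑ a_i g_i ∈ J` exactly when all `a_i` lie in `K`, then `(J + (g_i)) / J` is a direct sum of
copies of `S / K`, which determines the Hilbert function. -/
lemma hilbertFunction_sup_span_add [Finite σ] {ι : Type*} [Fintype ι] {d : ℕ}
    {J K : Ideal (MvPolynomial σ k)} (hJ : J.IsHomogeneous (homogeneousSubmodule σ k))
    {g : ι → MvPolynomial σ k} (hg : ∀ i, (g i).IsHomogeneous d)
    (hJK : ∀ a : ι → MvPolynomial σ k, ∑ i, a i * g i ∈ J ↔ ∀ i, a i ∈ K) (e : ℕ) :
    hilbertFunction (J ⊔ Ideal.span (Set.range g)) (e + d) +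
        Fintype.card ι * hilbertFunction K e =
      hilbertFunction J (e + d) +
        Fintype.card ι * hilbertFunction (⊤ : Ideal (MvPolynomial σ k)) e := by
  have h := LinearMap.finrank_range_add_finrank_ker (homogeneousCombination d e J g)
  rw [range_homogeneousCombination hJ hg, finrank_ker_homogeneousCombination hg hJK,
    Module.finrank_prod, Module.finrank_pi_fintype, Finset.sum_const, Finset.card_univ,
    smul_eq_mul, ← homogeneousPart_top] at h
  rw [hilbertFunction, h, hilbertFunction, hilbertFunction, add_comm]

lemma hilbertFunction_sup_span_of_lt {ι : Type*} [Fintype ι] {d e : ℕ}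
    {J : Ideal (MvPolynomial σ k)} (hJ : J.IsHomogeneous (homogeneousSubmodule σ k))
    {g : ι → MvPolynomial σ k} (hg : ∀ i, (g i).IsHomogeneous d) (h : e < d) :
    hilbertFunction (J ⊔ Ideal.span (Set.range g)) e = hilbertFunction J e := by
  suffices hpart : homogeneousPart (J ⊔ Ideal.span (Set.range g)) e = homogeneousPart J e by
    rw [hilbertFunction, hilbertFunction, hpart]
  refine le_antisymm (fun p hp => ?_) fun p hp => ⟨Ideal.mem_sup_left hp.1, hp.2⟩
  obtain ⟨hpJ, hpe⟩ := mem_homogeneousPart.mp hp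
  refine ⟨?_, hpe⟩
  obtain ⟨b, hb, c, hc, rfl⟩ := Submodule.mem_sup.mp hpJ
  obtain ⟨a, rfl⟩ := Ideal.mem_span_range_iff_exists_fun.mp hc
  rw [← homogeneousComponent_eq_self hpe, map_add, map_sum]
  simp only [homogeneousComponent_mul_of_lt (hg _) _ h, Finset.sum_const_zero, add_zero]
  exact homogeneousComponent_mem_of_mem hJ hb _

end HilbertFunction

section HilbertSeries

attribute [local instance] MvPolynomial.gradedAlgebra

variable {σ k : Type*} [Field k]

/-- The Hilbert series of an ideal of a polynomial ring. -/
noncomputable def hilbertSeries (J : Ideal (MvPolynomial σ k)) : PowerSeries ℤ :=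
  PowerSeries.mk fun e => (hilbertFunction J e : ℤ)

lemma coeff_hilbertSeries (J : Ideal (MvPolynomial σ k)) (e : ℕ) :
    PowerSeries.coeff e (hilbertSeries J) = hilbertFunction J e := PowerSeries.coeff_mk _ _

lemma hilbertSeries_sup_span_singleton [Finite σ] {d : ℕ} {J : Ideal (MvPolynomial σ k)}
    (hJ : J.IsHomogeneous (homogeneousSubmodule σ k)) {g : MvPolynomial σ k}
    (hg : g.IsHomogeneous d) (hreg : IsSMulRegular (MvPolynomial σ k ⧸ J) g) :
    hilbertSeries (J ⊔ Ideal.span {g}) =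
      hilbertSeries J + PowerSeries.X ^ d *
        (hilbertSeries (⊤ : Ideal (MvPolynomial σ k)) - hilbertSeries J) := by
  have hrange : ({g} : Set (MvPolynomial σ k)) = Set.range fun _ : Unit => g := by simp
  ext e
  rw [map_add, PowerSeries.coeff_X_pow_mul', coeff_hilbertSeries, coeff_hilbertSeries, hrange]
  split_ifs with h
  · obtain ⟨e, rfl⟩ := Nat.exists_eq_add_of_le' h
    have hrec := hilbertFunction_sup_span_add (K := J) hJ (g := fun _ : Unit => g) (fun _ => hg)
      (fun a => by
        simp only [Finset.univ_unique, Finset.sum_singleton]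
        refine ⟨fun ha i => isSMulRegular_quotient_iff_mul_mem.mp hreg _ (mul_comm g _ ▸ ha),
          fun ha => J.mul_mem_right _ (ha _)⟩) e
    rw [Nat.add_sub_cancel, map_sub, coeff_hilbertSeries, coeff_hilbertSeries]
    zify at hrec
    simp only [Fintype.card_unit, Nat.cast_one, one_mul] at hrec
    linear_combination hrec
  · rw [hilbertFunction_sup_span_of_lt hJ (fun _ => hg) (not_le.mp h), add_zero]

lemma hilbertSeries_top_sub_span_regularSequence [Finite σ] {d : ℕ} {g : ℕ → MvPolynomial σ k} :
    ∀ {n : ℕ}, (∀ r < n, (g r).IsHomogeneous d ∧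
      IsSMulRegular (MvPolynomial σ k ⧸ Ideal.span (g '' Set.Iio r)) (g r)) →
    hilbertSeries (⊤ : Ideal (MvPolynomial σ k)) - hilbertSeries (Ideal.span (g '' Set.Iio n)) =
      (1 - PowerSeries.X ^ d) ^ n * hilbertSeries (⊤ : Ideal (MvPolynomial σ k))
  | 0, _ => by
    have : hilbertSeries (⊥ : Ideal (MvPolynomial σ k)) = 0 := by
      ext e
      simp [coeff_hilbertSeries, hilbertFunction_bot]
    simp [this]
  | n + 1, hg => by
    have ih := hilbertSeries_top_sub_span_regularSequence fun r hr => hg r (Nat.lt_succ_of_lt hr)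
    have hhom : (Ideal.span (g '' Set.Iio n)).IsHomogeneous (homogeneousSubmodule σ k) :=
      isHomogeneous_span_of_isHomogeneous (by
        rintro _ ⟨r, hr, rfl⟩
        exact (hg r (Nat.lt_succ_of_lt hr)).1)
    rw [span_image_Iio_succ, hilbertSeries_sup_span_singleton hhom (hg n (Nat.lt_succ_self n)).1
      (hg n (Nat.lt_succ_self n)).2]
    linear_combination (1 - PowerSeries.X ^ d) * ih

/-- The Hilbert function of the square of an ideal generated by a regular sequence. -/
lemma hilbertFunction_add_eq_sq_add [Finite σ] {d n : ℕ} {g : ℕ → MvPolynomial σ k}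
    (hg : ∀ r < n, (g r).IsHomogeneous d ∧
      IsSMulRegular (MvPolynomial σ k ⧸ Ideal.span (g '' Set.Iio r)) (g r)) (e : ℕ) :
    hilbertFunction (Ideal.span (g '' Set.Iio n)) (e + d) +
        n * hilbertFunction (Ideal.span (g '' Set.Iio n)) e =
      hilbertFunction (Ideal.span (g '' Set.Iio n) ^ 2) (e + d) +
        n * hilbertFunction (⊤ : Ideal (MvPolynomial σ k)) e := by
  have hhom : (Ideal.span (g '' Set.Iio n)).IsHomogeneous (homogeneousSubmodule σ k) :=
    isHomogeneous_span_of_isHomogeneous (by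
      rintro _ ⟨r, hr, rfl⟩
      exact (hg r hr).1)
  have h := hilbertFunction_sup_span_add (J := Ideal.span (g '' Set.Iio n) ^ 2)
    (by rw [pow_two]; exact hhom.mul hhom) (g := fun i : Fin n => g i)
    (fun i => (hg i i.2).1) (sum_mul_mem_sq_iff fun r hr => (hg r hr).2) e
  rwa [← image_Iio_eq_range, sup_eq_right.mpr (Ideal.pow_le_self two_ne_zero),
    Fintype.card_fin] at h

end HilbertSeries

section Generators

variable {k S : Type*} [Field k] [CommRing S] [Algebra k S]

/-- A regular sequence is linearly independent, so it spans any space of at most its length in which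
it lies. -/
lemma span_image_Iio_eq_of_regularSequence {n : ℕ} {V : Submodule k S} [Module.Finite k V]
    (hV : Module.finrank k V ≤ n) {m : Ideal S} (hm : m ≠ ⊤) (hVm : (V : Set S) ⊆ m) {g : ℕ → S}
    (hg : ∀ r < n, g r ∈ V ∧ IsSMulRegular (S ⧸ Ideal.span (g '' Set.Iio r)) (g r)) :
    Submodule.span k (g '' Set.Iio n) = V := by
  have hle : ∀ r ≤ n, Submodule.span k (g '' Set.Iio r) ≤ V := by
    intro r hr
    rw [Submodule.span_le]
    rintro _ ⟨i, hi, rfl⟩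
    exact (hg i (lt_of_lt_of_le hi hr)).1
  have hdim : ∀ r ≤ n, r ≤ Module.finrank k (Submodule.span k (g '' Set.Iio r)) := by
    intro r
    induction r with
    | zero => simp
    | succ r ih =>
      intro hr
      have : Module.Finite k (Submodule.span k (g '' Set.Iio (r + 1))) :=
        Submodule.finiteDimensional_of_le (hle _ hr)
      refine (Nat.succ_le_succ (ih (by omega))).trans (Submodule.finrank_lt_finrank_of_lt ?_)
      refine lt_of_le_of_ne
        (Submodule.span_mono (Set.image_mono (Set.Iio_subset_Iio r.le_succ))) fun heq => ?_
      have hgr : g r ∈ Submodule.span k (g '' Set.Iio r) :=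
        heq ▸ Submodule.subset_span ⟨r, Nat.lt_succ_self r, rfl⟩
      have hgr' : g r ∈ Ideal.span (g '' Set.Iio r) :=
        (Submodule.span_le_restrictScalars k S _) hgr
      have hone := isSMulRegular_quotient_iff_mul_mem.mp (hg r hr).2 1 (by simpa using hgr')
      refine hm ((Ideal.eq_top_iff_one _).mpr (Ideal.span_le.mpr ?_ hone))
      rintro _ ⟨i, hi, rfl⟩
      exact hVm (hg i (lt_trans hi hr)).1
  exact Submodule.eq_of_le_of_finrank_le (hle n le_rfl) (hV.trans (hdim n le_rfl))

/-- The ideal generated by the linear span of a set is the ideal generated by the set. -/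
lemma ideal_span_submodule_span (s : Set S) :
    Ideal.span (Submodule.span k s : Set S) = Ideal.span s :=
  le_antisymm (Ideal.span_le.mpr (Submodule.span_le_restrictScalars k S s))
    (Ideal.span_mono Submodule.subset_span)

end Generators

section Nullstellensatz

variable {k : Type*} [Field k] {n : ℕ}

lemma mem_idealOfVars_iff {p : MvPolynomial (Fin n) k} :
    p ∈ idealOfVars (Fin n) k ↔ ∀ u ∈ p.support, u ≠ 0 := by
  rw [idealOfVars, ← Set.image_univ, mem_ideal_span_X_image]
  simp [Finsupp.ext_iff]

lemma idealOfVars_ne_top : idealOfVars (Fin n) k ≠ ⊤ := by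
  rw [Ideal.ne_top_iff_one, mem_idealOfVars_iff]
  simp

lemma MvPolynomial.IsHomogeneous.mem_idealOfVars {p : MvPolynomial (Fin n) k} {d : ℕ}
    (hp : p.IsHomogeneous d) (hd : d ≠ 0) : p ∈ idealOfVars (Fin n) k := by
  rw [mem_idealOfVars_iff]
  rintro u hu rfl
  have := hp.coeff_eq_zero (d := 0) (by simpa using hd.symm)
  exact mem_support_iff.mp hu this

lemma idealOfVars_le_of_zeroLocus_subset [IsAlgClosed k] {f : Fin n → MvPolynomial (Fin n) k}
    (hzero : ∀ x : Fin n → k, (∀ i, eval x (f i) = 0) → x = 0)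
    (P : Ideal (MvPolynomial (Fin n) k)) (hP : P.IsPrime) (hf : ∀ i, f i ∈ P) :
    idealOfVars (Fin n) k ≤ P := by
  rw [idealOfVars, Ideal.span_le]
  rintro _ ⟨j, rfl⟩
  rw [SetLike.mem_coe, ← hP.radical, ← vanishingIdeal_zeroLocus_eq_radical (K := k)]
  intro x hx
  have := hzero x fun i => by simpa [aeval_eq_eval] using hx (f i) (hf i)
  simp [this]

end Nullstellensatz

section Relations

attribute [local instance] MvPolynomial.gradedAlgebra

lemma span_range_mul_eq_sq {S : Type*} [CommRing S] {n : ℕ} (f : Fin n → S) :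
    Ideal.span (Set.range fun q : {p : Fin n × Fin n // p.1 ≤ p.2} => f q.1.1 * f q.1.2) =
      Ideal.span (Set.range f) ^ 2 := by
  rw [pow_two, Ideal.span_mul_span']
  congr 1
  ext x
  rw [Set.mem_mul]
  constructor
  · rintro ⟨q, rfl⟩
    exact ⟨_, ⟨q.1.1, rfl⟩, _, ⟨q.1.2, rfl⟩, rfl⟩
  · rintro ⟨_, ⟨i, rfl⟩, _, ⟨j, rfl⟩, rfl⟩
    rcases le_total i j with h | h
    · exact ⟨⟨(i, j), h⟩, rfl⟩
    · exact ⟨⟨(j, i), h⟩, mul_comm _ _⟩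

lemma card_fin_prod_le (n : ℕ) :
    Fintype.card {p : Fin n × Fin n // p.1 ≤ p.2} = (n + 1).choose 2 := by
  rw [← Fintype.card_congr (Sym2.sortEquiv (α := Fin n)), Sym2.card, Fintype.card_fin]

variable {k : Type*} [Field k] {n : ℕ}

lemma range_relMap {d e : ℕ} {f : Fin n → MvPolynomial (Fin n) k}
    (hf : ∀ i, (f i).IsHomogeneous d) :
    LinearMap.range (relMap k n e f) =
      homogeneousPart (Ideal.span (Set.range f) ^ 2) (e + (d + d)) := by
  have hhom : ∀ q : {p : Fin n × Fin n // p.1 ≤ p.2}, (f q.1.1 * f q.1.2).IsHomogeneous (d + d) :=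
    fun q => (hf _).mul (hf _)
  rw [← span_range_mul_eq_sq]
  ext p
  constructor
  · rintro ⟨a, rfl⟩
    exact ⟨Ideal.sum_mem _ fun q _ => Ideal.mul_mem_left _ _ (Ideal.subset_span ⟨q, rfl⟩),
      IsHomogeneous.sum _ _ _ fun q _ => IsHomogeneous.mul (a q).2 (hhom q)⟩
  · intro hp
    rw [← bot_sup_eq (Ideal.span _)] at hp
    obtain ⟨a, ha, b, hb, rfl⟩ := exists_homogeneous_coeff (Ideal.IsHomogeneous.bot _) hhom hp
    rw [homogeneousPart_bot, Submodule.mem_bot] at hb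
    exact ⟨fun q => ⟨a q, ha q⟩, by rw [hb, add_zero]; rfl⟩

lemma finrank_ker_relMap_add {d e : ℕ} {f : Fin n → MvPolynomial (Fin n) k}
    (hf : ∀ i, (f i).IsHomogeneous d) :
    Module.finrank k (LinearMap.ker (relMap k n e f)) +
        hilbertFunction (Ideal.span (Set.range f) ^ 2) (e + (d + d)) =
      (n + 1).choose 2 * hilbertFunction (⊤ : Ideal (MvPolynomial (Fin n) k)) e := by
  have h := LinearMap.finrank_range_add_finrank_ker (relMap k n e f)
  rw [range_relMap hf, Module.finrank_pi_fintype, Finset.sum_const, Finset.card_univ,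
    card_fin_prod_le, smul_eq_mul] at h
  rw [hilbertFunction, hilbertFunction, homogeneousPart_top, ← h, add_comm]

/-- If the only common zero of `n` homogeneous polynomials in `n` variables is the origin, then the
ideal they generate is generated by a regular sequence. -/
lemma exists_regularSequence_span_eq [IsAlgClosed k] {d : ℕ} (hd : d ≠ 0)
    {f : Fin n → MvPolynomial (Fin n) k} (hf : ∀ i, (f i).IsHomogeneous d)
    (hzero : ∀ x : Fin n → k, (∀ i, eval x (f i) = 0) → x = 0) :
    ∃ g : ℕ → MvPolynomial (Fin n) k, Ideal.span (g '' Set.Iio n) = Ideal.span (Set.range f) ∧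
      ∀ r < n, (g r).IsHomogeneous d ∧
        IsSMulRegular (MvPolynomial (Fin n) k ⧸ Ideal.span (g '' Set.Iio r)) (g r) := by
  have : Infinite k := IsAlgClosed.instInfinite
  have hVhom : Submodule.span k (Set.range f) ≤ homogeneousSubmodule (Fin n) k d :=
    Submodule.span_le.mpr (Set.range_subset_iff.mpr hf)
  have hVm : (Submodule.span k (Set.range f) : Set (MvPolynomial (Fin n) k)) ⊆
      idealOfVars (Fin n) k := fun p hp =>
    MvPolynomial.IsHomogeneous.mem_idealOfVars (hVhom hp) hd
  obtain ⟨g, hg⟩ := exists_regularSequence_of_hasRegularSequence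
    (hasRegularSequence_bot_idealOfVars k n) (Submodule.span k (Set.range f)) hVm
    fun P hP hVP => idealOfVars_le_of_zeroLocus_subset hzero P hP
      fun i => hVP (Submodule.subset_span ⟨i, rfl⟩)
  have : Module.Finite k (Submodule.span k (Set.range f)) :=
    Module.Finite.span_of_finite k (Set.finite_range f)
  have hspan := span_image_Iio_eq_of_regularSequence
    ((finrank_range_le_card f).trans_eq (Fintype.card_fin n)) idealOfVars_ne_top hVm hg
  refine ⟨g, ?_, fun r hr => ⟨hVhom (hg r hr).1, (hg r hr).2⟩⟩
  rw [← ideal_span_submodule_span (k := k) (g '' Set.Iio n), hspan, ideal_span_submodule_span]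

end Relations

section Binomial

variable {R : Type*} [CommRing R]

lemma sum_neg_one_pow_mul_choose_mul_pow (n : ℕ) (s : R) :
    ∑ m ∈ Finset.range (n + 1), (-1) ^ m * (n.choose m : R) * s ^ m = (1 - s) ^ n := by
  rw [sub_eq_neg_add, add_pow]
  exact Finset.sum_congr rfl fun m _ => by rw [neg_pow s]; ring

lemma sum_neg_one_pow_mul_sub_one_mul_choose_mul_pow (n : ℕ) (s : R) :
    ∑ m ∈ Finset.range (n + 2), (-1) ^ (m + 1) * ((m : R) - 1) * ((n + 1).choose m : R) * s ^ m =
      (1 - s) ^ n * (1 + n * s) := by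
  have h : ∑ m ∈ Finset.range (n + 2), (-1) ^ m * (m : R) * ((n + 1).choose m : R) * s ^ m =
      -((n + 1) * s * (1 - s) ^ n) := by
    rw [Finset.sum_range_succ', ← sum_neg_one_pow_mul_choose_mul_pow n s, Finset.mul_sum,
      ← Finset.sum_neg_distrib]
    simp only [Nat.cast_zero, mul_zero, zero_mul, add_zero]
    refine Finset.sum_congr rfl fun m _ => ?_
    have := congrArg (Nat.cast (R := R)) (Nat.add_one_mul_choose_eq n m)
    push_cast at this ⊢
    linear_combination (-1) ^ m * s ^ (m + 1) * this
  have h' := sum_neg_one_pow_mul_choose_mul_pow (n + 1) s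
  calc _ = ∑ m ∈ Finset.range (n + 2), (-1) ^ m * ((n + 1).choose m : R) * s ^ m -
        ∑ m ∈ Finset.range (n + 2), (-1) ^ m * (m : R) * ((n + 1).choose m : R) * s ^ m := by
        rw [← Finset.sum_sub_distrib]
        exact Finset.sum_congr rfl fun m _ => by ring
    _ = _ := by
        rw [h, h']
        ring

lemma sum_Ico_three_neg_one_pow_mul_sub_one_mul_choose_mul_pow {n : ℕ} (hn : n ≠ 0) (s : R) :
    ∑ m ∈ Finset.Ico 3 (n + 2),
        (-1) ^ (m + 1) * ((m : R) - 1) * ((n + 1).choose m : R) * s ^ m =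
      (1 - s) ^ n * (1 + n * s) - 1 + ((n + 1).choose 2 : R) * s ^ 2 := by
  rw [Finset.sum_Ico_eq_sub _ (by omega), sum_neg_one_pow_mul_sub_one_mul_choose_mul_pow]
  simp only [Finset.sum_range_succ, Finset.sum_range_zero, Nat.choose_zero_right, Nat.cast_zero,
    Nat.cast_one, Nat.cast_ofNat]
  ring

end Binomial

section Dimension

variable {k : Type*} [Field k] [IsAlgClosed k] {n d : ℕ} {f : Fin n → MvPolynomial (Fin n) k}

lemma hilbertFunction_top (k : Type*) [Field k] {n : ℕ} (hn : n ≠ 0) (e : ℕ) :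
    hilbertFunction (⊤ : Ideal (MvPolynomial (Fin n) k)) e = (e + n - 1).choose (n - 1) := by
  rw [hilbertFunction, homogeneousPart_top, finrank_homogeneousSubmodule, Fintype.card_fin,
    add_comm n e, ← Nat.choose_symm (by omega)]
  congr 1
  omega

/-- The dimension of the space of relations, as a coefficient of a power series. -/
lemma finrank_ker_relMap_eq_coeff (hn : n ≠ 0) (hd : d ≠ 0) (hf : ∀ i, (f i).IsHomogeneous d)
    (hzero : ∀ x : Fin n → k, (∀ i, eval x (f i) = 0) → x = 0) (e : ℕ) :
    (Module.finrank k (LinearMap.ker (relMap k n e f)) : ℤ) =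
      ∑ m ∈ Finset.Ico 3 (n + 2), (-1 : ℤ) ^ (m + 1) * ((m : ℤ) - 1) * ((n + 1).choose m) *
        PowerSeries.coeff (e + (d + d)) ((PowerSeries.X ^ d) ^ m *
          hilbertSeries (⊤ : Ideal (MvPolynomial (Fin n) k))) := by
  obtain ⟨g, hgf, hg⟩ := exists_regularSequence_span_eq hd hf hzero
  have hker := finrank_ker_relMap_add (e := e) hf
  have hsq := hilbertFunction_add_eq_sq_add hg (e + d)
  have hser := hilbertSeries_top_sub_span_regularSequence hg
  rw [hgf] at hsq hser
  have hid := sum_Ico_three_neg_one_pow_mul_sub_one_mul_choose_mul_pow hn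
    (PowerSeries.X ^ d : PowerSeries ℤ)
  generalize hH : hilbertSeries (⊤ : Ideal (MvPolynomial (Fin n) k)) = H at hser ⊢
  generalize hHI : hilbertSeries (Ideal.span (Set.range f)) = HI at hser
  have hc (J : Ideal (MvPolynomial (Fin n) k)) : PowerSeries.coeff (e + (d + d))
      (PowerSeries.X ^ d * hilbertSeries J) = (hilbertFunction J (e + d) : ℤ) := by
    rw [← add_assoc, PowerSeries.coeff_X_pow_mul, coeff_hilbertSeries]
  have hc2 : PowerSeries.coeff (e + (d + d)) (PowerSeries.X ^ d * (PowerSeries.X ^ d * H)) =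
      (hilbertFunction (⊤ : Ideal (MvPolynomial (Fin n) k)) e : ℤ) := by
    rw [← add_assoc, PowerSeries.coeff_X_pow_mul, PowerSeries.coeff_X_pow_mul, ← hH,
      coeff_hilbertSeries]
  have hcI := hc (Ideal.span (Set.range f))
  have hcT := hc ⊤
  have hcE := coeff_hilbertSeries (Ideal.span (Set.range f)) (e + (d + d))
  rw [hHI] at hcI hcE
  rw [hH] at hcT
  rw [← add_assoc] at hker hcE hcI hcT hc2 ⊢
  zify at hker hsq
  have hker' : (Module.finrank k (LinearMap.ker (relMap k n e f)) : ℤ) =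
      PowerSeries.coeff (e + d + d) (((n + 1).choose 2 : PowerSeries ℤ) *
        (PowerSeries.X ^ d * (PowerSeries.X ^ d * H)) - HI
        - (n : PowerSeries ℤ) * (PowerSeries.X ^ d * HI)
        + (n : PowerSeries ℤ) * (PowerSeries.X ^ d * H)) := by
    simp only [map_add, map_sub, ← nsmul_eq_mul, map_nsmul, hcI, hcT, hcE, hc2]
    simp only [nsmul_eq_mul]
    linear_combination hker + hsq
  rw [hker']
  have hsum : ∑ m ∈ Finset.Ico 3 (n + 2), ((((-1 : ℤ) ^ (m + 1) * ((m : ℤ) - 1) *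
      ((n + 1).choose m)) : ℤ) : PowerSeries ℤ) * ((PowerSeries.X ^ d) ^ m * H) =
      ((n + 1).choose 2 : PowerSeries ℤ) * (PowerSeries.X ^ d * (PowerSeries.X ^ d * H)) - HI
        - (n : PowerSeries ℤ) * (PowerSeries.X ^ d * HI)
        + (n : PowerSeries ℤ) * (PowerSeries.X ^ d * H) := by
    push_cast
    simp only [← mul_assoc, ← Finset.sum_mul]
    linear_combination H * hid - (1 + n * PowerSeries.X ^ d) * hser
  rw [← hsum, map_sum]
  refine Finset.sum_congr rfl fun m _ => ?_
  rw [← zsmul_eq_mul, map_zsmul, zsmul_eq_mul]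
  rfl

end Dimension

end

/-- For `n ≥ 3`, `d ≥ 2`, `(n,d) ≠ (3,2)` and homogeneous `f_1, …, f_n` of degree `d` over an
algebraically closed field of characteristic zero whose only common zero is the origin, the
space `R` of families `(α_{ij})_{i ≤ j}` of homogeneous polynomials of degree `n(d−1)−2d` with
`∑_{i ≤ j} α_{ij} f_i f_j = 0` has dimension
`∑_{m=3}^{⌊n(d−1)/d⌋} (−1)^{m−1}(m−1) C(n+1, m) C(n(d−1)−md+n−1, n−1)`. -/
theorem stmt_5 {k : Type*} [Field k] [IsAlgClosed k] [CharZero k]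
    (n d : ℕ) (hn : 3 ≤ n) (hd : 2 ≤ d) (hnd : (n, d) ≠ (3, 2))
    (f : Fin n → MvPolynomial (Fin n) k)
    (hf : ∀ i, (f i).IsHomogeneous d)
    (hzero : ∀ x : Fin n → k, (∀ i, MvPolynomial.eval x (f i) = 0) → x = 0) :
    (Module.finrank k (LinearMap.ker (relMap k n (n * (d - 1) - 2 * d) f)) : ℤ)
      = ∑ m ∈ Finset.Icc 3 (n * (d - 1) / d),
          (-1 : ℤ) ^ (m + 1) * ((m : ℤ) - 1) * ((n + 1).choose m) *
            ((n * (d - 1) - m * d + n - 1).choose (n - 1)) := by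
  have hle : 2 * d ≤ n * (d - 1) := by
    obtain ⟨c, rfl⟩ : ∃ c, d = c + 2 := ⟨d - 2, by omega⟩
    rcases hn.eq_or_lt with rfl | hn
    · have : c ≠ 0 := by
        rintro rfl
        exact hnd rfl
      omega
    · calc 2 * (c + 2) ≤ 4 * (c + 1) := by omega
        _ ≤ n * (c + 1) := Nat.mul_le_mul_right _ hn
  have hlt : n * (d - 1) / d ≤ n :=
    (Nat.div_le_div_right (Nat.mul_le_mul_left n d.pred_le)).trans_eq
      (Nat.mul_div_cancel n (by omega))
  rw [finrank_ker_relMap_eq_coeff (by omega) (by omega) hf hzero,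
    show n * (d - 1) - 2 * d + (d + d) = n * (d - 1) by omega]
  refine (Finset.sum_subset_zero_on_sdiff (fun m hm => ?_) (fun m hm => ?_)
    fun m hm => ?_).symm
  · rw [Finset.mem_Icc] at hm
    exact Finset.mem_Ico.mpr ⟨hm.1, by omega⟩
  · rw [Finset.mem_sdiff, Finset.mem_Ico, Finset.mem_Icc, Nat.le_div_iff_mul_le (by omega)] at hm
    rw [← pow_mul, PowerSeries.coeff_X_pow_mul', if_neg (by rw [mul_comm]; tauto), mul_zero]
  · rw [Finset.mem_Icc, Nat.le_div_iff_mul_le (by omega), mul_comm m d] at hm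
    rw [← pow_mul, PowerSeries.coeff_X_pow_mul', if_pos hm.2, coeff_hilbertSeries,
      hilbertFunction_top k (by omega), mul_comm m d]
end

section
/- Let k be an algebraically closed field of characteristic zero, let n ≥ 3 and d ≥ 2 be integers with (n, d) ≠ (3, 2), and let f_1, …, f_n ∈ k[x_1, …, x_n] be homogeneous polynomials of degree d whose only common zero in k^n is the origin. Let P ⊆ k[x_1, …, x_n]_{n(d−1)} be the k-linear span of all products e · f_i · f_j where e ranges over homogeneous polynomials of degree n(d−1)−2d and 1 ≤ i ≤ j ≤ n. Then C(n(d−1)+n−1, n−1) − dim_k P = n·C(d+n−1, n−1) − n² + 1. -/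
/-- The subspace `P ⊆ k[x_1, …, x_n]_{n(d−1)}`: the span of all products `e · f_i · f_j`
with `e` homogeneous of degree `n(d−1)−2d` and `i ≤ j`. -/
noncomputable def prodSpan {k : Type*} [Field k] (n d : ℕ)
    (f : Fin n → MvPolynomial (Fin n) k) : Submodule k (MvPolynomial (Fin n) k) :=
  Submodule.span k
    {p : MvPolynomial (Fin n) k | ∃ e : MvPolynomial (Fin n) k, ∃ i j : Fin n,
      e.IsHomogeneous (n * (d - 1) - 2 * d) ∧ i ≤ j ∧ p = e * (f i * f j)}

namespace MvPolynomial

section HilbertFunction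

variable {σ k : Type*} [Field k]

/-- The degree `j` part of an ideal, as a subspace of the forms of degree `j`. -/
noncomputable def degreePart (I : Ideal (MvPolynomial σ k)) (j : ℕ) :
    Submodule k (homogeneousSubmodule σ k j) :=
  (I.restrictScalars k).comap (homogeneousSubmodule σ k j).subtype

/-- The Hilbert function of the quotient by an ideal, computed on forms. -/
noncomputable def hilb (I : Ideal (MvPolynomial σ k)) (j : ℕ) : ℕ :=
  Module.finrank k (homogeneousSubmodule σ k j ⧸ degreePart I j)

theorem mem_degreePart {I : Ideal (MvPolynomial σ k)} {j : ℕ} {u : homogeneousSubmodule σ k j} :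
    u ∈ degreePart I j ↔ (u : MvPolynomial σ k) ∈ I := Iff.rfl

instance [Finite σ] (j : ℕ) : FiniteDimensional k (homogeneousSubmodule σ k j) :=
  Module.Finite.iff_fg.mpr (homogeneousSubmodule_fg σ k j)

theorem degreePart_mono {I J : Ideal (MvPolynomial σ k)} (h : I ≤ J) (j : ℕ) :
    degreePart I j ≤ degreePart J j := fun _ hu => h hu

theorem hilb_add_finrank [Finite σ] (I : Ideal (MvPolynomial σ k)) (j : ℕ) :
    hilb I j + Module.finrank k (degreePart I j) =
      Module.finrank k (homogeneousSubmodule σ k j) :=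
  Submodule.finrank_quotient_add_finrank _

theorem hilb_anti [Finite σ] {I J : Ideal (MvPolynomial σ k)} (h : I ≤ J) (j : ℕ) :
    hilb J j ≤ hilb I j := by
  have h1 := hilb_add_finrank I j
  have h2 := hilb_add_finrank J j
  have h3 := Submodule.finrank_mono (degreePart_mono h j)
  omega

theorem mem_of_hilb_le [Finite σ] {I J : Ideal (MvPolynomial σ k)} (h : I ≤ J) {j : ℕ}
    (hj : hilb I j ≤ hilb J j) {u : MvPolynomial σ k} (hu : u.IsHomogeneous j) (huJ : u ∈ J) :
    u ∈ I := by
  have h1 := hilb_add_finrank I j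
  have h2 := hilb_add_finrank J j
  have h3 := Submodule.eq_of_le_of_finrank_le (degreePart_mono h j) (by omega)
  have : (⟨u, hu⟩ : homogeneousSubmodule σ k j) ∈ degreePart I j := by
    rw [h3]; exact huJ
  exact this

theorem hilb_eq_zero_iff [Finite σ] {I : Ideal (MvPolynomial σ k)} {j : ℕ} :
    hilb I j = 0 ↔ ∀ u : MvPolynomial σ k, u.IsHomogeneous j → u ∈ I := by
  constructor
  · intro h u hu
    exact mem_of_hilb_le (le_top : I ≤ ⊤) (by omega) hu trivial
  · intro h
    have h1 := hilb_add_finrank I j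
    have h2 : degreePart I j = ⊤ := eq_top_iff.mpr fun u _ => h u u.2
    rw [h2, finrank_top] at h1
    omega

attribute [local instance] MvPolynomial.gradedAlgebra

theorem homogeneousComponent_mul_add {p f : MvPolynomial σ k} {d : ℕ} (hf : f.IsHomogeneous d)
    (j : ℕ) : homogeneousComponent (j + d) (p * f) = homogeneousComponent j p * f := by
  rw [← decomposition.decompose'_apply, ← decomposition.decompose'_apply]
  exact DirectSum.coe_decompose_mul_add_of_right_mem (homogeneousSubmodule σ k) (a := p) (i := j) hf

theorem homogeneousComponent_mul_of_lt {p f : MvPolynomial σ k} {d : ℕ} (hf : f.IsHomogeneous d)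
    {j : ℕ} (hj : j < d) : homogeneousComponent j (p * f) = 0 := by
  rw [← decomposition.decompose'_apply]
  exact DirectSum.coe_decompose_mul_of_right_mem_of_not_le (homogeneousSubmodule σ k) hf
    (not_le.mpr hj)

/-- `I` contains the homogeneous components of its elements. -/
def HomogIdeal (I : Ideal (MvPolynomial σ k)) : Prop :=
  ∀ p ∈ I, ∀ j, homogeneousComponent j p ∈ I

theorem homogIdeal_span_range {ι : Type*} {f : ι → MvPolynomial σ k} {d : ℕ}
    (hf : ∀ i, (f i).IsHomogeneous d) : HomogIdeal (Ideal.span (Set.range f)) := by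
  have h : (Ideal.span (Set.range f)).IsHomogeneous (homogeneousSubmodule σ k) := by
    refine Ideal.homogeneous_span _ _ ?_
    rintro _ ⟨i, rfl⟩
    exact ⟨d, hf i⟩
  exact fun p hp j => homogeneousComponent_mem_of_mem h hp j

theorem mem_sup_span_singleton_iff {I : Ideal (MvPolynomial σ k)} (hI : HomogIdeal I)
    {f : MvPolynomial σ k} {d : ℕ} (hf : f.IsHomogeneous d) {j : ℕ} {u : MvPolynomial σ k}
    (hu : u.IsHomogeneous (j + d)) :
    u ∈ I ⊔ Ideal.span {f} ↔ ∃ v : MvPolynomial σ k, v.IsHomogeneous j ∧ u - v * f ∈ I := by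
  constructor
  · intro h
    obtain ⟨a, ha, b, hb, rfl⟩ := Submodule.mem_sup.mp h
    obtain ⟨c, rfl⟩ := Ideal.mem_span_singleton'.mp hb
    refine ⟨homogeneousComponent j c, homogeneousComponent_isHomogeneous _ _, ?_⟩
    rw [← homogeneousComponent_mul_add hf]
    have : a + c * f - homogeneousComponent (j + d) (c * f) =
        homogeneousComponent (j + d) a := by
      rw [sub_eq_iff_eq_add, ← map_add]
      exact (homogeneousComponent_eq_self hu).symm
    rw [this]
    exact hI a ha _
  · rintro ⟨v, -, hv⟩
    have : u = (u - v * f) + v * f := by ring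
    rw [this]
    exact add_mem (Ideal.mem_sup_left hv)
      (Ideal.mem_sup_right (Ideal.mul_mem_left _ _ (Ideal.mem_span_singleton_self f)))

theorem hilb_sup_of_lt {I : Ideal (MvPolynomial σ k)} (hI : HomogIdeal I)
    {f : MvPolynomial σ k} {d : ℕ} (hf : f.IsHomogeneous d) {j : ℕ} (hj : j < d) :
    hilb (I ⊔ Ideal.span {f}) j = hilb I j := by
  have : degreePart (I ⊔ Ideal.span {f}) j = degreePart I j := by
    refine le_antisymm (fun u hu => ?_) (degreePart_mono le_sup_left j)
    rw [mem_degreePart] at hu ⊢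
    obtain ⟨a, ha, b, hb, hab⟩ := Submodule.mem_sup.mp hu
    obtain ⟨c, rfl⟩ := Ideal.mem_span_singleton'.mp hb
    rw [← homogeneousComponent_eq_self (mem_homogeneousSubmodule _ _ |>.mp u.2), ← hab, map_add,
      homogeneousComponent_mul_of_lt hf hj, add_zero]
    exact hI a ha _
  rw [hilb, hilb, this]

theorem hilb_add_degree [Finite σ] {I : Ideal (MvPolynomial σ k)} (hI : HomogIdeal I)
    {f : MvPolynomial σ k} {d : ℕ} (hf : f.IsHomogeneous d) (j : ℕ) :
    hilb I (j + d) = hilb (I ⊔ Ideal.span {f}) (j + d) + hilb (I.colon {f}) j := by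
  let m : homogeneousSubmodule σ k j →ₗ[k] homogeneousSubmodule σ k (j + d) :=
    ((LinearMap.mulRight k f).comp (homogeneousSubmodule σ k j).subtype).codRestrict _
      fun u => IsHomogeneous.mul u.2 hf
  let T := (degreePart I (j + d)).mkQ.comp m
  let π := Submodule.factor (degreePart_mono (le_sup_left : I ≤ I ⊔ Ideal.span {f}) (j + d))
  have hTker : LinearMap.ker T = degreePart (I.colon {f}) j := by
    ext u
    simp only [T, LinearMap.mem_ker, LinearMap.comp_apply, Submodule.mkQ_apply,
      Submodule.Quotient.mk_eq_zero, mem_degreePart, Submodule.mem_colon_singleton]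
    rfl
  have hπker : LinearMap.ker π = LinearMap.range T := by
    ext q
    obtain ⟨u, rfl⟩ := Submodule.mkQ_surjective _ q
    simp only [π, LinearMap.mem_ker, LinearMap.mem_range]
    rw [Submodule.factor_mk, Submodule.mkQ_apply, Submodule.Quotient.mk_eq_zero, mem_degreePart,
      mem_sup_span_singleton_iff hI hf u.2]
    constructor
    · rintro ⟨v, hv, h⟩
      refine ⟨⟨v, hv⟩, Eq.symm ?_⟩
      exact (Submodule.Quotient.eq _).mpr h
    · rintro ⟨v, h⟩
      exact ⟨v, v.2, (Submodule.Quotient.eq (degreePart I (j + d))).mp h.symm⟩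
  have h1 := LinearMap.finrank_range_add_finrank_ker π
  have h2 := LinearMap.finrank_range_add_finrank_ker T
  have h3 := hilb_add_finrank (I.colon {f}) j
  rw [LinearMap.range_eq_top.mpr (Submodule.factor_surjective _), finrank_top, hπker] at h1
  rw [hTker] at h2
  simp only [hilb] at h1 h2 h3 ⊢
  omega

theorem le_colon_singleton (I : Ideal (MvPolynomial σ k)) (f : MvPolynomial σ k) :
    I ≤ I.colon {f} := fun _ hu => Submodule.mem_colon_singleton.mpr (I.mul_mem_right f hu)



theorem finrank_homogeneousSubmodule [Fintype σ] (j : ℕ) :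
    Module.finrank k (homogeneousSubmodule σ k j) = (Fintype.card σ).multichoose j := by
  classical
  have hset : {d : σ →₀ ℕ | d.degree = j} =
      (Finset.finsuppAntidiag (Finset.univ : Finset σ) j : Set (σ →₀ ℕ)) := by
    ext d
    simp [Finset.mem_finsuppAntidiag, Finsupp.degree_eq_sum]
  have e : homogeneousSubmodule σ k j ≃ₗ[k]
      ((Finset.finsuppAntidiag (Finset.univ : Finset σ) j : Set (σ →₀ ℕ)) →₀ k) :=
    (LinearEquiv.ofEq _ _ (by rw [homogeneousSubmodule_eq_finsupp_supported, hset])).trans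
      (AddMonoidAlgebra.supportedEquivFinsupp _)
  rw [e.finrank_eq, ← Finset.card_univ, ← Finset.card_finsuppAntidiag_nat_eq_multichoose]
  simp

theorem hilb_bot [Finite σ] (j : ℕ) :
    hilb (⊥ : Ideal (MvPolynomial σ k)) j = Module.finrank k (homogeneousSubmodule σ k j) := by
  rw [← hilb_add_finrank ⊥ j]
  have : degreePart (⊥ : Ideal (MvPolynomial σ k)) j = ⊥ :=
    (Submodule.eq_bot_iff _).mpr fun u hu => Subtype.ext (Ideal.mem_bot.mp hu)
  rw [this, finrank_bot, add_zero]

/-- The Hilbert series of the quotient by an ideal. -/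
noncomputable def hilbertSeries (I : Ideal (MvPolynomial σ k)) : PowerSeries ℤ :=
  PowerSeries.mk fun j => (hilb I j : ℤ)

theorem hilbertSeries_bot (n : ℕ) :
    hilbertSeries (⊥ : Ideal (MvPolynomial (Fin n) k)) * (1 - PowerSeries.X) ^ n = 1 := by
  have : hilbertSeries (⊥ : Ideal (MvPolynomial (Fin n) k)) =
      (PowerSeries.invOneSubPow ℤ n).val := by
    ext j
    rw [hilbertSeries, PowerSeries.coeff_mk, hilb_bot, finrank_homogeneousSubmodule,
      Fintype.card_fin]
    rcases n with _ | n
    · rw [PowerSeries.invOneSubPow_zero, Units.val_one, PowerSeries.coeff_one]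
      rcases j with _ | j <;> simp
    · rw [PowerSeries.invOneSubPow_val_succ_eq_mk_add_choose, PowerSeries.coeff_mk,
        Nat.multichoose_eq]
      congr 1
      rw [show n + 1 + j - 1 = n + j by omega, Nat.choose_symm_add]
  rw [this, ← PowerSeries.invOneSubPow_inv_eq_one_sub_pow, Units.inv_eq_val_inv, Units.mul_inv]

theorem hilbertSeries_sup [Finite σ] {I : Ideal (MvPolynomial σ k)} (hI : HomogIdeal I)
    {f : MvPolynomial σ k} {d : ℕ} (hf : f.IsHomogeneous d) :
    hilbertSeries (I ⊔ Ideal.span {f}) = (1 - PowerSeries.X ^ d) * hilbertSeries I +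
      PowerSeries.X ^ d * (hilbertSeries I - hilbertSeries (I.colon {f})) := by
  have : hilbertSeries (I ⊔ Ideal.span {f}) =
      hilbertSeries I - PowerSeries.X ^ d * hilbertSeries (I.colon {f}) := by
    ext j
    rw [map_sub, PowerSeries.coeff_X_pow_mul']
    simp only [hilbertSeries, PowerSeries.coeff_mk]
    split_ifs with h
    · obtain ⟨i, rfl⟩ := Nat.exists_eq_add_of_le' h
      have := hilb_add_degree hI hf i
      rw [Nat.add_sub_cancel]
      omega
    · rw [hilb_sup_of_lt hI hf (not_le.mp h), sub_zero]
  rw [this]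
  ring

/-- The integer power series with nonnegative coefficients. -/
def nonnegSeries : Subsemiring (PowerSeries ℤ) where
  carrier := {p | ∀ j, 0 ≤ PowerSeries.coeff j p}
  mul_mem' {p q} hp hq j := by
    rw [PowerSeries.coeff_mul]
    exact Finset.sum_nonneg fun x _ => mul_nonneg (hp _) (hq _)
  one_mem' j := by
    rw [PowerSeries.coeff_one]
    split_ifs <;> simp
  add_mem' {p q} hp hq j := by
    rw [map_add]
    exact add_nonneg (hp j) (hq j)
  zero_mem' j := by simp

theorem X_pow_mem_nonnegSeries (d : ℕ) : (PowerSeries.X : PowerSeries ℤ) ^ d ∈ nonnegSeries := by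
  refine pow_mem (fun j => ?_) d
  rw [PowerSeries.coeff_X]
  split_ifs <;> simp

theorem eq_zero_of_add_eq_zero_of_mem_nonnegSeries {p q : PowerSeries ℤ} (hp : p ∈ nonnegSeries)
    (hq : q ∈ nonnegSeries) (h : p + q = 0) : p = 0 := by
  ext j
  have h1 := hp j
  have h2 := hq j
  have h3 := congrArg (PowerSeries.coeff j) h
  rw [map_add, map_zero] at h3
  rw [map_zero]
  omega

theorem hilbertSeries_sub_mem [Finite σ] {I J : Ideal (MvPolynomial σ k)} (h : I ≤ J) :
    hilbertSeries I - hilbertSeries J ∈ nonnegSeries := fun j => by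
  have := hilb_anti h j
  simp only [map_sub, hilbertSeries, PowerSeries.coeff_mk]
  omega

theorem exists_inv_one_sub_X_pow {d : ℕ} (hd : 0 < d) :
    ∃ S ∈ nonnegSeries, S * (1 - PowerSeries.X ^ d) = 1 := by
  refine ⟨PowerSeries.mk fun j => if d ∣ j then 1 else 0, fun j => ?_, ?_⟩
  · rw [PowerSeries.coeff_mk]
    split_ifs <;> simp
  · ext j
    rw [mul_sub, mul_one, map_sub, PowerSeries.coeff_mul_X_pow', PowerSeries.coeff_one]
    simp only [PowerSeries.coeff_mk]
    rcases lt_or_ge j d with h | h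
    · rw [if_neg (not_le.mpr h), sub_zero]
      congr 1
      exact propext ⟨fun h' => Nat.eq_zero_of_dvd_of_lt h' h, fun h' => h' ▸ dvd_zero d⟩
    · rw [if_pos h, if_neg (by omega : j ≠ 0)]
      have : d ∣ j - d ↔ d ∣ j := by
        rw [Nat.dvd_sub_iff_left h dvd_rfl]
      simp only [this, sub_self]

theorem span_range_succAbove {R : Type*} [CommRing R] {m : ℕ} (φ : Fin (m + 1) → R)
    (i : Fin (m + 1)) :
    Ideal.span (Set.range φ) =
      Ideal.span (Set.range (φ ∘ i.succAbove)) ⊔ Ideal.span {φ i} := by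
  rw [← Ideal.span_union, Set.range_comp, Fin.range_succAbove, ← Set.image_singleton,
    ← Set.image_union, Set.compl_union_self, Set.image_univ]

theorem hilbertSeries_mul_pow_sub_mem [Finite σ] {d : ℕ} {S : PowerSeries ℤ}
    (hS : S ∈ nonnegSeries) (hSd : S * (1 - PowerSeries.X ^ d) = 1) (m : ℕ)
    (φ : Fin m → MvPolynomial σ k) (hφ : ∀ i, (φ i).IsHomogeneous d) :
    hilbertSeries (Ideal.span (Set.range φ)) * S ^ m -
      hilbertSeries (⊥ : Ideal (MvPolynomial σ k)) ∈ nonnegSeries := by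
  induction m with
  | zero => simp
  | succ m ih =>
    have h1 := ih (φ ∘ (Fin.last m).succAbove) fun i => hφ _
    have h2 := homogIdeal_span_range (f := φ ∘ (Fin.last m).succAbove) fun i => hφ _
    rw [span_range_succAbove φ (Fin.last m), hilbertSeries_sup h2 (hφ (Fin.last m))]
    set I := Ideal.span (Set.range (φ ∘ (Fin.last m).succAbove))
    set N := hilbertSeries I - hilbertSeries (I.colon {φ (Fin.last m)}) with hN
    have h3 : N ∈ nonnegSeries := hilbertSeries_sub_mem (le_colon_singleton _ _)
    have : ((1 - PowerSeries.X ^ d) * hilbertSeries I + PowerSeries.X ^ d * N) * S ^ (m + 1) -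
        hilbertSeries (⊥ : Ideal (MvPolynomial σ k)) = (hilbertSeries I * S ^ m -
        hilbertSeries (⊥ : Ideal (MvPolynomial σ k))) + PowerSeries.X ^ d * N * S ^ (m + 1) := by
      linear_combination (hilbertSeries I * S ^ m) * hSd
    rw [this]
    exact add_mem h1 (mul_mem (mul_mem (X_pow_mem_nonnegSeries d) h3) (pow_mem hS _))

theorem hilb_eq_of_surjective {τ : Type*} [Finite σ] [Finite τ]
    (ψ : MvPolynomial σ k →ₐ[k] MvPolynomial τ k) (ι : MvPolynomial τ k →ₐ[k] MvPolynomial σ k)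
    (hψ : ∀ p j, p.IsHomogeneous j → (ψ p).IsHomogeneous j)
    (hι : ∀ p j, p.IsHomogeneous j → (ι p).IsHomogeneous j) (hψι : ∀ q, ψ (ι q) = q)
    {I : Ideal (MvPolynomial σ k)} {J : Ideal (MvPolynomial τ k)} (hIJ : ∀ p, p ∈ I ↔ ψ p ∈ J)
    (j : ℕ) : hilb I j = hilb J j := by
  let m : homogeneousSubmodule σ k j →ₗ[k] homogeneousSubmodule τ k j :=
    (ψ.toLinearMap.comp (homogeneousSubmodule σ k j).subtype).codRestrict _
      fun u => hψ _ _ u.2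
  let T := (degreePart J j).mkQ.comp m
  have hker : LinearMap.ker T = degreePart I j := by
    ext u
    simp only [T, LinearMap.mem_ker, LinearMap.comp_apply, Submodule.mkQ_apply,
      Submodule.Quotient.mk_eq_zero, mem_degreePart, hIJ]
    rfl
  have hm : Function.Surjective m := fun q => ⟨⟨ι q, hι _ _ q.2⟩, Subtype.ext (hψι q)⟩
  have hT : LinearMap.range T = ⊤ :=
    LinearMap.range_eq_top.mpr ((Submodule.mkQ_surjective _).comp hm)
  have h1 := LinearMap.finrank_range_add_finrank_ker T
  have h2 := hilb_add_finrank I j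
  rw [hT, finrank_top, hker] at h1
  simp only [hilb] at h2 ⊢
  omega

theorem exists_hilb_eq_zero [IsAlgClosed k] [Finite σ] {I : Ideal (MvPolynomial σ k)}
    (hI : ∀ x : σ → k, (∀ p ∈ I, eval x p = 0) → x = 0) :
    ∃ J, ∀ j, J ≤ j → hilb I j = 0 := by
  have h1 : idealOfVars σ k ≤ I.radical := by
    rw [← vanishingIdeal_zeroLocus_eq_radical (K := k), idealOfVars, Ideal.span_le]
    rintro _ ⟨i, rfl⟩ x hx
    have := hI x fun p hp => by simpa [coe_aeval_eq_eval] using hx p hp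
    simp [this]
  obtain ⟨J, hJ⟩ := Ideal.exists_pow_le_of_le_radical_of_fg h1 (idealOfVars_fg σ k)
  refine ⟨J, fun j hj => hilb_eq_zero_iff.mpr fun u hu => hJ ?_⟩
  rw [mem_pow_idealOfVars_iff]
  intro x hx
  rwa [hu.degree_eq_sum_deg_support hx] at hj

theorem hilb_bounded [Finite σ] {I : Ideal (MvPolynomial σ k)} (hI : HomogIdeal I)
    {f : MvPolynomial σ k} {d : ℕ} (hd : 0 < d) (hf : f.IsHomogeneous d) {J : ℕ}
    (hJ : ∀ j, J ≤ j → hilb (I ⊔ Ideal.span {f}) j = 0) : ∃ B, ∀ j, hilb I j ≤ B := by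
  refine ⟨∑ i ∈ Finset.range (J + d), hilb I i, fun j => ?_⟩
  induction j using Nat.strong_induction_on with
  | _ j ih =>
    rcases lt_or_ge j (J + d) with h | h
    · exact Finset.single_le_sum (f := fun i => hilb I i) (fun _ _ => Nat.zero_le _)
        (Finset.mem_range.mpr h)
    · obtain ⟨i, rfl⟩ := Nat.exists_eq_add_of_le' (show d ≤ j by omega)
      have h1 := hilb_add_degree hI hf i
      have h2 := hilb_anti (le_colon_singleton I f) i
      have h3 := hJ (i + d) (by omega)
      have h4 := ih i (by omega)
      omega

/-- A form which is eventually surjective modulo `I` is a nonzerodivisor on forms modulo `I`,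
if the Hilbert function of `I` is eventually constant and some linear form is a nonzerodivisor. -/
theorem mem_of_mul_mem_of_eventually_const [Finite σ] {I : Ideal (MvPolynomial σ k)}
    (hI : HomogIdeal I) {f g : MvPolynomial σ k} {d : ℕ} (hf : f.IsHomogeneous d)
    (hg : g.IsHomogeneous 1)
    (hgI : ∀ j (u : MvPolynomial σ k), u.IsHomogeneous j → u * g ∈ I → u ∈ I) {J : ℕ}
    (hconst : ∀ j, J ≤ j → hilb I (j + 1) = hilb I j)
    (hzero : ∀ j, J ≤ j → hilb (I ⊔ Ideal.span {f}) j = 0) (j : ℕ) (u : MvPolynomial σ k)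
    (hu : u.IsHomogeneous j) (huf : u * f ∈ I) : u ∈ I := by
  have hconst' : ∀ j, J ≤ j → ∀ i, hilb I (j + i) = hilb I j := by
    intro j hj i
    induction i with
    | zero => rfl
    | succ i ih => rw [← ih, ← add_assoc, hconst _ (by omega)]
  have hlarge : ∀ j, J ≤ j → ∀ u : MvPolynomial σ k, u.IsHomogeneous j → u * f ∈ I → u ∈ I := by
    intro j hj u hu huf
    refine mem_of_hilb_le (le_colon_singleton I f) ?_ hu (Submodule.mem_colon_singleton.mpr huf)
    have h1 := hilb_add_degree hI hf j
    have h2 := hzero (j + d) (by omega)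
    have h3 := hconst' j hj d
    omega
  have hgpow : ∀ s j (u : MvPolynomial σ k), u.IsHomogeneous j → u * g ^ s ∈ I → u ∈ I := by
    intro s
    induction s with
    | zero => simp
    | succ s ih =>
      intro j u hu h
      refine hgI j u hu (ih (j + 1) _ (hu.mul hg) ?_)
      rwa [mul_assoc, ← pow_succ']
  refine hgpow J j u hu (hlarge (j + J) (by omega) _ ?_ ?_)
  · simpa using hu.mul (hg.pow J)
  · rw [mul_right_comm]
    exact I.mul_mem_right _ huf

/-- The linear form with coefficients `1, c, c ^ 2, …`. -/
noncomputable def powForm (n : ℕ) (c : k) : MvPolynomial (Fin (n + 1)) k :=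
  ∑ i : Fin (n + 1), C (c ^ (i : ℕ)) * X i

theorem isHomogeneous_powForm (n : ℕ) (c : k) : (powForm n c).IsHomogeneous 1 :=
  IsHomogeneous.sum _ _ _ fun _ _ => isHomogeneous_C_mul_X _ _

theorem exists_eval_powForm_ne_zero [Infinite k] {n N : ℕ} (A : Fin N → Fin (n + 1) → k)
    (hA : ∀ t, A t ≠ 0) : ∃ c, ∀ t, eval (A t) (powForm n c) ≠ 0 := by
  let P : Fin N → Polynomial k := fun t => ∑ i : Fin (n + 1), Polynomial.monomial i (A t i)
  have hP : ∀ t, P t ≠ 0 := by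
    intro t h
    obtain ⟨i, hi⟩ := Function.ne_iff.mp (hA t)
    refine hi ?_
    have := congrArg (fun p => Polynomial.coeff p i) h
    simpa [P, Polynomial.finsetSum_coeff, Polynomial.coeff_monomial, Fin.val_inj] using this
  obtain ⟨c, hc⟩ := Polynomial.exists_eval_ne_zero_of_natDegree_lt_card (∏ t, P t)
    (Finset.prod_ne_zero_iff.mpr fun t _ => hP t)
    (Cardinal.natCast_lt_aleph0.trans_le (Cardinal.aleph0_le_mk k))
  refine ⟨c, fun t ht => hc ?_⟩
  rw [Polynomial.eval_prod]
  refine Finset.prod_eq_zero (Finset.mem_univ t) ?_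
  rw [← ht]
  simp [P, powForm, Polynomial.eval_finsetSum, mul_comm]

theorem exists_powForm_zeros [Infinite k] {n B : ℕ} {I : Ideal (MvPolynomial (Fin (n + 1)) k)}
    (hB : ∀ j, hilb I j ≤ B) :
    ∃ c, ∀ x : Fin (n + 1) → k, (∀ p ∈ I, eval x p = 0) → eval x (powForm n c) = 0 → x = 0 := by
  by_contra! hbad
  have key : ∀ N, ∃ A : Fin N → Fin (n + 1) → k, ∃ D, (∀ t, A t ≠ 0) ∧
      (∀ t, ∀ p ∈ I, eval (A t) p = 0) ∧
      ∀ y : Fin N → k, ∃ p : MvPolynomial (Fin (n + 1)) k, p.IsHomogeneous D ∧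
        ∀ t, eval (A t) p = y t := by
    intro N
    induction N with
    | zero => exact ⟨0, 0, nofun, nofun, fun y => ⟨0, isHomogeneous_zero _ _ _, nofun⟩⟩
    | succ N ih =>
      obtain ⟨A, D, hA0, hAI, hA⟩ := ih
      obtain ⟨c, hc⟩ := exists_eval_powForm_ne_zero A hA0
      obtain ⟨b, hbI, hbc, hb0⟩ := hbad c
      obtain ⟨i, hi⟩ := Function.ne_iff.mp hb0
      have hi' : b i ^ (D + 1) ≠ 0 := pow_ne_zero _ hi
      refine ⟨Fin.cons b A, D + 1, fun t => ?_, fun t => ?_, fun y => ?_⟩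
      · cases t using Fin.cases <;> simp [hA0, hb0]
      · cases t using Fin.cases
        · simpa using hbI
        · simpa using hAI _
      · let q : MvPolynomial (Fin (n + 1)) k := C (y 0 / b i ^ (D + 1)) * X i ^ (D + 1)
        obtain ⟨p, hp, hpA⟩ := hA fun t =>
          (y t.succ - eval (A t) q) / eval (A t) (powForm n c)
        refine ⟨p * powForm n c + q, (hp.mul (isHomogeneous_powForm n c)).add
          (isHomogeneous_C_mul_X_pow _ _ _), fun t => ?_⟩
        cases t using Fin.cases with
        | zero => simp [hbc, q, hi']
        | succ t => simp [hpA, hc]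
  obtain ⟨A, D, -, hAI, hA⟩ := key (B + 1)
  let E : homogeneousSubmodule (Fin (n + 1)) k D →ₗ[k] (Fin (B + 1) → k) :=
    LinearMap.pi fun t => (aeval (A t)).toLinearMap.comp (Submodule.subtype _)
  have hE_apply : ∀ u t, E u t = eval (A t) (u : MvPolynomial (Fin (n + 1)) k) := fun u t =>
    RingHom.congr_fun (coe_aeval_eq_eval (A t)) (u : MvPolynomial (Fin (n + 1)) k)
  clear_value E
  have hE : LinearMap.range E = ⊤ := by
    refine LinearMap.range_eq_top.mpr fun y => ?_
    obtain ⟨p, hp, hpy⟩ := hA y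
    refine ⟨⟨p, hp⟩, ?_⟩
    ext t
    rw [hE_apply, hpy]
  have hker : degreePart I D ≤ LinearMap.ker E := fun u hu => by
    rw [LinearMap.mem_ker]
    ext t
    exact (hE_apply u t).trans (hAI t _ hu)
  have h1 := LinearMap.finrank_range_add_finrank_ker E
  have h2 := Submodule.finrank_mono hker
  have h3 := hilb_add_finrank I D
  have h4 := hB D
  rw [hE, finrank_top, Module.finrank_fin_fun] at h1
  omega

/-- Elimination of the first variable by means of `powForm n c`. -/
noncomputable def elimFirst (n : ℕ) (c : k) :
    MvPolynomial (Fin (n + 1)) k →ₐ[k] MvPolynomial (Fin n) k :=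
  aeval (Fin.cons (-∑ i : Fin n, C (c ^ (i.succ : ℕ)) * X i) X)

theorem elimFirst_powForm (n : ℕ) (c : k) : elimFirst n c (powForm n c) = 0 := by
  simp [elimFirst, powForm, Fin.sum_univ_succ, algHom_C, algebraMap_eq]

theorem elimFirst_rename (n : ℕ) (c : k) (q : MvPolynomial (Fin n) k) :
    elimFirst n c (rename Fin.succ q) = q := by
  rw [elimFirst, aeval_rename]
  exact aeval_X_left_apply q

theorem isHomogeneous_elimFirst (n : ℕ) (c : k) {p : MvPolynomial (Fin (n + 1)) k} {j : ℕ}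
    (hp : p.IsHomogeneous j) : (elimFirst n c p).IsHomogeneous j := by
  have := IsHomogeneous.aeval hp
    (Fin.cons (-∑ i : Fin n, C (c ^ (i.succ : ℕ)) * X i) X : Fin (n + 1) → MvPolynomial (Fin n) k)
    (n := 1) fun i => by
      cases i using Fin.cases
      · exact (IsHomogeneous.sum _ _ _ fun _ _ => isHomogeneous_C_mul_X _ _).neg
      · exact isHomogeneous_X _ _
  simpa [elimFirst] using this

theorem eval_elimFirst (n : ℕ) (c : k) (x : Fin n → k) (p : MvPolynomial (Fin (n + 1)) k) :
    eval x (elimFirst n c p) = eval (Fin.cons (-∑ i : Fin n, c ^ (i.succ : ℕ) * x i) x) p := by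
  rw [← coe_aeval_eq_eval, ← coe_aeval_eq_eval]
  have : (aeval x).comp (elimFirst n c) =
      aeval (Fin.cons (-∑ i : Fin n, c ^ (i.succ : ℕ) * x i) x : Fin (n + 1) → k) :=
    algHom_ext fun i => by cases i using Fin.cases <;> simp [elimFirst]
  exact AlgHom.congr_fun this p

theorem sub_rename_elimFirst_mem (n : ℕ) (c : k) (p : MvPolynomial (Fin (n + 1)) k) :
    p - rename Fin.succ (elimFirst n c p) ∈ Ideal.span {powForm n c} := by
  let J := Ideal.span {powForm n c}
  have : Ideal.Quotient.mkₐ k J =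
      (Ideal.Quotient.mkₐ k J).comp ((rename Fin.succ).comp (elimFirst n c)) := by
    ext i
    cases i using Fin.cases with
    | zero =>
      refine (Ideal.Quotient.mk_eq_mk_iff_sub_mem _ _).mpr ?_
      convert Ideal.mem_span_singleton_self (powForm n c) using 1
      simp [elimFirst, powForm, Fin.sum_univ_succ]
    | succ i => simp [elimFirst]
  exact (Ideal.Quotient.mk_eq_mk_iff_sub_mem _ _).mp (DFunLike.congr_fun this p)

theorem mem_sup_powForm_iff {n : ℕ} (c : k) {ι : Type*} (φ : ι → MvPolynomial (Fin (n + 1)) k)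
    (p : MvPolynomial (Fin (n + 1)) k) :
    p ∈ Ideal.span (Set.range φ) ⊔ Ideal.span {powForm n c} ↔
      elimFirst n c p ∈ Ideal.span (Set.range (elimFirst n c ∘ φ)) := by
  constructor
  · have : Ideal.span (Set.range φ) ⊔ Ideal.span {powForm n c} ≤
        (Ideal.span (Set.range (elimFirst n c ∘ φ))).comap (elimFirst n c) := by
      rw [sup_le_iff, Ideal.span_le, Ideal.span_le]
      constructor
      · rintro _ ⟨i, rfl⟩
        exact Ideal.subset_span ⟨i, rfl⟩
      · rintro _ rfl
        simp [elimFirst_powForm]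
    exact fun h => this h
  · intro h
    set J := Ideal.span (Set.range φ) ⊔ Ideal.span {powForm n c}
    have hJ : ∀ q, q - rename Fin.succ (elimFirst n c q) ∈ J := fun q =>
      Ideal.mem_sup_right (sub_rename_elimFirst_mem n c q)
    have : Ideal.span (Set.range (elimFirst n c ∘ φ)) ≤ J.comap (rename Fin.succ) := by
      rw [Ideal.span_le]
      rintro _ ⟨i, rfl⟩
      have h1 : φ i ∈ J := Ideal.mem_sup_left (Ideal.subset_span ⟨i, rfl⟩)
      simpa using sub_mem h1 (hJ (φ i))
    simpa using add_mem (hJ p) (this h)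

theorem eval_eq_zero_of_mem_span {ι : Type*} {φ : ι → MvPolynomial σ k} {x : σ → k}
    (hx : ∀ i, eval x (φ i) = 0) {p : MvPolynomial σ k} (hp : p ∈ Ideal.span (Set.range φ)) :
    eval x p = 0 := by
  have : Ideal.span (Set.range φ) ≤ RingHom.ker (eval x) := by
    rw [Ideal.span_le]
    rintro _ ⟨i, rfl⟩
    exact hx i
  exact this hp

theorem exists_hilb_span_eq_zero [IsAlgClosed k] [Finite σ] {ι : Type*}
    {φ : ι → MvPolynomial σ k} (hφ : ∀ x : σ → k, (∀ i, eval x (φ i) = 0) → x = 0) :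
    ∃ J, ∀ j, J ≤ j → hilb (Ideal.span (Set.range φ)) j = 0 :=
  exists_hilb_eq_zero fun x hx => hφ x fun i => hx _ (Ideal.subset_span ⟨i, rfl⟩)

theorem hilb_colon_eq [Finite σ] {I : Ideal (MvPolynomial σ k)} {f : MvPolynomial σ k}
    {j : ℕ} (h : ∀ u : MvPolynomial σ k, u.IsHomogeneous j → u * f ∈ I → u ∈ I) :
    hilb (I.colon {f}) j = hilb I j := by
  have : degreePart (I.colon {f}) j = degreePart I j :=
    le_antisymm (fun (u : homogeneousSubmodule σ k j) hu =>
        h u u.2 (Submodule.mem_colon_singleton.mp hu))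
      (degreePart_mono (le_colon_singleton I f) j)
  rw [hilb, hilb, this]

theorem hilbertSeries_eq_iff [Finite σ] {I J : Ideal (MvPolynomial σ k)} :
    hilbertSeries I = hilbertSeries J ↔ ∀ j, hilb I j = hilb J j := by
  simp [hilbertSeries, PowerSeries.ext_iff]

theorem regular_of_hilbertSeries [IsAlgClosed k] {n d : ℕ} (hd : 0 < d)
    (ih : ∀ ψ : Fin n → MvPolynomial (Fin n) k, (∀ i, (ψ i).IsHomogeneous d) →
      (∀ x : Fin n → k, (∀ i, eval x (ψ i) = 0) → x = 0) →
      hilbertSeries (Ideal.span (Set.range ψ)) * (1 - PowerSeries.X) ^ n =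
        (1 - PowerSeries.X ^ d) ^ n)
    (φ : Fin (n + 1) → MvPolynomial (Fin (n + 1)) k) (hφ : ∀ i, (φ i).IsHomogeneous d)
    (hzero : ∀ x : Fin (n + 1) → k, (∀ i, eval x (φ i) = 0) → x = 0) (i : Fin (n + 1)) :
    (∀ j (u : MvPolynomial (Fin (n + 1)) k), u.IsHomogeneous j →
      u * φ i ∈ Ideal.span (Set.range (φ ∘ i.succAbove)) →
      u ∈ Ideal.span (Set.range (φ ∘ i.succAbove))) ∧
    hilbertSeries (Ideal.span (Set.range (φ ∘ i.succAbove))) * (1 - PowerSeries.X) ^ (n + 1) =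
      (1 - PowerSeries.X ^ d) ^ n := by
  have hI : HomogIdeal (Ideal.span (Set.range (φ ∘ i.succAbove))) :=
    homogIdeal_span_range fun l => hφ _
  obtain ⟨J, hJ⟩ := exists_hilb_span_eq_zero hzero
  rw [span_range_succAbove φ i] at hJ
  obtain ⟨B, hB⟩ := hilb_bounded hI hd (hφ i) hJ
  obtain ⟨c, hc⟩ := exists_powForm_zeros hB
  let ψ := elimFirst n c ∘ φ ∘ i.succAbove
  have hψ0 : ∀ x : Fin n → k, (∀ l, eval x (ψ l) = 0) → x = 0 := by
    intro x hx
    have h1 := hc (Fin.cons (-∑ i : Fin n, c ^ (i.succ : ℕ) * x i) x)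
      (fun p hp => eval_eq_zero_of_mem_span
        (fun l => by simpa [ψ, eval_elimFirst] using hx l) hp)
      (by rw [← eval_elimFirst, elimFirst_powForm, map_zero])
    funext l
    simpa using congrFun h1 l.succ
  have hilb_ψ := hilb_eq_of_surjective (elimFirst n c) (rename Fin.succ)
    (fun p j hp => isHomogeneous_elimFirst n c hp) (fun p j hp => hp.rename_isHomogeneous)
    (elimFirst_rename n c) (mem_sup_powForm_iff c (φ ∘ i.succAbove))
  have hH := ih ψ (fun l => isHomogeneous_elimFirst n c (hφ _)) hψ0
  obtain ⟨J', hJ'⟩ := exists_hilb_span_eq_zero hψ0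
  set I := Ideal.span (Set.range (φ ∘ i.succAbove))
  set g := powForm n c with hg_def
  have hg : g.IsHomogeneous 1 := isHomogeneous_powForm n c
  have hHψ : hilbertSeries (Ideal.span (Set.range ψ)) =
      (1 - PowerSeries.X) * hilbertSeries I +
        PowerSeries.X * (hilbertSeries I - hilbertSeries (I.colon {g})) := by
    have := hilbertSeries_sup hI hg
    rw [pow_one] at this
    rw [← this]
    ext j
    simp [hilbertSeries, hilb_ψ j, ψ]
  obtain ⟨T, hT, hT1⟩ := exists_inv_one_sub_X_pow one_pos
  obtain ⟨S, hS, hS1⟩ := exists_inv_one_sub_X_pow hd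
  rw [pow_one] at hT1
  have hbot := hilbertSeries_bot (k := k) (n + 1)
  set E := hilbertSeries (⊥ : Ideal (MvPolynomial (Fin (n + 1)) k))
  have hE : E = T ^ (n + 1) := by
    calc E = E * (T * (1 - PowerSeries.X)) ^ (n + 1) := by rw [hT1, one_pow, mul_one]
      _ = (E * (1 - PowerSeries.X) ^ (n + 1)) * T ^ (n + 1) := by rw [mul_pow]; ring
      _ = T ^ (n + 1) := by rw [hbot, one_mul]
  have hlow : hilbertSeries I * S ^ n - E ∈ nonnegSeries :=
    hilbertSeries_mul_pow_sub_mem hS hS1 n (φ ∘ i.succAbove) fun l => hφ _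
  set N := hilbertSeries I - hilbertSeries (I.colon {g}) with hN
  have hN0 : N ∈ nonnegSeries := hilbertSeries_sub_mem (le_colon_singleton _ _)
  have hHψS : hilbertSeries (Ideal.span (Set.range ψ)) * S ^ n = T ^ n := by
    calc _ = hilbertSeries (Ideal.span (Set.range ψ)) * (T * (1 - PowerSeries.X)) ^ n * S ^ n := by
          rw [hT1, one_pow, mul_one]
      _ = (hilbertSeries (Ideal.span (Set.range ψ)) * (1 - PowerSeries.X) ^ n) * T ^ n * S ^ n := by
          rw [mul_pow]; ring
      _ = T ^ n * (S * (1 - PowerSeries.X ^ d)) ^ n := by rw [hH, mul_pow]; ring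
      _ = T ^ n := by rw [hS1, one_pow, mul_one]
  have hsum : PowerSeries.X * N * T * S ^ n + (hilbertSeries I * S ^ n - E) = 0 := by
    have : PowerSeries.X * N * T * S ^ n =
        hilbertSeries (Ideal.span (Set.range ψ)) * S ^ n * T -
          (T * (1 - PowerSeries.X)) * (hilbertSeries I * S ^ n) := by
      rw [hHψ]; ring
    rw [this, hHψS, hT1, hE]
    ring
  have hX : (PowerSeries.X : PowerSeries ℤ) ∈ nonnegSeries := by
    simpa using X_pow_mem_nonnegSeries 1
  have hmem : PowerSeries.X * N * T * S ^ n ∈ nonnegSeries :=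
    mul_mem (mul_mem (mul_mem hX hN0) hT) (pow_mem hS n)
  have hNzero : N = 0 := by
    have h0 := eq_zero_of_add_eq_zero_of_mem_nonnegSeries hmem hlow hsum
    have hT0 : T ≠ 0 := left_ne_zero_of_mul_eq_one hT1
    have hS0 : S ≠ 0 := left_ne_zero_of_mul_eq_one hS1
    simpa [hT0, hS0, PowerSeries.X_ne_zero] using h0
  have hcolon := hilbertSeries_eq_iff.mp (sub_eq_zero.mp hNzero)
  have hIS : hilbertSeries I * S ^ n = E :=
    sub_eq_zero.mp (eq_zero_of_add_eq_zero_of_mem_nonnegSeries hlow hmem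
      ((add_comm _ _).trans hsum))
  refine ⟨?_, ?_⟩
  · refine mem_of_mul_mem_of_eventually_const hI (hφ i) hg (J := max J J') ?_ ?_ ?_
    · intro j u hu hug
      exact mem_of_hilb_le (le_colon_singleton I g) (hcolon j).le hu
        (Submodule.mem_colon_singleton.mpr hug)
    · intro j hj
      have h1 := hilb_add_degree hI hg j
      rw [hilb_ψ, hJ' (j + 1) (by have := le_max_right J J'; omega), ← hcolon, zero_add] at h1
      exact h1
    · exact fun j hj => hJ j ((le_max_left _ _).trans hj)
  · calc _ = hilbertSeries I * (S * (1 - PowerSeries.X ^ d)) ^ n *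
          (1 - PowerSeries.X) ^ (n + 1) := by rw [hS1, one_pow, mul_one]
      _ = (hilbertSeries I * S ^ n) * (1 - PowerSeries.X) ^ (n + 1) *
          (1 - PowerSeries.X ^ d) ^ n := by rw [mul_pow]; ring
      _ = _ := by rw [hIS, hbot, one_mul]

/-- The Hilbert series of a complete intersection of `n` forms of degree `d` in `n` variables. -/
theorem hilbertSeries_mul_one_sub_X_pow [IsAlgClosed k] {n d : ℕ} (hd : 0 < d)
    (φ : Fin n → MvPolynomial (Fin n) k) (hφ : ∀ i, (φ i).IsHomogeneous d)
    (hzero : ∀ x : Fin n → k, (∀ i, eval x (φ i) = 0) → x = 0) :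
    hilbertSeries (Ideal.span (Set.range φ)) * (1 - PowerSeries.X) ^ n =
      (1 - PowerSeries.X ^ d) ^ n := by
  induction n with
  | zero => simpa using hilbertSeries_bot (k := k) 0
  | succ n ih =>
    obtain ⟨h1, h2⟩ := regular_of_hilbertSeries hd ih φ hφ hzero (Fin.last n)
    have hI : HomogIdeal (Ideal.span (Set.range (φ ∘ (Fin.last n).succAbove))) :=
      homogIdeal_span_range fun l => hφ _
    rw [span_range_succAbove φ (Fin.last n), hilbertSeries_sup hI (hφ _),
      hilbertSeries_eq_iff.mpr fun j => hilb_colon_eq (h1 j), sub_self, mul_zero, add_zero,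
      mul_assoc, h2, pow_succ']

theorem mem_span_of_mul_mem_span [IsAlgClosed k] {n d : ℕ} (hd : 0 < d)
    (φ : Fin (n + 1) → MvPolynomial (Fin (n + 1)) k) (hφ : ∀ i, (φ i).IsHomogeneous d)
    (hzero : ∀ x : Fin (n + 1) → k, (∀ i, eval x (φ i) = 0) → x = 0) (i : Fin (n + 1))
    {j : ℕ} {u : MvPolynomial (Fin (n + 1)) k} (hu : u.IsHomogeneous j)
    (h : u * φ i ∈ Ideal.span (Set.range (φ ∘ i.succAbove))) :
    u ∈ Ideal.span (Set.range (φ ∘ i.succAbove)) :=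
  (regular_of_hilbertSeries hd (hilbertSeries_mul_one_sub_X_pow hd) φ hφ hzero i).1 j u hu h

theorem exists_homogeneous_coeff {ι : Type*} [Fintype ι] {f : ι → MvPolynomial σ k} {d j : ℕ}
    (hf : ∀ i, (f i).IsHomogeneous d) {u : MvPolynomial σ k} (hu : u.IsHomogeneous (j + d))
    (h : u ∈ Ideal.span (Set.range f)) :
    ∃ c : ι → homogeneousSubmodule σ k j, ∑ i, (c i : MvPolynomial σ k) * f i = u := by
  obtain ⟨c, rfl⟩ := (Ideal.mem_span_range_iff_exists_fun).mp h
  refine ⟨fun i => ⟨homogeneousComponent j (c i), homogeneousComponent_isHomogeneous _ _⟩, ?_⟩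
  rw [← homogeneousComponent_of_mem hu (m := j + d) |>.trans (if_pos rfl), map_sum]
  exact Finset.sum_congr rfl fun i _ => (homogeneousComponent_mul_add (hf i) j).symm

/-- The map sending a tuple of forms of degree `j` to the combination of the `f i` having these
forms as coefficients. -/
noncomputable def combination {ι : Type*} [Fintype ι] (f : ι → MvPolynomial σ k) (j : ℕ) :
    (ι → homogeneousSubmodule σ k j) →ₗ[k] MvPolynomial σ k :=
  ∑ i, LinearMap.mulRight k (f i) ∘ₗ (homogeneousSubmodule σ k j).subtype ∘ₗ LinearMap.proj i

theorem combination_apply {ι : Type*} [Fintype ι] (f : ι → MvPolynomial σ k) (j : ℕ)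
    (w : ι → homogeneousSubmodule σ k j) :
    combination f j w = ∑ i, (w i : MvPolynomial σ k) * f i := by
  simp [combination]

theorem finrank_range_combination {ι : Type*} [Fintype ι] {f : ι → MvPolynomial σ k} {d : ℕ}
    (hf : ∀ i, (f i).IsHomogeneous d) (j : ℕ) :
    Module.finrank k (LinearMap.range (combination f j)) =
      Module.finrank k (degreePart (Ideal.span (Set.range f)) (j + d)) := by
  have : LinearMap.range (combination f j) =
      (degreePart (Ideal.span (Set.range f)) (j + d)).map
        (homogeneousSubmodule σ k (j + d)).subtype := by
    ext u
    constructor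
    · rintro ⟨w, rfl⟩
      rw [combination_apply]
      exact ⟨⟨∑ i, (w i : MvPolynomial σ k) * f i,
        IsHomogeneous.sum _ _ _ fun i _ =>
          IsHomogeneous.mul (w i).2 (hf i)⟩,
        Ideal.sum_mem _ fun i _ =>
          Ideal.mul_mem_left _ _ (Ideal.subset_span (Set.mem_range_self i)),
        rfl⟩
    · rintro ⟨u, hu, rfl⟩
      obtain ⟨c, hc⟩ := exists_homogeneous_coeff hf u.2 hu
      exact ⟨c, (combination_apply f j c).trans hc⟩
  rw [this, Submodule.finrank_map_subtype_eq]

theorem card_mul_finrank_quotient_add_finrank_pi {V : Type*} [AddCommGroup V] [Module k V]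
    [FiniteDimensional k V] {ι : Type*} [Fintype ι] (N : Submodule k V) :
    Fintype.card ι * Module.finrank k (V ⧸ N) +
        Module.finrank k (Submodule.pi (Set.univ : Set ι) fun _ => N) =
      Module.finrank k (ι → V) := by
  classical
  rw [← Submodule.finrank_quotient_add_finrank (Submodule.pi (Set.univ : Set ι) fun _ => N),
    (Submodule.quotientPi fun _ : ι => N).finrank_eq, Module.finrank_pi_fintype]
  simp

theorem map_combination {ι : Type*} [Fintype ι] {f : ι → MvPolynomial σ k} {d : ℕ}
    (hf : ∀ i, (f i).IsHomogeneous d) (j : ℕ) :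
    (Submodule.pi (Set.univ : Set ι) fun _ => degreePart (Ideal.span (Set.range f)) (j + d)).map
        (combination f (j + d)) =
      Submodule.span k {p | ∃ e : MvPolynomial σ k, ∃ i l : ι,
        e.IsHomogeneous j ∧ p = e * (f i * f l)} := by
  classical
  refine le_antisymm ?_ (Submodule.span_le.mpr ?_)
  · rintro _ ⟨w, hw, rfl⟩
    rw [combination_apply]
    refine Submodule.sum_mem _ fun l _ => ?_
    obtain ⟨c, hc⟩ := exists_homogeneous_coeff hf (w l).2 (hw l trivial)
    rw [← hc, Finset.sum_mul]
    exact Submodule.sum_mem _ fun i _ =>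
      Submodule.subset_span ⟨c i, i, l, (c i).2, mul_assoc _ _ _⟩
  · rintro _ ⟨e, i, l, he, rfl⟩
    let u : homogeneousSubmodule σ k (j + d) := ⟨e * f i, he.mul (hf i)⟩
    refine ⟨Pi.single l u, fun t _ => ?_, ?_⟩
    · rcases eq_or_ne t l with rfl | h
      · rw [Pi.single_eq_same]
        exact mem_degreePart.mpr
          (Ideal.mul_mem_left _ _ (Ideal.subset_span (Set.mem_range_self i)))
      · simp [Pi.single_eq_of_ne h]
    · rw [combination_apply, Finset.sum_eq_single l]
      · simp [u, mul_assoc]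
      · intro b _ hb
        simp [Pi.single_eq_of_ne hb]
      · simp

theorem finrank_map_add_finrank_ker {V W : Type*} [AddCommGroup V] [Module k V]
    [FiniteDimensional k V] [AddCommGroup W] [Module k W] (φ : V →ₗ[k] W) {K : Submodule k V}
    (h : LinearMap.ker φ ≤ K) :
    Module.finrank k (K.map φ) + Module.finrank k (LinearMap.ker φ) = Module.finrank k K := by
  rw [← (φ.domRestrict K).finrank_range_add_finrank_ker, LinearMap.range_domRestrict,
    LinearMap.ker_domRestrict, (Submodule.comapSubtypeEquivOfLe h).finrank_eq]

theorem ker_combination_le [IsAlgClosed k] {n d : ℕ} (hd : 0 < d)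
    (φ : Fin (n + 1) → MvPolynomial (Fin (n + 1)) k) (hφ : ∀ i, (φ i).IsHomogeneous d)
    (hzero : ∀ x : Fin (n + 1) → k, (∀ i, eval x (φ i) = 0) → x = 0) (j : ℕ) :
    LinearMap.ker (combination φ j) ≤
      Submodule.pi Set.univ fun _ => degreePart (Ideal.span (Set.range φ)) j := by
  intro w hw i _
  rw [LinearMap.mem_ker, combination_apply, Fin.sum_univ_succAbove _ i] at hw
  refine Ideal.span_mono (Set.range_comp_subset_range i.succAbove φ)
    (mem_span_of_mul_mem_span hd φ hφ hzero i (w i).2 ?_)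
  rw [Submodule.subtype_apply, eq_neg_of_add_eq_zero_left hw]
  exact neg_mem (Ideal.sum_mem _ fun l _ =>
    Ideal.mul_mem_left _ _ (Ideal.subset_span ⟨l, rfl⟩))

theorem finrank_span_products_add [IsAlgClosed k] {n d : ℕ} (hd : 0 < d)
    (φ : Fin (n + 1) → MvPolynomial (Fin (n + 1)) k) (hφ : ∀ i, (φ i).IsHomogeneous d)
    (hzero : ∀ x : Fin (n + 1) → k, (∀ i, eval x (φ i) = 0) → x = 0) (j : ℕ) :
    Module.finrank k (Submodule.span k {p | ∃ e : MvPolynomial (Fin (n + 1)) k,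
        ∃ i l : Fin (n + 1), e.IsHomogeneous j ∧ p = e * (φ i * φ l)}) +
      (n + 1) * hilb (Ideal.span (Set.range φ)) (j + d) +
      hilb (Ideal.span (Set.range φ)) (j + d + d) = (n + 1).multichoose (j + d + d) := by
  have h1 := finrank_map_add_finrank_ker _ (ker_combination_le hd φ hφ hzero (j + d))
  have h2 := (combination φ (j + d)).finrank_range_add_finrank_ker
  have h3 := finrank_range_combination hφ (j + d)
  have h4 := card_mul_finrank_quotient_add_finrank_pi (ι := Fin (n + 1))
    (degreePart (Ideal.span (Set.range φ)) (j + d))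
  have h5 := hilb_add_finrank (Ideal.span (Set.range φ)) (j + d + d)
  rw [map_combination hφ j] at h1
  rw [finrank_homogeneousSubmodule] at h5
  rw [Fintype.card_fin] at h4 h5
  rw [← hilb] at h4
  omega

theorem reflect_geom_sum_pow (d n : ℕ) :
    Polynomial.reflect (n * d) ((∑ i ∈ Finset.range (d + 1), Polynomial.X ^ i : Polynomial ℤ) ^ n) =
      (∑ i ∈ Finset.range (d + 1), Polynomial.X ^ i) ^ n := by
  set P : Polynomial ℤ := ∑ i ∈ Finset.range (d + 1), Polynomial.X ^ i with hP
  have hdeg : P.natDegree ≤ d :=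
    Polynomial.natDegree_sum_le_of_forall_le _ _ fun i hi =>
      (Polynomial.natDegree_X_pow_le i).trans (by grind)
  have hrefl : Polynomial.reflect d P = P := by
    ext i
    rw [Polynomial.coeff_reflect]
    simp only [hP, Polynomial.finsetSum_coeff, Polynomial.coeff_X_pow, Finset.sum_ite_eq,
      Finset.mem_range]
    rcases le_or_gt i d with h | h
    · rw [Polynomial.revAt_le h, if_pos (by omega), if_pos (by omega)]
    · rw [Polynomial.revAt_eq_self_of_lt h]
  induction n with
  | zero => simp
  | succ n ih =>
    rw [pow_succ, add_mul, one_mul,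
      Polynomial.reflect_mul _ _ (Polynomial.natDegree_pow_le_of_le n hdeg) hdeg, ih, hrefl]

theorem hilb_eq_hilb_sub [Finite σ] {I : Ideal (MvPolynomial σ k)} {n d : ℕ}
    (h : hilbertSeries I * (1 - PowerSeries.X) ^ n = (1 - PowerSeries.X ^ (d + 1)) ^ n)
    {j : ℕ} (hj : j ≤ n * d) : hilb I (n * d - j) = hilb I j := by
  have hX : (1 - PowerSeries.X : PowerSeries ℤ) ≠ 0 := fun h0 => by
    simpa using congrArg (PowerSeries.coeff 0) h0
  have hG : hilbertSeries I =
      (((∑ i ∈ Finset.range (d + 1), Polynomial.X ^ i : Polynomial ℤ) ^ n : Polynomial ℤ) :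
        PowerSeries ℤ) := by
    refine mul_right_cancel₀ (pow_ne_zero n hX) ?_
    rw [h, Polynomial.coe_pow, ← mul_pow, ← geom_sum_mul_neg]
    congr 2
    rw [← Polynomial.coeToPowerSeries.ringHom_apply, map_sum]
    simp
  have hcoeff (i : ℕ) : (hilb I i : ℤ) =
      ((∑ i ∈ Finset.range (d + 1), Polynomial.X ^ i : Polynomial ℤ) ^ n).coeff i := by
    rw [← Polynomial.coeff_coe, ← hG, hilbertSeries, PowerSeries.coeff_mk]
  have := hcoeff j
  rw [← reflect_geom_sum_pow, Polynomial.coeff_reflect, Polynomial.revAt_le hj, ← hcoeff] at this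
  exact_mod_cast this.symm

theorem hilb_add_of_hilbertSeries {n : ℕ} {I : Ideal (MvPolynomial (Fin n) k)} {d : ℕ} (hd : 0 < d)
    (h : hilbertSeries I * (1 - PowerSeries.X) ^ n = (1 - PowerSeries.X ^ d) ^ n) :
    hilb I d + n = n.multichoose d ∧ hilb I 0 = 1 := by
  have hser : hilbertSeries I =
      hilbertSeries (⊥ : Ideal (MvPolynomial (Fin n) k)) * (1 - PowerSeries.X ^ d) ^ n := by
    rw [← h, mul_left_comm, hilbertSeries_bot, mul_one]
  obtain ⟨Q, hQ⟩ := Polynomial.powAddExpansion (1 : PowerSeries ℤ) (-PowerSeries.X ^ d) n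
  rw [sub_eq_add_neg, hQ] at hser
  have hbot (j : ℕ) : PowerSeries.coeff j (hilbertSeries (⊥ : Ideal (MvPolynomial (Fin n) k))) =
      n.multichoose j := by
    rw [hilbertSeries, PowerSeries.coeff_mk, hilb_bot, finrank_homogeneousSubmodule,
      Fintype.card_fin]
  have hcoeff (j : ℕ) : (hilb I j : ℤ) = PowerSeries.coeff j
      (hilbertSeries (⊥ : Ideal (MvPolynomial (Fin n) k)) -
        (n : PowerSeries ℤ) *
          (hilbertSeries (⊥ : Ideal (MvPolynomial (Fin n) k)) * PowerSeries.X ^ d) +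
        hilbertSeries (⊥ : Ideal (MvPolynomial (Fin n) k)) * Q * PowerSeries.X ^ (2 * d)) := by
    rw [← PowerSeries.coeff_mk j fun j => (hilb I j : ℤ), ← hilbertSeries, hser]
    congr 1
    rw [one_pow, one_pow]
    ring
  have hcoeff' (j : ℕ) := hcoeff j
  simp only [map_add, map_sub, PowerSeries.coeff_mul_X_pow', hbot, ← nsmul_eq_mul, map_nsmul]
    at hcoeff'
  constructor
  · have := hcoeff' d
    rw [if_pos le_rfl, if_neg (by omega), Nat.sub_self, Nat.multichoose_zero_right] at this
    simp at this
    omega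
  · have := hcoeff' 0
    rw [if_neg (by omega), if_neg (by omega), Nat.multichoose_zero_right] at this
    simpa using this


end HilbertFunction

end MvPolynomial

theorem prodSpan_eq {k : Type*} [Field k] (n d : ℕ) (f : Fin n → MvPolynomial (Fin n) k) :
    prodSpan n d f = Submodule.span k
      {p | ∃ e : MvPolynomial (Fin n) k, ∃ i l : Fin n,
        e.IsHomogeneous (n * (d - 1) - 2 * d) ∧ p = e * (f i * f l)} := by
  refine congrArg (Submodule.span k) (Set.ext fun p => ⟨?_, ?_⟩)
  · rintro ⟨e, i, l, he, -, rfl⟩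
    exact ⟨e, i, l, he, rfl⟩
  · rintro ⟨e, i, l, he, rfl⟩
    rcases le_total i l with h | h
    · exact ⟨e, i, l, he, h, rfl⟩
    · exact ⟨e, l, i, he, h, by rw [mul_comm (f i)]⟩

/-- For `n ≥ 3`, `d ≥ 2`, `(n,d) ≠ (3,2)` and homogeneous `f_1, …, f_n` of degree `d` over an
algebraically closed field of characteristic zero whose only common zero is the origin,
`C(n(d−1)+n−1, n−1) − dim_k P = n·C(d+n−1, n−1) − n² + 1`. -/
theorem stmt_6 {k : Type*} [Field k] [IsAlgClosed k] [CharZero k]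
    (n d : ℕ) (hn : 3 ≤ n) (hd : 2 ≤ d) (hnd : (n, d) ≠ (3, 2))
    (f : Fin n → MvPolynomial (Fin n) k)
    (hf : ∀ i, (f i).IsHomogeneous d)
    (hzero : ∀ x : Fin n → k, (∀ i, MvPolynomial.eval x (f i) = 0) → x = 0) :
    ((n * (d - 1) + n - 1).choose (n - 1) : ℤ) - Module.finrank k (prodSpan n d f)
      = n * ((d + n - 1).choose (n - 1)) - (n : ℤ) ^ 2 + 1 := by
  obtain ⟨n, rfl⟩ : ∃ m, n = m + 1 := ⟨n - 1, by omega⟩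
  obtain ⟨d, rfl⟩ : ∃ c, d = c + 1 := ⟨d - 1, by omega⟩
  have hle : 2 * (d + 1) ≤ (n + 1) * d := by
    rcases Nat.lt_or_ge n 3 with h | h
    · obtain rfl : n = 2 := by omega
      have : d ≠ 1 := fun h => hnd (by rw [h])
      omega
    · nlinarith
  obtain ⟨e, he⟩ := Nat.exists_eq_add_of_le' hle
  have hmulti (j : ℕ) : (n + 1).multichoose j = (j + (n + 1) - 1).choose (n + 1 - 1) := by
    rw [Nat.multichoose_eq, add_right_comm, Nat.add_sub_cancel, Nat.add_sub_cancel,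
      ← add_assoc, Nat.add_sub_cancel, add_comm n j, Nat.choose_symm_add]
  have hser := MvPolynomial.hilbertSeries_mul_one_sub_X_pow d.succ_pos f hf hzero
  have hcount := MvPolynomial.finrank_span_products_add d.succ_pos f hf hzero e
  obtain ⟨hdeg, h0⟩ := MvPolynomial.hilb_add_of_hilbertSeries d.succ_pos hser
  have hm := MvPolynomial.hilb_eq_hilb_sub hser (Nat.zero_le _)
  have hmd := MvPolynomial.hilb_eq_hilb_sub hser (j := d + 1) (by omega)
  rw [Nat.sub_zero, h0] at hm
  rw [show (n + 1) * d - (d + 1) = e + (d + 1) by omega] at hmd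
  rw [show e + (d + 1) + (d + 1) = (n + 1) * d by omega, hm, hmd, hmulti] at hcount
  rw [hmulti] at hdeg
  rw [prodSpan_eq, Nat.add_sub_cancel d 1, show (n + 1) * d - 2 * (d + 1) = e by omega,
    ← hcount, ← hdeg]
  push_cast
  ring
end

section
/- For all integers p ≥ 1 and r ≥ 1, Σ_{m=0}^{⌊p(r−1)/r⌋} (−1)^m C(p, m) C(pr−mr−1, p−1) = 1. -/
/-- The falling factorial `(-1)(-2)⋯(-n)` equals `(-1)^n n!`. -/
theorem descPochhammer_eval_neg_one (n : ℕ) :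
    (descPochhammer ℤ n).eval (-1) = (-1) ^ n * n.factorial := by
  induction n with
  | zero => simp
  | succ n ih =>
    rw [descPochhammer_succ_eval, ih, Nat.factorial_succ]
    push_cast
    ring

open Polynomial in
/-- The alternating binomial sum of the values of a polynomial of degree less than `n` at
`n, n - 1, …, 0` vanishes. -/
theorem Polynomial.alternating_sum_choose_mul_eval_eq_zero {P : ℤ[X]} {n : ℕ}
    (hP : P.natDegree < n) :
    ∑ m ∈ Finset.range (n + 1), (-1 : ℤ) ^ m * n.choose m * P.eval ((n : ℤ) - m) = 0 := by
  have h := congrFun (Polynomial.fwdDiff_iter_eq_zero_of_degree_lt hP) 0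
  rw [fwdDiff_iter_eq_sum_shift, ← Finset.sum_range_reflect] at h
  refine (Finset.sum_congr rfl fun m hm => ?_).trans h
  have hm' : m ≤ n := Nat.lt_succ_iff.mp (Finset.mem_range.mp hm)
  rw [show n + 1 - 1 - m = n - m by omega, Nat.sub_sub_self hm', Nat.choose_symm hm']
  simp [Nat.cast_sub hm']

open Polynomial in
/-- For all integers `p ≥ 1` and `r ≥ 1`,
`∑_{m=0}^{⌊p(r−1)/r⌋} (−1)^m C(p, m) C(pr−mr−1, p−1) = 1`. -/
theorem stmt_8 (p r : ℕ) (hp : 1 ≤ p) (hr : 1 ≤ r) :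
    ∑ m ∈ Finset.range (p * (r - 1) / r + 1),
      (-1 : ℤ) ^ m * (p.choose m) * ((p * r - m * r - 1).choose (p - 1)) = 1 := by
  have hle : p * (r - 1) / r + 1 ≤ p :=
    (Nat.div_lt_iff_lt_mul hr).mpr (Nat.mul_lt_mul_of_pos_left (by omega) hp)
  rw [Finset.sum_subset (Finset.range_mono hle) fun m hm hm' => ?_]
  · obtain ⟨q, rfl⟩ := Nat.exists_eq_add_of_le' hp
    have hdeg : ((descPochhammer ℤ q).comp (C (r : ℤ) * X + C (-1))).natDegree < q + 1 := by
      refine Nat.lt_succ_of_le (natDegree_comp_le.trans ?_)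
      rw [descPochhammer_natDegree]
      exact (Nat.mul_le_mul_left q natDegree_linear_le).trans_eq (mul_one q)
    have h := alternating_sum_choose_mul_eval_eq_zero hdeg
    rw [Finset.sum_range_succ] at h
    simp only [eval_comp, eval_add, eval_mul, eval_C, eval_X, sub_self, mul_zero, zero_add,
      descPochhammer_eval_neg_one, Nat.choose_self, Nat.cast_one, mul_one] at h
    have hsign : (-1 : ℤ) ^ (q + 1) * ((-1) ^ q * q.factorial) = -q.factorial := by
      rw [← mul_assoc, ← pow_add, show q + 1 + q = 2 * q + 1 by ring, pow_succ, pow_mul]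
      simp
    rw [hsign, add_neg_eq_zero] at h
    refine mul_right_cancel₀ (Nat.cast_ne_zero.mpr q.factorial_ne_zero : (q.factorial : ℤ) ≠ 0) ?_
    rw [one_mul, Finset.sum_mul]
    refine (Finset.sum_congr rfl fun m hm => ?_).trans h
    have hm' : m < q + 1 := Finset.mem_range.mp hm
    have hpos : 1 ≤ (q + 1 - m) * r := Nat.mul_pos (Nat.sub_pos_of_lt hm') hr
    have harg : (r : ℤ) * (((q + 1 : ℕ) : ℤ) - m) + -1
        = (((q + 1) * r - m * r - 1 : ℕ) : ℤ) := by
      rw [← Nat.sub_mul, Nat.cast_sub hpos, Nat.cast_mul, Nat.cast_sub hm'.le]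
      push_cast
      ring
    rw [harg, descPochhammer_eval_eq_descFactorial, Nat.descFactorial_eq_factorial_mul_choose,
      Nat.add_sub_cancel]
    push_cast
    ring
  · have hlt : p * (r - 1) < m * r := by
      rw [← Nat.div_lt_iff_lt_mul hr]
      simpa using hm'
    have hlt' : p * r - m * r - 1 < p - 1 := by
      have hpm : m * r + r ≤ p * r := by
        simpa [Nat.succ_mul] using Nat.mul_le_mul_right r (Finset.mem_range.mp hm)
      rw [Nat.mul_sub_one] at hlt
      omega
    simp [Nat.choose_eq_zero_of_lt hlt']
end

section
/- For all integers p ≥ 1 and r ≥ 1, Σ_{m=0}^{⌊p(r−1)/r⌋} (−1)^m C(p+1, m) C(pr−mr, p) = C(p+r−1, p). -/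
open Polynomial in
/-- The alternating binomial sum of a polynomial of degree less than `n` vanishes. -/
theorem Polynomial.sum_alternating_choose_mul_eval_eq_zero (P : ℤ[X]) {n : ℕ}
    (hP : P.natDegree < n) :
    ∑ m ∈ Finset.range (n + 1), (-1 : ℤ) ^ m * (n.choose m) * P.eval (m : ℤ) = 0 := by
  have h := congrFun (Polynomial.fwdDiff_iter_eq_zero_of_degree_lt hP) 0
  rw [fwdDiff_iter_eq_sum_shift] at h
  have h' := congrArg (fun z : ℤ ↦ (-1) ^ n * z) h
  simp only [Pi.zero_apply, mul_zero, Finset.mul_sum] at h'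
  rw [← h']
  refine Finset.sum_congr rfl fun m hm ↦ ?_
  have hmn : m ≤ n := Nat.lt_succ_iff.mp (Finset.mem_range.mp hm)
  have hsign : (-1 : ℤ) ^ n * (-1) ^ (n - m) = (-1) ^ m := by
    obtain ⟨k, rfl⟩ := Nat.exists_eq_add_of_le hmn
    rw [Nat.add_sub_cancel_left, pow_add, mul_assoc, ← mul_pow]
    simp
  simp only [zero_add, smul_eq_mul, nsmul_eq_mul, mul_one]
  rw [← hsign]
  ring

/-- The descending Pochhammer polynomial at a negative integer, as a binomial coefficient. -/
theorem descPochhammer_eval_neg_natCast (p r : ℕ) :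
    (descPochhammer ℤ p).eval (-(r : ℤ)) =
      (-1) ^ p * (p.factorial * ((p + r - 1).choose p : ℤ)) := by
  have h := ascPochhammer_eval_neg_eq_descPochhammer ℤ (-(r : ℤ)) p
  rw [neg_neg, ascPochhammer_nat_eq_natCast_ascFactorial,
    Nat.ascFactorial_eq_factorial_mul_choose', add_comm r p, Nat.cast_mul] at h
  rw [h, ← mul_assoc, ← mul_pow]
  simp

/-- For all integers `p ≥ 1` and `r ≥ 1`,
`∑_{m=0}^{⌊p(r−1)/r⌋} (−1)^m C(p+1, m) C(pr−mr, p) = C(p+r−1, p)`. -/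
theorem stmt_9 (p r : ℕ) (hp : 1 ≤ p) (hr : 1 ≤ r) :
    ∑ m ∈ Finset.range (p * (r - 1) / r + 1),
      (-1 : ℤ) ^ m * ((p + 1).choose m) * ((p * r - m * r).choose p)
      = (p + r - 1).choose p := by
  have hle : p * (r - 1) / r ≤ p :=
    Nat.div_le_of_le_mul (by rw [mul_comm r]; exact Nat.mul_le_mul_left p (Nat.sub_le r 1))
  have hextend : ∑ m ∈ Finset.range (p * (r - 1) / r + 1),
        (-1 : ℤ) ^ m * ((p + 1).choose m) * ((p * r - m * r).choose p) =
      ∑ m ∈ Finset.range (p + 1),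
        (-1 : ℤ) ^ m * ((p + 1).choose m) * ((p * r - m * r).choose p) := by
    refine Finset.sum_subset (Finset.range_subset_range.mpr (by omega)) fun m _ hm ↦ ?_
    have hlt : p * (r - 1) < m * r :=
      (Nat.div_lt_iff_lt_mul hr).mp (by rw [Finset.mem_range] at hm; omega)
    rw [Nat.mul_sub, mul_one] at hlt
    have hlt' : p * r - m * r < p := by omega
    rw [Nat.choose_eq_zero_of_lt hlt', Nat.cast_zero, mul_zero]
  rw [hextend]
  let P : Polynomial ℤ := (descPochhammer ℤ p).comp
    (Polynomial.C (-(r : ℤ)) * Polynomial.X + Polynomial.C ((p : ℤ) * r))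
  have hdeg : P.natDegree < p + 1 := by
    refine Nat.lt_succ_of_le (Polynomial.natDegree_comp_le.trans ?_)
    rw [descPochhammer_natDegree]
    exact (Nat.mul_le_mul_left p Polynomial.natDegree_linear_le).trans_eq (mul_one p)
  have heval (x : ℤ) : P.eval x = (descPochhammer ℤ p).eval (-r * x + p * r) := by
    simp [P]
  have h := P.sum_alternating_choose_mul_eval_eq_zero hdeg
  have hterm : ∀ m ∈ Finset.range (p + 1),
      (-1 : ℤ) ^ m * ((p + 1).choose m) * P.eval (m : ℤ) =
        p.factorial * ((-1 : ℤ) ^ m * ((p + 1).choose m) * ((p * r - m * r).choose p)) := by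
    intro m hm
    have hmp : m * r ≤ p * r :=
      Nat.mul_le_mul_right r (Nat.lt_succ_iff.mp (Finset.mem_range.mp hm))
    have hx : -(r : ℤ) * m + p * r = ((p * r - m * r : ℕ) : ℤ) := by
      push_cast [hmp]
      ring
    rw [heval, hx, descPochhammer_eval_eq_descFactorial,
      Nat.descFactorial_eq_factorial_mul_choose, Nat.cast_mul]
    ring
  have hlast : -(r : ℤ) * ((p + 1 : ℕ) : ℤ) + p * r = -(r : ℤ) := by
    push_cast
    ring
  have hsign : (-1 : ℤ) ^ (p + 1) * (-1) ^ p = -1 := by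
    rw [pow_succ, mul_right_comm, ← mul_pow]
    simp
  rw [Finset.sum_range_succ, Finset.sum_congr rfl hterm, ← Finset.mul_sum, heval, hlast,
    descPochhammer_eval_neg_natCast, Nat.choose_self, Nat.cast_one, mul_one, ← mul_assoc, hsign]
    at h
  refine mul_left_cancel₀ (Nat.cast_ne_zero.mpr p.factorial_ne_zero : (p.factorial : ℤ) ≠ 0) ?_
  linarith
end

section
/- For all integers n ≥ 1 and m ≥ 2, Σ_{p=0}^{m} (−1)^p · p · C(n+1, m−p) C(n+p−1, p) = 0. -/
theorem Ring.choose_neg_natCast_succ (n k : ℕ) :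
    Ring.choose (-((n + 1 : ℕ) : ℤ)) k = (-1) ^ k * ((n + k).choose k : ℤ) := by
  rw [Ring.choose_neg, show ((n + 1 : ℕ) : ℤ) + k - 1 = ((n + k : ℕ) : ℤ) by push_cast; ring,
    Ring.choose_natCast, Int.negOnePow_def, zpow_natCast, Units.smul_def]
  simp

theorem Int.sum_neg_one_pow_mul_choose_mul_choose_eq_zero (n : ℕ) {k : ℕ} (hk : 0 < k) :
    ∑ j ∈ Finset.range (k + 1),
      (-1 : ℤ) ^ j * ((n + j).choose j) * ((n + 1).choose (k - j)) = 0 := by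
  have h := Ring.add_choose_eq k (Commute.all (-((n + 1 : ℕ) : ℤ)) ((n + 1 : ℕ) : ℤ))
  rw [neg_add_cancel, Ring.choose_zero_pos ℤ hk,
    Finset.Nat.sum_antidiagonal_eq_sum_range_succ_mk] at h
  simpa only [Ring.choose_neg_natCast_succ, Ring.choose_natCast] using h.symm

/-- For all integers `n ≥ 1` and `m ≥ 2`,
`∑_{p=0}^{m} (−1)^p p C(n+1, m−p) C(n+p−1, p) = 0`. -/
theorem stmt_11 (n m : ℕ) (hn : 1 ≤ n) (hm : 2 ≤ m) :
    ∑ p ∈ Finset.range (m + 1),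
      (-1 : ℤ) ^ p * p * ((n + 1).choose (m - p)) * ((n + p - 1).choose p) = 0 := by
  obtain ⟨k, rfl⟩ := Nat.exists_eq_add_of_le' (one_le_two.trans hm)
  have h := Int.sum_neg_one_pow_mul_choose_mul_choose_eq_zero n (k := k) (by omega)
  rw [Finset.sum_range_succ']
  simp only [Nat.cast_zero, mul_zero, zero_mul, add_zero]
  rw [← mul_zero (-(n : ℤ)), ← h, Finset.mul_sum]
  refine Finset.sum_congr rfl fun j _ => ?_
  have absorb : ((n + j).choose (j + 1) : ℤ) * (j + 1) = (n + j).choose j * n := by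
    have := Nat.choose_succ_right_eq (n + j) j
    rw [Nat.add_sub_cancel] at this
    exact_mod_cast this
  rw [Nat.add_sub_add_right, ← Nat.add_assoc, Nat.add_sub_cancel, Nat.cast_succ, pow_succ]
  linear_combination (-(-1 : ℤ) ^ j * (n + 1).choose (k - j)) * absorb
end

section
/- Let n ≥ 5 be an integer and, for an integer s ≥ 1, set δ_s = (s(s+1)/2)·C(n+s−1, s+2). Then for every integer m with 5 ≤ m ≤ n+1, δ_{m−2} + Σ_{ℓ=1}^{m−4} (−1)^ℓ Σ' C(n+r_1−1, n−1)⋯C(n+r_ℓ−1, n−1)·δ_s = (−1)^m (m−1) C(n+1, m), where the inner sum Σ' runs over all tuples of integers (r_1, …, r_ℓ, s) with r_1 + ⋯ + r_ℓ + s = m−2, r_1, …, r_{ℓ−1} ≥ 1, r_ℓ ≥ 2, and s ≥ 1. -/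
/-- `δ_s = (s(s+1)/2)·C(n+s−1, s+2)`. -/
def deltaIK (n s : ℕ) : ℤ := (s * (s + 1) / 2 : ℕ) * ((n + s - 1).choose (s + 2))

open PowerSeries in
/-- The coefficient of a product over `Fin k` is a sum over antidiagonal tuples. -/
theorem PowerSeries.coeff_prod_fin {R : Type*} [CommSemiring R] (k N : ℕ) (f : Fin k → R⟦X⟧) :
    coeff N (∏ i, f i) =
      ∑ t ∈ Finset.Nat.antidiagonalTuple k N, ∏ i, coeff (t i) (f i) := by
  rw [PowerSeries.coeff_prod]
  refine Finset.sum_equiv Finsupp.equivFunOnFinite (fun t => ?_) (fun t _ => rfl)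
  simp [Finset.Nat.mem_antidiagonalTuple, Finset.mem_finsuppAntidiag]

open PowerSeries in
theorem PowerSeries.coeff_one_sub_X_pow (n k : ℕ) :
    coeff k ((1 - X : ℤ⟦X⟧) ^ n) = (-1) ^ k * (n.choose k : ℤ) := by
  have h : (1 - X : ℤ⟦X⟧) ^ n =
      rescale (-1 : ℤ) (((1 + Polynomial.X) ^ n : Polynomial ℤ) : ℤ⟦X⟧) := by
    simp [rescale_X, sub_eq_add_neg]
  rw [h, coeff_rescale, Polynomial.coeff_coe, Polynomial.coeff_one_add_X_pow]

/-- If `F (1 + H) = 1`, then `∑_{l < L} (-1)^(l+1) H^l G D` is `-G D F`, up to a multiple of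
`H ^ L`. -/
theorem sum_neg_pow_mul_eq {R : Type*} [CommRing R] {F H : R} (h : F * (1 + H) = 1) (G D : R)
    (L : ℕ) :
    ∑ l ∈ Finset.range L, (-1) ^ (l + 1) * (H ^ l * G * D) =
      -(G * D * F) + (-1) ^ L * (F * (H ^ L * G * D)) := by
  induction L with
  | zero => simp; ring
  | succ L ih =>
    rw [Finset.sum_range_succ, ih]
    linear_combination (-1) ^ (L + 1) * (H ^ L * G * D) * h * (-1)

/-- The generating function of `deltaIK n`. -/
noncomputable def deltaSeries (n : ℕ) : PowerSeries ℤ := PowerSeries.mk (deltaIK n)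

/-- The power series `∑_j C(d + j, d) X ^ j`. -/
noncomputable def chooseSeries (d : ℕ) : PowerSeries ℤ :=
  PowerSeries.mk fun j => ((d + j).choose d : ℤ)

open PowerSeries in
theorem chooseSeries_mul (d : ℕ) : chooseSeries d * (1 - X) ^ (d + 1) = 1 :=
  mk_add_choose_mul_one_sub_pow_eq_one ℤ d

theorem deltaIK_add_three (a s : ℕ) :
    deltaIK (a + 3) s = ((a + 2).choose 2 : ℤ) * ((a + 2 + s).choose (a + 2)) -
      (a + 1) * ((a + 2 + s).choose (a + 1)) + (a + 2 + s).choose a := by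
  have e1 : ((a + 2 + s).choose (s + 2)) = (a + 2 + s).choose a :=
    Nat.choose_symm_of_eq_add (by omega)
  have e2 := Nat.choose_succ_right_eq (a + 2 + s) a
  have e3 := Nat.choose_succ_right_eq (a + 2 + s) (a + 1)
  rw [show a + 2 + s - a = s + 2 by omega] at e2
  rw [show a + 2 + s - (a + 1) = s + 1 by omega] at e3
  have e4 : 2 * (a + 2).choose 2 = (a + 2) * (a + 1) := by
    rw [Nat.choose_two_right, Nat.mul_div_cancel' (Nat.even_mul_pred_self _).two_dvd]
    rfl
  have e5 : 2 * (s * (s + 1) / 2) = s * (s + 1) :=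
    Nat.mul_div_cancel' (Nat.even_mul_succ_self s).two_dvd
  unfold deltaIK
  rw [show a + 3 + s - 1 = a + 2 + s by omega, e1]
  generalize s * (s + 1) / 2 = q at *
  zify at e2 e3 e4 e5
  rw [show a + 1 + 1 = a + 2 by omega] at e3
  refine mul_left_cancel₀ (two_ne_zero (α := ℤ)) ?_
  linear_combination ((a + 2 + s).choose a : ℤ) * e5 -
    ((a + 2 + s).choose (a + 2) : ℤ) * e4 - (a + 1) * e3 - (s + 1) * e2 + 2 * e2

open PowerSeries in
theorem X_sq_mul_deltaSeries (a : ℕ) :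
    X ^ 2 * deltaSeries (a + 3) + 1 = C ((a + 2).choose 2 : ℤ) * (X ^ 2 * chooseSeries (a + 2)) -
      C (a + 1 : ℤ) * (X * chooseSeries (a + 1)) + chooseSeries a := by
  ext j
  match j with
  | 0 => simp [chooseSeries]
  | 1 =>
    have h : coeff 1 (X * chooseSeries (a + 1)) = coeff 0 (chooseSeries (a + 1)) :=
      coeff_succ_X_mul 0 _
    simp only [map_add, map_sub, add_mul, coeff_C_mul, h]
    simp [chooseSeries, coeff_X_pow_mul', coeff_one]
  | s + 2 =>
    simp only [map_add, map_sub, add_mul, coeff_C_mul, coeff_X_pow_mul, coeff_one, coeff_succ_X_mul,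
      deltaSeries, chooseSeries, coeff_mk, deltaIK_add_three]
    rw [show a + 1 + (s + 1) = a + 2 + s by omega, show a + (s + 2) = a + 2 + s by omega]
    simp

open PowerSeries in
theorem X_sq_mul_deltaSeries_mul_one_sub_X_pow (a : ℕ) :
    X ^ 2 * (deltaSeries (a + 3) * (1 - X) ^ (a + 3)) =
      C ((a + 2).choose 2 : ℤ) * X ^ 2 - C (a + 1 : ℤ) * X * (1 - X) + (1 - X) ^ 2 -
        (1 - X) ^ (a + 3) := by
  have h0 := chooseSeries_mul a
  have h1 := chooseSeries_mul (a + 1)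
  have h2 := chooseSeries_mul (a + 2)
  linear_combination (1 - X) ^ (a + 3) * X_sq_mul_deltaSeries a +
    C ((a + 2).choose 2 : ℤ) * X ^ 2 * h2 - C (a + 1 : ℤ) * X * (1 - X) * h1 + (1 - X) ^ 2 * h0

open PowerSeries in
theorem coeff_deltaSeries_mul (a m : ℕ) (hm : 4 ≤ m) :
    coeff (m - 2) (deltaSeries (a + 3) * (1 - X) ^ (a + 3) * (1 + C (a + 3 : ℤ) * X)) =
      (-1) ^ m * ((m : ℤ) - 1) * ((a + 3 + 1).choose m) := by
  obtain ⟨p, rfl⟩ : ∃ p, m = p + 4 := ⟨m - 4, by omega⟩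
  have hX : X ^ 2 * (deltaSeries (a + 3) * (1 - X) ^ (a + 3) * (1 + C (a + 3 : ℤ) * X)) =
      C ((a + 2).choose 2 : ℤ) * X ^ 2 + C (((a + 2).choose 2 : ℤ) * (a + 3)) * X ^ 3
      - C (a + 1 : ℤ) * X + C (a + 1 : ℤ) * X ^ 2 - C ((a + 1) * (a + 3) : ℤ) * X ^ 2
      + C ((a + 1) * (a + 3) : ℤ) * X ^ 3
      + 1 - C 2 * X + X ^ 2 + C (a + 3 : ℤ) * X - C (2 * (a + 3) : ℤ) * X ^ 2
      + C (a + 3 : ℤ) * X ^ 3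
      - (1 - X) ^ (a + 3) - C (a + 3 : ℤ) * (X * (1 - X) ^ (a + 3)) := by
    have h2 : (C 2 : ℤ⟦X⟧) = 2 := rfl
    simp only [map_mul, h2]
    linear_combination (1 + C (a + 3 : ℤ) * X) * X_sq_mul_deltaSeries_mul_one_sub_X_pow a
  have h := congrArg (coeff (p + 2 + 2)) hX
  rw [coeff_X_pow_mul] at h
  rw [show p + 4 - 2 = p + 2 by omega, h]
  have hs := coeff_succ_X_mul (p + 3) ((1 - X : ℤ⟦X⟧) ^ (a + 3))
  simp only [map_add, map_sub, add_mul, coeff_C_mul, coeff_one_sub_X_pow, coeff_X_pow, coeff_X, coeff_one,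
    hs]
  have e1 := Nat.add_one_mul_choose_eq (a + 3) (p + 3)
  have e2 := Nat.choose_succ_succ (a + 3) (p + 3)
  simp only [Nat.succ_eq_add_one, add_assoc, Nat.reduceAdd] at e1 e2 ⊢
  zify at e1 e2
  simp
  rw [pow_add (-1 : ℤ) p 4, pow_add (-1 : ℤ) p 3]
  linear_combination (-1) ^ p * e1 + (-1) ^ p * e2

open PowerSeries in
theorem coeff_chooseSeries_sub_one (n r : ℕ) (hn : 1 ≤ n) :
    coeff r (chooseSeries (n - 1) - 1) = if 1 ≤ r then ((n + r - 1).choose (n - 1) : ℤ) else 0 := by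
  rcases r with _ | r
  · simp [chooseSeries]
  · simp [chooseSeries, coeff_one, show n - 1 + (r + 1) = n + (r + 1) - 1 by omega]

open PowerSeries in
theorem coeff_chooseSeries_sub_one_sub (n r : ℕ) (hn : 1 ≤ n) :
    coeff r (chooseSeries (n - 1) - 1 - C (n : ℤ) * X) =
      if 2 ≤ r then ((n + r - 1).choose (n - 1) : ℤ) else 0 := by
  rw [map_sub, coeff_chooseSeries_sub_one n r hn, coeff_C_mul, coeff_X]
  rcases r with _ | _ | r
  · simp
  · obtain ⟨k, rfl⟩ : ∃ k, n = k + 1 := ⟨n - 1, by omega⟩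
    simp
  · simp

open scoped Classical in
open PowerSeries in
theorem sum_filter_antidiagonalTuple (n : ℕ) (hn : 1 ≤ n) (l N : ℕ) :
    ∑ t ∈ (Finset.Nat.antidiagonalTuple (l + 2) N).filter
        (fun t => (∀ i, 1 ≤ t i) ∧ 2 ≤ t ⟨l, by omega⟩),
      (∏ i : Fin (l + 1), ((n + t i.castSucc - 1).choose (n - 1) : ℤ)) *
        deltaIK n (t (Fin.last (l + 1))) =
    coeff N ((chooseSeries (n - 1) - 1) ^ l * (chooseSeries (n - 1) - 1 - C (n : ℤ) * X) *
      deltaSeries n) := by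
  set H := chooseSeries (n - 1) - 1
  have hprod : H ^ l * (H - C (n : ℤ) * X) * deltaSeries n =
      ∏ i : Fin (l + 2), (Fin.snoc (Fin.snoc (fun _ : Fin l => H) (H - C (n : ℤ) * X) :
        Fin (l + 1) → ℤ⟦X⟧) (deltaSeries n) : Fin (l + 2) → ℤ⟦X⟧) i := by
    simp [Fin.prod_univ_castSucc]
  rw [hprod, coeff_prod_fin, Finset.sum_filter]
  refine Finset.sum_congr rfl fun t _ => ?_
  have hl : (⟨l, by omega⟩ : Fin (l + 2)) = (Fin.last l).castSucc := rfl
  simp only [Fin.prod_univ_castSucc, Fin.snoc_castSucc, Fin.snoc_last, H,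
    coeff_chooseSeries_sub_one n _ hn, coeff_chooseSeries_sub_one_sub n _ hn, deltaSeries, coeff_mk,
    hl]
  split_ifs with h1 h2 h2
  · simp [h1.1]
  · exact absurd h1.2 h2
  · by_cases h0 : t (Fin.last (l + 1)) = 0
    · simp [h0, deltaIK]
    · obtain ⟨i, hi⟩ : ∃ i : Fin l, ¬ 1 ≤ t i.castSucc.castSucc := by
        by_contra! hc
        refine h1 ⟨fun i => ?_, h2⟩
        induction i using Fin.lastCases with
        | last => omega
        | cast i =>
          induction i using Fin.lastCases with
          | last => omega
          | cast i => exact hc i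
      rw [Finset.prod_eq_zero (Finset.mem_univ i) (if_neg hi)]
      simp
  · simp

open PowerSeries in
theorem coeff_mul_pow_mul_eq_zero (F : ℤ⟦X⟧) (n : ℕ) (hn : 1 ≤ n) (L N : ℕ) (hN : N < L + 3) :
    coeff N (F * ((chooseSeries (n - 1) - 1) ^ L *
      (chooseSeries (n - 1) - 1 - C (n : ℤ) * X) * deltaSeries n)) = 0 := by
  have h1 : X ∣ chooseSeries (n - 1) - 1 := by
    rw [X_dvd_iff, ← coeff_zero_eq_constantCoeff_apply, coeff_chooseSeries_sub_one n 0 hn]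
    simp
  have h2 : X ^ 2 ∣ chooseSeries (n - 1) - 1 - C (n : ℤ) * X := by
    rw [X_pow_dvd_iff]
    intro r hr
    rw [coeff_chooseSeries_sub_one_sub n r hn, if_neg (by omega)]
  have h3 : X ∣ deltaSeries n := by
    rw [X_dvd_iff, ← coeff_zero_eq_constantCoeff_apply]
    simp [deltaSeries, deltaIK]
  have h := (mul_dvd_mul (mul_dvd_mul (pow_dvd_pow_of_dvd h1 L) h2) h3).mul_left F
  rw [← pow_add, ← pow_succ, X_pow_dvd_iff] at h
  exact h N hN

open scoped Classical in
/-- For `n ≥ 5` and `5 ≤ m ≤ n+1`,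
`δ_{m−2} + ∑_{ℓ=1}^{m−4} (−1)^ℓ ∑' C(n+r_1−1, n−1)⋯C(n+r_ℓ−1, n−1) δ_s
   = (−1)^m (m−1) C(n+1, m)`,
where the inner sum runs over tuples `(r_1, …, r_ℓ, s)` with
`r_1 + ⋯ + r_ℓ + s = m−2`, `r_1, …, r_{ℓ−1} ≥ 1`, `r_ℓ ≥ 2`, `s ≥ 1`.
(Here the outer summation variable is `l = ℓ − 1`, running over `0, …, m−5`,
a tuple `(r_1, …, r_ℓ, s)` is encoded as `t : Fin (l+2) → ℕ` with
`t ⟨0⟩, …, t ⟨l⟩` the `r`'s and `t (last)` equal to `s`.) -/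
theorem stmt_13 (n : ℕ) (hn : 5 ≤ n) (m : ℕ) (hm1 : 5 ≤ m) (hm2 : m ≤ n + 1) :
    deltaIK n (m - 2) +
      ∑ l ∈ Finset.range (m - 4), (-1 : ℤ) ^ (l + 1) *
        ∑ t ∈ (Finset.Nat.antidiagonalTuple (l + 2) (m - 2)).filter
            (fun t => (∀ i, 1 ≤ t i) ∧ 2 ≤ t ⟨l, by omega⟩),
          (∏ i : Fin (l + 1), ((n + t i.castSucc - 1).choose (n - 1) : ℤ)) *
            deltaIK n (t (Fin.last (l + 1)))
      = (-1 : ℤ) ^ m * ((m : ℤ) - 1) * ((n + 1).choose m) := by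
  obtain ⟨a, rfl⟩ : ∃ a, n = a + 3 := ⟨n - 3, by omega⟩
  simp only [sum_filter_antidiagonalTuple (a + 3) (by omega)]
  set F : PowerSeries ℤ := (1 - PowerSeries.X) ^ (a + 3)
  set G := chooseSeries (a + 3 - 1) - 1 - PowerSeries.C ((a + 3 : ℕ) : ℤ) * PowerSeries.X with hG
  have h2 : a + 3 - 1 = a + 2 := rfl
  have hF : F * (1 + (chooseSeries (a + 3 - 1) - 1)) = 1 := by
    rw [h2]
    linear_combination chooseSeries_mul (a + 2)
  have hsum := congrArg (PowerSeries.coeff (m - 2))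
    (sum_neg_pow_mul_eq hF G (deltaSeries (a + 3)) (m - 4))
  have hcoeff (k : ℕ) (φ : PowerSeries ℤ) : PowerSeries.coeff (m - 2) ((-1) ^ k * φ) =
      (-1) ^ k * PowerSeries.coeff (m - 2) φ := by
    rw [← PowerSeries.coeff_C_mul]
    simp
  rw [map_sum, map_add, hcoeff, coeff_mul_pow_mul_eq_zero F _ (by omega) _ _ (by omega),
    mul_zero, add_zero] at hsum
  simp only [hcoeff] at hsum
  rw [hsum, ← coeff_deltaSeries_mul a m (by omega)]
  have hd : deltaIK (a + 3) (m - 2) = PowerSeries.coeff (m - 2) (deltaSeries (a + 3)) := by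
    simp [deltaSeries]
  rw [hd, ← map_add]
  congr 1
  have hc : PowerSeries.C ((a + 3 : ℕ) : ℤ) = PowerSeries.C (a + 3 : ℤ) := by push_cast; rfl
  rw [hc] at hG
  linear_combination (-deltaSeries (a + 3)) * hF - deltaSeries (a + 3) * F * hG
end

section
/- For all integers n ≥ 2 and d ≥ 2, Σ_{m=0}^{⌊n(d−1)/d⌋} (−1)^{m−1} (m−1) C(n+1, m) C(nd−md−1, n−1) = n·C(d+n−1, n−1) − n² + 1. -/
open Polynomial in
/-- The `N`-th alternating binomial sum of a polynomial of degree less than `N` vanishes. -/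
theorem sum_neg_one_pow_mul_choose_mul_eval_eq_zero {R : Type*} [CommRing R] {P : R[X]} {N : ℕ}
    (hP : P.natDegree < N) :
    ∑ m ∈ Finset.range (N + 1), (-1 : R) ^ m * (N.choose m) * P.eval (m : R) = 0 := by
  have h := congrFun (P.fwdDiff_iter_eq_zero_of_degree_lt hP) 0
  rw [fwdDiff_iter_eq_sum_shift] at h
  have h' := congrArg (fun x => (-1 : R) ^ N * x) h
  simp only [Finset.mul_sum, Pi.zero_apply, mul_zero] at h'
  rw [← h']
  refine Finset.sum_congr rfl fun m hm => ?_
  obtain ⟨j, rfl⟩ := Nat.exists_eq_add_of_le (Nat.lt_succ_iff.mp (Finset.mem_range.mp hm))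
  have hj : (-1 : R) ^ j * (-1) ^ j = 1 := by rw [← mul_pow]; simp
  simp only [Nat.add_sub_cancel_left, zero_add, nsmul_eq_mul, mul_one, zsmul_eq_mul]
  push_cast
  rw [pow_add]
  linear_combination (-(-1 : R) ^ m * ((m + j).choose m) * P.eval (m : R)) * hj

open Polynomial in
/-- The alternating binomial sum of `(m - 1) * C(a - m d, k)`, a polynomial in `m` of degree at
most `k + 1`. -/
theorem sum_neg_one_pow_mul_sub_one_mul_choose_mul_ringChoose_eq_zero (k : ℕ) (a d : ℤ) :
    ∑ m ∈ Finset.range (k + 3),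
      (-1 : ℤ) ^ m * ((k + 2).choose m) * (((m : ℤ) - 1) * Ring.choose (a - m * d) k) = 0 := by
  have hdeg : ((X - C 1) * (descPochhammer ℤ k).comp (C a - C d * X)).natDegree < k + 2 := by
    have h1 : (X - C (1 : ℤ)).natDegree ≤ 1 := natDegree_X_sub_C_le 1
    have h2 : (C a - C d * X).natDegree ≤ 1 := by compute_degree
    have h3 := natDegree_comp_le (p := descPochhammer ℤ k) (q := C a - C d * X)
    rw [descPochhammer_natDegree] at h3
    have h4 := natDegree_mul_le (p := X - C (1 : ℤ))
      (q := (descPochhammer ℤ k).comp (C a - C d * X))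
    have h5 := Nat.mul_le_mul_left k h2
    lia
  have h := sum_neg_one_pow_mul_choose_mul_eval_eq_zero hdeg
  have hk : (k.factorial : ℤ) ≠ 0 := by exact_mod_cast k.factorial_ne_zero
  refine (mul_eq_zero.mp ?_).resolve_left hk
  rw [← h, Finset.mul_sum]
  refine Finset.sum_congr rfl fun m _ => ?_
  have he : (descPochhammer ℤ k).eval (a - d * m) = k.factorial * Ring.choose (a - m * d) k := by
    rw [eval_eq_smeval, Ring.descPochhammer_eq_factorial_smul_choose, nsmul_eq_mul, mul_comm d]
  simp only [eval_mul, eval_sub, eval_X, eval_C, eval_comp, he]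
  ring

/-- For all integers `n ≥ 2` and `d ≥ 2`,
`∑_{m=0}^{⌊n(d−1)/d⌋} (−1)^{m−1} (m−1) C(n+1, m) C(nd−md−1, n−1) = n C(d+n−1, n−1) − n² + 1`. -/
theorem stmt_14 (n d : ℕ) (hn : 2 ≤ n) (hd : 2 ≤ d) :
    ∑ m ∈ Finset.range (n * (d - 1) / d + 1),
      (-1 : ℤ) ^ (m + 1) * ((m : ℤ) - 1) * ((n + 1).choose m) * ((n * d - m * d - 1).choose (n - 1))
      = n * ((d + n - 1).choose (n - 1)) - (n : ℤ) ^ 2 + 1 := by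
  obtain ⟨k, rfl⟩ : ∃ k, n = k + 1 := ⟨n - 1, by lia⟩
  have hd0 : 0 < d := by lia
  have hsub : Finset.range ((k + 1) * (d - 1) / d + 1) ⊆ Finset.range (k + 1) := by
    refine Finset.range_subset_range.mpr (Nat.succ_le_of_lt ((Nat.div_lt_iff_lt_mul hd0).mpr ?_))
    exact Nat.mul_lt_mul_of_pos_left (by lia) (by lia)
  rw [Finset.sum_subset hsub]
  · have h := sum_neg_one_pow_mul_sub_one_mul_choose_mul_ringChoose_eq_zero k ((k + 1) * d - 1) d
    rw [Finset.sum_range_succ, Finset.sum_range_succ] at h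
    have hmain : ∑ m ∈ Finset.range (k + 1), (-1 : ℤ) ^ (m + 1) * ((m : ℤ) - 1) *
          ((k + 1 + 1).choose m) * (((k + 1) * d - m * d - 1).choose (k + 1 - 1)) =
        -∑ m ∈ Finset.range (k + 1), (-1 : ℤ) ^ m * ((k + 2).choose m) *
          (((m : ℤ) - 1) * Ring.choose (((k : ℤ) + 1) * d - 1 - m * d) k) := by
      rw [← Finset.sum_neg_distrib]
      refine Finset.sum_congr rfl fun m hm => ?_
      have hlt : m * d < (k + 1) * d := Nat.mul_lt_mul_of_pos_right (Finset.mem_range.mp hm) hd0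
      have hcast : ((k : ℤ) + 1) * d - 1 - m * d = (((k + 1) * d - m * d - 1 : ℕ) : ℤ) := by
        rw [Nat.cast_sub (by lia), Nat.cast_sub hlt.le]
        push_cast
        ring
      rw [hcast, Ring.choose_natCast, Nat.add_sub_cancel]
      ring
    have hchoose (b : ℕ) : Ring.choose (-((b : ℤ) + 1)) k = (-1) ^ k * ((b + k).choose k : ℤ) := by
      rw [Ring.choose_neg, show (b : ℤ) + 1 + k - 1 = ((b + k : ℕ) : ℤ) by push_cast; ring,
        Ring.choose_natCast]
      simp [Units.smul_def, Int.negOnePow_def]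
    have hn1 : Ring.choose (((k : ℤ) + 1) * d - 1 - ((k + 1 : ℕ) : ℤ) * d) k = (-1) ^ k := by
      have := hchoose 0
      simp only [Nat.cast_zero, zero_add, Nat.choose_self, Nat.cast_one, mul_one] at this
      rw [← this]
      congr 1
      push_cast
      ring
    have hn2 : Ring.choose (((k : ℤ) + 1) * d - 1 - ((k + 2 : ℕ) : ℤ) * d) k =
        (-1) ^ k * ((d + k).choose k : ℤ) := by
      rw [← hchoose d]
      congr 1
      push_cast
      ring
    have hs : (-1 : ℤ) ^ k * (-1) ^ k = 1 := by rw [← mul_pow]; simp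
    rw [hn1, hn2, Nat.choose_succ_self_right, Nat.choose_self, pow_succ, pow_add] at h
    rw [hmain, show d + (k + 1) - 1 = d + k by lia, Nat.add_sub_cancel]
    push_cast at h ⊢
    linear_combination -h + (-((k : ℤ) + 2) * k + (k + 1) * ((d + k).choose k : ℤ)) * hs
  · intro m _ hm
    have hlt : (k + 1) * (d - 1) < m * d := by
      rw [Finset.mem_range, not_lt, Nat.succ_le_iff, Nat.div_lt_iff_lt_mul hd0] at hm
      exact hm
    have hle : (k + 1) * d = (k + 1) * (d - 1) + (k + 1) := by
      obtain ⟨e, rfl⟩ := Nat.exists_eq_add_of_lt hd0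
      simp [Nat.mul_add]
    rw [Nat.choose_eq_zero_of_lt (n := (k + 1) * d - m * d - 1)]
    · simp
    · lia
end

section
/- Let k be a field of characteristic zero and let n ≥ 2 and s ≥ 1 be integers. Consider the k-vector space of all families (A^{i_1⋯i_s}) of skew-symmetric n×n matrices over k, indexed by nondecreasing index tuples 1 ≤ i_1 ≤ ⋯ ≤ i_s ≤ n, satisfying, for every choice of indices 1 ≤ p ≤ i_1 ≤ ⋯ ≤ i_s ≤ n, the linear condition R^p(A^{i_1⋯i_s}) + R^{i_1}(A^{p i_2⋯i_s}) + ⋯ + R^{i_s}(A^{p i_1⋯i_{s−1}}) = 0, where R^i(M) denotes the i-th row of a matrix M and each index tuple such as (p, i_2, …, i_s) is nondecreasing since p ≤ i_1 ≤ ⋯ ≤ i_s. Then the dimension of this vector space over k equals (s(s+1)/2)·C(n+s−1, s+2). -/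
open Matrix in

/-- The space of families `(A^{i_1⋯i_s})`, indexed by nondecreasing tuples
`1 ≤ i_1 ≤ ⋯ ≤ i_s ≤ n`, of skew-symmetric `n×n` matrices over `k` satisfying, for every
nondecreasing tuple `p ≤ i_1 ≤ ⋯ ≤ i_s` (encoded as a monotone `w : Fin (s+1) → Fin n`), the
row condition `R^p(A^{i_1⋯i_s}) + R^{i_1}(A^{p i_2⋯i_s}) + ⋯ + R^{i_s}(A^{p i_1⋯i_{s−1}}) = 0`,
i.e. `∑_t R^{w t}(A^{w with t-th entry removed}) = 0` (stated entrywise in the column `c`). -/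
def skewRowSpace (k : Type*) [Field k] (n s : ℕ) :
    Submodule k ({v : Fin s → Fin n // Monotone v} → Matrix (Fin n) (Fin n) k) where
  carrier := {A | (∀ v, (A v)ᵀ = -(A v)) ∧
    ∀ w : Fin (s + 1) → Fin n, ∀ hw : Monotone w, ∀ c : Fin n,
      ∑ t : Fin (s + 1),
        A ⟨fun j => w (t.succAbove j),
            hw.comp (Fin.strictMono_succAbove t).monotone⟩ (w t) c = 0}
  zero_mem' := by
    refine ⟨fun v => by simp, fun w hw c => by simp⟩
  add_mem' := by
    rintro A B ⟨hA1, hA2⟩ ⟨hB1, hB2⟩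
    refine ⟨fun v => ?_, fun w hw c => ?_⟩
    · simp only [Pi.add_apply, Matrix.transpose_add, hA1 v, hB1 v, neg_add]
    · simp only [Pi.add_apply, Matrix.add_apply]
      rw [Finset.sum_add_distrib, hA2 w hw c, hB2 w hw c, add_zero]
  smul_mem' := by
    rintro a A ⟨hA1, hA2⟩
    refine ⟨fun v => ?_, fun w hw c => ?_⟩
    · simp only [Pi.smul_apply, Matrix.transpose_smul, hA1 v, smul_neg]
    · simp only [Pi.smul_apply, Matrix.smul_apply]
      rw [← Finset.smul_sum, hA2 w hw c, smul_zero]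

section SymmetricTensors

variable {k : Type*} [Field k] {α : Type*} {m : ℕ}

/-- Extension by zero of a function on multisets of size `m` to all multisets. -/
def symExtend (F : Sym α m → k) (u : Multiset α) : k :=
  if h : u.card = m then F (Sym.mk u h) else 0

theorem symExtend_of_card (F : Sym α m → k) {u : Multiset α} (h : u.card = m) :
    symExtend F u = F (Sym.mk u h) :=
  dif_pos h

@[simp]
theorem symExtend_coe (F : Sym α m → k) (w : Sym α m) : symExtend F w.1 = F w :=
  symExtend_of_card F w.2

theorem symExtend_add (F G : Sym α m → k) (u : Multiset α) :
    symExtend (F + G) u = symExtend F u + symExtend G u := by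
  unfold symExtend; split_ifs <;> simp

theorem symExtend_smul (r : k) (F : Sym α m → k) (u : Multiset α) :
    symExtend (r • F) u = r * symExtend F u := by
  unfold symExtend; split_ifs <;> simp

theorem symExtend_neg (F : Sym α m → k) (u : Multiset α) :
    symExtend (-F) u = -symExtend F u := by
  unfold symExtend; split_ifs <;> simp

variable [DecidableEq α]

/-- The symmetrized contraction `G ↦ (w ↦ ∑_{a ∈ w} G_a(w - a))`, which is multiplication of
`∑_a x_a G_a` in divided power coordinates. -/
def symContract (k : Type*) [Field k] (α : Type*) [DecidableEq α] (m : ℕ) :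
    (α → Sym α m → k) →ₗ[k] (Sym α (m + 1) → k) where
  toFun G w := (w.1.map fun a => symExtend (G a) (w.1.erase a)).sum
  map_add' F G := by
    funext w
    simp [symExtend_add, Multiset.sum_map_add]
  map_smul' r F := by
    funext w
    simp [symExtend_smul, Multiset.sum_map_mul_left]

theorem symContract_apply (G : α → Sym α m → k) (w : Sym α (m + 1)) :
    symContract k α m G w = (w.1.map fun a => symExtend (G a) (w.1.erase a)).sum :=
  rfl

theorem symContract_surjective [CharZero k] : Function.Surjective (symContract k α m) := by
  intro H
  refine ⟨fun a μ => ((m : k) + 1)⁻¹ * H (a ::ₛ μ), funext fun w => ?_⟩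
  have key : ∀ a ∈ w.1, symExtend (fun μ => ((m : k) + 1)⁻¹ * H (a ::ₛ μ)) (w.1.erase a) =
      ((m : k) + 1)⁻¹ * H w := fun a ha => by
    rw [symExtend_of_card _ (by rw [Multiset.card_erase_of_mem ha, w.2]; rfl)]
    congr 2
    exact Subtype.ext (Multiset.cons_erase ha)
  have hm : (m : k) + 1 ≠ 0 := by exact_mod_cast m.succ_ne_zero
  rw [symContract_apply, Multiset.map_congr rfl key]
  rw [Multiset.map_const', Multiset.sum_replicate, w.2, nsmul_eq_mul, Nat.cast_succ,
    mul_inv_cancel_left₀ hm]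

/-- Contracting a skew-symmetric family twice gives zero. -/
theorem symContract_symContract [Fintype α] [CharZero k] (F : α → α → Sym α m → k)
    (hF : ∀ a c, F a c = -F c a) :
    symContract k α (m + 1) (fun c => symContract k α m fun a => F a c) = 0 := by
  funext w
  have expand : symContract k α (m + 1) (fun c => symContract k α m fun a => F a c) w =
      ∑ c, ∑ a, ((w.1.count c * (w.1.erase c).count a : ℕ) : k) *
        symExtend (F a c) ((w.1.erase c).erase a) := by
    have hsum : ∀ (u : Multiset α) (f : α → k),
        (u.map f).sum = ∑ a, (u.count a : k) * f a := fun u f => by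
      rw [Finset.sum_multiset_map_count]
      simp only [nsmul_eq_mul]
      refine Finset.sum_subset (Finset.subset_univ _) fun a _ ha => ?_
      rw [Multiset.count_eq_zero_of_notMem (by simpa using ha)]
      simp
    rw [symContract_apply, hsum]
    refine Finset.sum_congr rfl fun c _ => ?_
    by_cases hc : c ∈ w.1
    · rw [symExtend_of_card _ (by rw [Multiset.card_erase_of_mem hc, w.2]; rfl),
        symContract_apply, hsum, Finset.mul_sum]
      refine Finset.sum_congr rfl fun a _ => ?_
      rw [Nat.cast_mul, mul_assoc]
    · rw [Multiset.count_eq_zero_of_notMem hc]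
      simp
  have skew : ∑ c, ∑ a, ((w.1.count c * (w.1.erase c).count a : ℕ) : k) *
        symExtend (F a c) ((w.1.erase c).erase a) =
      -∑ c, ∑ a, ((w.1.count c * (w.1.erase c).count a : ℕ) : k) *
        symExtend (F a c) ((w.1.erase c).erase a) := by
    conv_lhs => rw [Finset.sum_comm]
    simp only [← Finset.sum_neg_distrib]
    refine Finset.sum_congr rfl fun c _ => Finset.sum_congr rfl fun a _ => ?_
    rw [hF c a, symExtend_neg, mul_neg, Multiset.erase_comm]
    rcases eq_or_ne a c with rfl | h
    · rfl
    · rw [Multiset.count_erase_of_ne h.symm, Multiset.count_erase_of_ne h, mul_comm (w.1.count a)]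
  rw [expand]
  exact self_eq_neg.mp skew

/-- Contracting the exterior derivative of a family with zero contraction multiplies the family
by a positive integer. -/
theorem symContract_exterior (G : α → Sym α (m + 1) → k) (hG : symContract k α (m + 1) G = 0)
    (c : α) :
    symContract k α m (fun a μ => G c (a ::ₛ μ) - G a (c ::ₛ μ)) = ((m : k) + 2) • G c := by
  funext w
  have key : ∀ a ∈ w.1, symExtend (fun μ => G c (a ::ₛ μ) - G a (c ::ₛ μ)) (w.1.erase a) =
      G c w - symExtend (G a) ((c ::ₘ w.1).erase a) := fun a ha => by
    have hcard : (w.1.erase a).card = m := by rw [Multiset.card_erase_of_mem ha, w.2]; rfl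
    rw [symExtend_of_card _ hcard, Multiset.erase_cons_tail_of_mem ha,
      symExtend_of_card (G a) (by rw [Multiset.card_cons, hcard])]
    congr 2
    exact Subtype.ext (Multiset.cons_erase ha)
  have h0 := congrFun hG (c ::ₛ w)
  rw [symContract_apply, Sym.val_eq_coe, Sym.coe_cons, Multiset.map_cons, Multiset.sum_cons,
    Multiset.erase_cons_head, ← Sym.val_eq_coe, symExtend_coe] at h0
  rw [symContract_apply, Multiset.map_congr rfl key, Multiset.sum_map_sub]
  simp only [Multiset.map_const', Multiset.sum_replicate, w.2, Pi.smul_apply, smul_eq_mul,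
    nsmul_eq_mul, Pi.zero_apply] at h0 ⊢
  push_cast
  linear_combination -h0

end SymmetricTensors

section SkewMatrices

open Matrix

/-- The space of skew-symmetric matrices. -/
def skewMatrices (k : Type*) [Field k] (n : ℕ) : Submodule k (Matrix (Fin n) (Fin n) k) where
  carrier := {M | Mᵀ = -M}
  zero_mem' := by simp
  add_mem' {A B} hA hB := by
    simp only [Set.mem_ofPred_eq] at *
    rw [transpose_add, hA, hB, neg_add]
  smul_mem' r A hA := by
    simp only [Set.mem_ofPred_eq] at *
    rw [transpose_smul, hA, smul_neg]

variable {k : Type*} [Field k] {n : ℕ}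

theorem mem_skewMatrices {M : Matrix (Fin n) (Fin n) k} : M ∈ skewMatrices k n ↔ Mᵀ = -M :=
  Iff.rfl

theorem skewMatrices_apply (M : skewMatrices k n) (i j : Fin n) : M.1 i j = -M.1 j i :=
  congrFun (congrFun M.2 j) i

variable [CharZero k]

/-- A skew-symmetric matrix is determined by its entries below the diagonal. -/
def skewMatricesEquiv : skewMatrices k n ≃ₗ[k] ((Σ i : Fin n, Fin i) → k) where
  toFun M p := M.1 p.1 (p.2.castLE p.1.2.le)
  map_add' _ _ := rfl
  map_smul' _ _ := rfl
  invFun f := ⟨Matrix.of fun i j => if h : j < i then f ⟨i, j, h⟩ else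
      if h : i < j then -f ⟨j, i, h⟩ else 0, by
    rw [mem_skewMatrices]
    ext i j
    rcases lt_trichotomy i j with h | h | h
    · simp [h, h.not_gt]
    · simp [h]
    · simp [h, h.not_gt]⟩
  left_inv M := by
    ext i j
    rcases lt_trichotomy i j with h | rfl | h
    · simpa [h, h.not_gt] using (skewMatrices_apply M i j).symm
    · simpa using (self_eq_neg.mp (skewMatrices_apply M i i)).symm
    · simp [h]
  right_inv f := by
    funext ⟨i, j⟩
    have h : j.castLE i.2.le < i := j.2
    simp [h]

theorem finrank_skewMatrices : Module.finrank k (skewMatrices k n) = n.choose 2 := by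
  rw [skewMatricesEquiv.finrank_eq, Module.finrank_fintype_fun_eq_card, Fintype.card_sigma]
  simp [Fin.sum_univ_eq_sum_range (fun i => i), Finset.sum_range_id, Nat.choose_two_right]

end SkewMatrices

section Koszul

variable (k : Type*) [Field k] (n m : ℕ)

/-- The Koszul differential from skew-symmetric families to vector families. -/
def skewContract :
    (Sym (Fin n) m → skewMatrices k n) →ₗ[k] (Fin n → Sym (Fin n) (m + 1) → k) :=
  LinearMap.pi fun c => symContract k (Fin n) m ∘ₗ LinearMap.pi fun a => LinearMap.pi fun μ =>
    Matrix.entryLinearMap k k a c ∘ₗ (skewMatrices k n).subtype ∘ₗ LinearMap.proj μ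

variable {k n m}

theorem skewContract_apply (F : Sym (Fin n) m → skewMatrices k n) (c : Fin n) :
    skewContract k n m F c = symContract k (Fin n) m fun a μ => (F μ).1 a c :=
  rfl

theorem range_skewContract [CharZero k] :
    LinearMap.range (skewContract k n m) = LinearMap.ker (symContract k (Fin n) (m + 1)) := by
  apply le_antisymm
  · rintro _ ⟨F, rfl⟩
    exact symContract_symContract (fun a c μ => (F μ).1 a c)
      fun a c => funext fun μ => skewMatrices_apply (F μ) a c
  · intro G hG
    have hm : (m : k) + 2 ≠ 0 := by exact_mod_cast (m + 1).succ_ne_zero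
    refine ⟨((m : k) + 2)⁻¹ • fun μ => ⟨Matrix.of fun a c => G c (a ::ₛ μ) - G a (c ::ₛ μ), by
      rw [mem_skewMatrices]
      ext a c
      simp⟩, ?_⟩
    · rw [map_smul, inv_smul_eq_iff₀ hm]
      funext c
      exact symContract_exterior G hG c

theorem finrank_ker_skewContract [CharZero k] :
    Module.finrank k (LinearMap.ker (skewContract k n m)) +
        n * Fintype.card (Sym (Fin n) (m + 1)) =
      Fintype.card (Sym (Fin n) m) * n.choose 2 + Fintype.card (Sym (Fin n) (m + 2)) := by
  have h1 := (skewContract k n m).finrank_range_add_finrank_ker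
  have h2 := (symContract k (Fin n) (m + 1)).finrank_range_add_finrank_ker
  rw [LinearMap.range_eq_top.mpr symContract_surjective, finrank_top] at h2
  rw [range_skewContract] at h1
  simp only [Module.finrank_pi_fintype, finrank_skewMatrices, Module.finrank_self,
    Finset.sum_const, Finset.card_univ, smul_eq_mul, mul_one, Fintype.card_fin, add_assoc, Nat.reduceAdd] at h1 h2
  omega

end Koszul

section MonotoneTuples

/-- The multiset of entries of a tuple. -/
def tupleSym {α : Type*} {s : ℕ} (v : Fin s → α) : Sym α s :=
  ⟨Finset.univ.val.map v, by simp⟩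

theorem tupleSym_erase {α : Type*} [DecidableEq α] {s : ℕ} (w : Fin (s + 1) → α)
    (t : Fin (s + 1)) :
    (tupleSym w).1.erase (w t) = (tupleSym fun j => w (t.succAbove j)).1 := by
  simp [tupleSym, Fin.univ_succAbove s t, Function.comp_def]

theorem symContract_tupleSym {k α : Type*} [Field k] [DecidableEq α] {s : ℕ}
    (G : α → Sym α s → k) (w : Fin (s + 1) → α) :
    symContract k α s G (tupleSym w) =
      ∑ t, G (w t) (tupleSym fun j => w (t.succAbove j)) := by
  rw [symContract_apply]
  conv_lhs => rw [tupleSym, Multiset.map_map]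
  refine Finset.sum_congr rfl fun t _ => ?_
  exact (congrArg _ (tupleSym_erase w t)).trans (symExtend_coe _ _)

theorem tupleSym_val {α : Type*} {s : ℕ} (v : Fin s → α) :
    (tupleSym v).1 = (List.ofFn v : Multiset α) := by
  simp [tupleSym, List.ofFn_eq_map]

theorem tupleSym_bijective (α : Type*) [LinearOrder α] (s : ℕ) :
    Function.Bijective fun v : {v : Fin s → α // Monotone v} => tupleSym v.1 := by
  constructor
  · rintro ⟨v, hv⟩ ⟨u, hu⟩ h
    have h' := congrArg Subtype.val h
    simp only [tupleSym_val, Multiset.coe_eq_coe] at h'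
    exact Subtype.ext (List.ofFn_injective (h'.eq_of_sortedLE hv.sortedLE_ofFn hu.sortedLE_ofFn))
  · rintro ⟨u, rfl⟩
    have hl : u.sort.length = u.card := Multiset.length_sort _
    refine ⟨⟨fun i => u.sort.get (i.cast hl.symm), fun i j hij =>
      (Multiset.pairwise_sort u (· ≤ ·)).sortedLE.monotone_get hij⟩, Subtype.ext ?_⟩
    rw [tupleSym_val]
    conv_rhs => rw [← Multiset.sort_eq u (· ≤ ·)]
    congr 1
    apply List.ext_get
    · simp
    · simp

/-- Monotone tuples correspond to multisets. -/
noncomputable def monotoneEquivSym (α : Type*) [LinearOrder α] (s : ℕ) :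
    {v : Fin s → α // Monotone v} ≃ Sym α s :=
  Equiv.ofBijective _ (tupleSym_bijective α s)

theorem monotoneEquivSym_apply {α : Type*} [LinearOrder α] {s : ℕ}
    (v : {v : Fin s → α // Monotone v}) : monotoneEquivSym α s v = tupleSym v.1 :=
  rfl

end MonotoneTuples

/-- The space of the row conditions is the kernel of the Koszul differential. -/
noncomputable def skewRowSpaceEquiv (k : Type*) [Field k] (n s : ℕ) :
    LinearMap.ker (skewContract k n s) ≃ₗ[k] skewRowSpace k n s where
  toFun F := ⟨fun v => (F.1 (monotoneEquivSym _ s v)).1,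
    fun v => (F.1 (monotoneEquivSym _ s v)).2, fun w hw c =>
      (symContract_tupleSym (fun a μ => (F.1 μ).1 a c) w).symm.trans
        (congrFun (congrFun F.2 c) (tupleSym w))⟩
  map_add' _ _ := rfl
  map_smul' _ _ := rfl
  invFun A := ⟨fun μ => ⟨A.1 ((monotoneEquivSym _ s).symm μ), A.2.1 _⟩, by
    rw [LinearMap.mem_ker]
    funext c μ
    obtain ⟨⟨w, hw⟩, rfl⟩ := (monotoneEquivSym (Fin n) (s + 1)).surjective μ
    rw [monotoneEquivSym_apply, skewContract_apply, symContract_tupleSym]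
    refine (Finset.sum_congr rfl fun t _ => ?_).trans (A.2.2 w hw c)
    exact congrArg (fun v => A.1 v (w t) c) ((Equiv.symm_apply_eq _).mpr rfl)⟩
  left_inv F := by
    ext μ
    simp
  right_inv A := by
    ext v
    simp

theorem choose_koszul_identity (m s : ℕ) :
    (s * (s + 1) / 2 * (m + s + 1).choose (s + 2)) + (m + 2) * (m + s + 2).choose (s + 1) =
      (m + s + 1).choose s * (m + 2).choose 2 + (m + s + 3).choose (s + 2) := by
  have h1 := Nat.choose_succ_right_eq (m + s + 1) s
  have h2 := Nat.choose_succ_right_eq (m + s + 1) (s + 1)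
  rw [show m + s + 1 - s = m + 1 by omega] at h1
  rw [show m + s + 1 - (s + 1) = m by omega] at h2
  have h3 := Nat.choose_two_right (m + 2)
  have h4 : (m + 2) * (m + 1) / 2 * 2 = (m + 2) * (m + 1) :=
    Nat.div_mul_cancel (Nat.even_mul_pred_self (m + 2)).two_dvd
  have h5 : s * (s + 1) / 2 * 2 = s * (s + 1) :=
    Nat.div_mul_cancel (Nat.even_mul_succ_self s).two_dvd
  rw [show m + 2 - 1 = m + 1 from rfl] at h3
  rw [h3, Nat.choose_succ_succ (m + s + 2) (s + 1),
    Nat.choose_succ_succ (m + s + 1) (s + 1), Nat.choose_succ_succ (m + s + 1) s]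
  simp only [Nat.succ_eq_add_one, show s + 1 + 1 = s + 2 from rfl] at *
  generalize (m + s + 1).choose s = a at *
  generalize (m + s + 1).choose (s + 1) = b at *
  generalize (m + s + 1).choose (s + 2) = c at *
  generalize (m + 2) * (m + 1) / 2 = d at *
  generalize s * (s + 1) / 2 = e at *
  zify at *
  apply mul_left_cancel₀ (two_ne_zero (α := ℤ))
  linear_combination c * h5 - a * h4 + (s - 1) * h2 + m * h1

/-- For a field `k` of characteristic zero, `n ≥ 2` and `s ≥ 1`, the space of families of
skew-symmetric matrices satisfying the row conditions has dimension
`(s(s+1)/2)·C(n+s−1, s+2)`. -/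
theorem stmt_15 {k : Type*} [Field k] [CharZero k]
    (n s : ℕ) (hn : 2 ≤ n) (hs : 1 ≤ s) :
    Module.finrank k (skewRowSpace k n s) = s * (s + 1) / 2 * ((n + s - 1).choose (s + 2)) := by
  obtain ⟨m, rfl⟩ := Nat.exists_eq_add_of_le' hn
  have h := finrank_ker_skewContract (k := k) (n := m + 2) (m := s)
  rw [(skewRowSpaceEquiv k (m + 2) s).finrank_eq] at h
  simp only [Sym.card_sym_eq_choose, Fintype.card_fin] at h
  have h' := choose_koszul_identity m s
  rw [show m + 2 + (s + 1) - 1 = m + s + 2 by omega, show m + 2 + s - 1 = m + s + 1 by omega,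
    show m + 2 + (s + 2) - 1 = m + s + 3 by omega] at h
  rw [show m + 2 + s - 1 = m + s + 1 by omega]
  omega
end
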